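/- Hölder regularity of the solution: Under the assumptions U ∈ C²(ℂ;ℝ), U(ψ) = u(|ψ|²), U(z) ≥ A − B|z|² (A ∈ ℝ, B > 0), and φ ∈ H¹(ℝ), the solution ψ of the Duhamel equation with initial data φ is Hölder continuous of exponent 1/4 on ℝ×ℝ: there exists C > 0 such that |ψ(x,t) − ψ(x',t')| ≤ C(|x−x'|^{1/4} + |t−t'|^{1/4}) for all (x,t), (x',t') ∈ ℝ×ℝ. -/

import Mathlib

/-!  Common framework for the Schrödinger equation coupled to a nonlinear
oscillator (point nonlinearity), following Komech–Komech.

The Sobolev space `H¹(ℝ)` is described through the Fourier side: an element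
of `H¹(ℝ)` is (identified with) a measurable function `hat : ℝ → ℂ`
(its Fourier transform, nonunitary convention `φ̂(k) = ∫ e^{-ikx} φ(x) dx`)
such that `(1+k²)^{1/2} φ̂ ∈ L²(ℝ)`.  Since `φ̂ ∈ L¹`, the continuous
representative `φ(x) = (2π)⁻¹ ∫ e^{ikx} φ̂(k) dk` is defined pointwise, so
`φ(0)` makes sense.  Plancherel gives `‖φ‖²_{L²} = (2π)⁻¹∫|φ̂|²` and
`‖φ'‖²_{L²} = (2π)⁻¹∫ k²|φ̂|²`. -/

noncomputable section

open MeasureTheory Real Set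

namespace SNLS

/-- The Sobolev space `H¹(ℝ)`, described via the Fourier transform. -/
structure H1 : Type where
  hat : ℝ → ℂ
  meas : AEStronglyMeasurable hat (volume : Measure ℝ)
  finite : Integrable (fun k : ℝ => (1 + k ^ 2) * ‖hat k‖ ^ 2) volume

namespace H1

/-- The continuous (pointwise defined) representative of `φ ∈ H¹(ℝ)`:
the inverse Fourier transform, which converges absolutely. -/
def toFun (φ : H1) : ℝ → ℂ := fun x =>
  (2 * π)⁻¹ * ∫ k : ℝ, Complex.exp (Complex.I * ((k * x : ℝ) : ℂ)) * φ.hat k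

/-- `‖φ‖²_{L²} = ∫_ℝ |φ(x)|² dx`, computed on the Fourier side (Plancherel). -/
def l2NormSq (φ : H1) : ℝ := (2 * π)⁻¹ * ∫ k : ℝ, ‖φ.hat k‖ ^ 2

/-- `‖φ'‖²_{L²} = ∫_ℝ |φ'(x)|² dx`, computed on the Fourier side. -/
def derivL2NormSq (φ : H1) : ℝ := (2 * π)⁻¹ * ∫ k : ℝ, k ^ 2 * ‖φ.hat k‖ ^ 2

/-- `‖φ‖²_{H¹} = ‖φ‖²_{L²} + ‖φ'‖²_{L²}`. -/
def normSq (φ : H1) : ℝ := (2 * π)⁻¹ * ∫ k : ℝ, (1 + k ^ 2) * ‖φ.hat k‖ ^ 2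

/-- The `H¹` norm. -/
def norm (φ : H1) : ℝ := Real.sqrt φ.normSq

/-- The `H¹` distance. -/
def dist (φ ψ : H1) : ℝ :=
  Real.sqrt ((2 * π)⁻¹ * ∫ k : ℝ, (1 + k ^ 2) * ‖φ.hat k - ψ.hat k‖ ^ 2)

/-- The `H¹` inner product `⟨f,g⟩_{H¹} = ⟨f,g⟩_{L²} + ⟨f',g'⟩_{L²}`,
computed on the Fourier side. -/
def inner (φ ψ : H1) : ℂ :=
  (2 * π)⁻¹ * ∫ k : ℝ, ((1 + k ^ 2 : ℝ) : ℂ) * (starRingEnd ℂ (φ.hat k) * ψ.hat k)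

/-- Continuity of a curve in `H¹` on a set of times, w.r.t. the `H¹` distance. -/
def ContOn (Ψ : ℝ → H1) (S : Set ℝ) : Prop :=
  ∀ t₀ ∈ S, ∀ δ > 0, ∃ η > 0, ∀ t ∈ S, |t - t₀| < η → dist (Ψ t) (Ψ t₀) < δ

end H1

/-- The free Schrödinger group `W_t`, defined by `(W_tφ)^(k) = e^{ik²t} φ̂(k)`;
equivalently `(W_tφ)(x) = (2π)⁻¹ ∫ e^{ikx} e^{ik²t} φ̂(k) dk`. -/
def W (t : ℝ) (φ : H1) : ℝ → ℂ := fun x =>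
  (2 * π)⁻¹ * ∫ k : ℝ, Complex.exp (Complex.I * ((k * x + k ^ 2 * t : ℝ) : ℂ)) * φ.hat k

/-- The charge `Q(φ) = ½ ∫_ℝ |φ|² dx`. -/
def charge (φ : H1) : ℝ := (1 / 2) * φ.l2NormSq

/-- The energy `𝓗(φ) = ½ ∫_ℝ |φ'|² dx + U(φ(0))`. -/
def energy (U : ℂ → ℝ) (φ : H1) : ℝ := (1 / 2) * φ.derivL2NormSq + U (φ.toFun 0)

/-- The gradient `∇_ψ U` of `U : ℂ → ℝ` with respect to `(Re ψ, Im ψ)`,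
viewed as a complex number. -/
def grad (U : ℂ → ℝ) (z : ℂ) : ℂ :=
  ((fderiv ℝ U z 1 : ℝ) : ℂ) + ((fderiv ℝ U z Complex.I : ℝ) : ℂ) * Complex.I

/-- The nonlinearity `F(ψ) = -∇_ψ U(ψ)`. -/
def nonlin (U : ℂ → ℝ) (z : ℂ) : ℂ := -grad U z

/-- The kernel `(2πs)^{-1/2} e^{ix²/(2s)}` of the free propagator applied to
`δ(x)` (principal branch of the square root for negative times). -/
def freeKernel (s x : ℝ) : ℂ :=
  ((2 * π * s : ℝ) : ℂ) ^ (-(1 / 2 : ℂ)) *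
    Complex.exp (Complex.I * ((x ^ 2 : ℝ) : ℂ) / ((2 * s : ℝ) : ℂ))

/-- `ψ` solves, for all times in `S`, the Duhamel equation
`ψ(x,t) = W_tφ(x) − ∫_0^t (2πs)^{−1/2} e^{ix²/(2s)} F(ψ(0,t−s)) ds`
for the Schrödinger equation with point nonlinearity `F` and data `φ`. -/
def IsDuhamelSolution (F : ℂ → ℂ) (φ : H1) (ψ : ℝ → ℝ → ℂ) (S : Set ℝ) : Prop :=
  ∀ x : ℝ, ∀ t ∈ S,
    ψ x t = W t φ x - ∫ s in (0 : ℝ)..t, freeKernel s x * F (ψ 0 (t - s))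

/-- `ψ ∈ C_b(ℝ × S; ℂ)`: bounded and continuous on `ℝ × S`. -/
def CbOn (ψ : ℝ → ℝ → ℂ) (S : Set ℝ) : Prop :=
  ContinuousOn (fun p : ℝ × ℝ => ψ p.1 p.2) (Set.univ ×ˢ S) ∧
    ∃ M : ℝ, ∀ x : ℝ, ∀ t ∈ S, ‖ψ x t‖ ≤ M

/-- `t ↦ ψ(·,t)` takes values in `H¹(ℝ)` and is `H¹`-continuous on `S`. -/
def ContH1On (ψ : ℝ → ℝ → ℂ) (S : Set ℝ) : Prop :=
  ∃ Ψ : ℝ → H1, (∀ t ∈ S, ∀ x : ℝ, (Ψ t).toFun x = ψ x t) ∧ H1.ContOn Ψ S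

/-- A mollifying profile: `ρ₁ ∈ C₀^∞`, nonnegative, supported in `[-1,1]`,
of total integral `1`. -/
structure Mollifier : Type where
  ρ : ℝ → ℝ
  smooth : ContDiff ℝ (⊤ : ℕ∞) ρ
  supp : ∀ x : ℝ, x ∉ Set.Icc (-1 : ℝ) 1 → ρ x = 0
  nonneg : ∀ x : ℝ, 0 ≤ ρ x
  total : (∫ x : ℝ, ρ x) = 1

/-- `ρ_ε(x) = ε⁻¹ ρ₁(x/ε)`. -/
def rho (m : Mollifier) (ε : ℝ) : ℝ → ℝ := fun x => ε⁻¹ * m.ρ (x / ε)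

/-- The pairing `⟨g, ψ⟩ = ∫_ℝ g(x) ψ(x) dx`. -/
def pair (g : ℝ → ℝ) (ψ : ℝ → ℂ) : ℂ := ∫ x : ℝ, (g x : ℂ) * ψ x

/-- The `H¹` norm of an ordinary (smooth) function. -/
def h1NormFun (g : ℝ → ℝ) : ℝ :=
  Real.sqrt ((∫ x : ℝ, g x ^ 2) + ∫ x : ℝ, deriv g x ^ 2)

/-- The Fourier transform `ĝ(k) = ∫ e^{-ikx} g(x) dx` of a real function. -/
def fourierHatR (g : ℝ → ℝ) : ℝ → ℂ := fun k =>
  ∫ x : ℝ, Complex.exp (-(Complex.I * ((k * x : ℝ) : ℂ))) * (g x : ℂ)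

/-- The curve `Ψ : ℝ → H¹` solves, for times in `S`, the regularized Duhamel
equation `ψ_ε(t) = W_tφ − ∫_0^t W_s[ρ_ε · F(⟨ρ_ε, ψ_ε(t−s)⟩)] ds`
(with `g = ρ_ε`), written on the Fourier side, where it reads
`ψ̂_ε(t)(k) = e^{ik²t}φ̂(k) − ∫_0^t e^{ik²s} ĝ(k) F(⟨g, ψ_ε(t−s)⟩) ds`. -/
def IsRegularizedSolution (F : ℂ → ℂ) (g : ℝ → ℝ) (φ : H1) (Ψ : ℝ → H1)
    (S : Set ℝ) : Prop :=
  ∀ t ∈ S, ∀ k : ℝ,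
    (Ψ t).hat k =
      Complex.exp (Complex.I * ((k ^ 2 * t : ℝ) : ℂ)) * φ.hat k -
        ∫ s in (0 : ℝ)..t,
          Complex.exp (Complex.I * ((k ^ 2 * s : ℝ) : ℂ)) * fourierHatR g k *
            F (pair g (Ψ (t - s)).toFun)

/-- The regularized energy `𝓗_ε(ψ) = ½‖ψ'‖²_{L²} + U(⟨ρ_ε, ψ⟩)` (with `g = ρ_ε`). -/
def energyReg (U : ℂ → ℝ) (g : ℝ → ℝ) (φ : H1) : ℝ :=
  (1 / 2) * φ.derivL2NormSq + U (pair g φ.toFun)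

end SNLS
section
open Filter Topology
namespace SNLS
/-- the complex Gaussian integral -/
def EE (ε u : ℝ) : ℂ := ((π : ℂ) / ((ε : ℂ) - Complex.I * (u : ℂ))) ^ (1 / 2 : ℂ)

lemma EE_int {ε : ℝ} (hε : 0 < ε) (u : ℝ) :
    ∫ k : ℝ, Complex.exp (-((ε : ℂ) - Complex.I * (u : ℂ)) * (k : ℂ) ^ 2) = EE ε u := by
  apply integral_gaussian_complex
  simpa using hε

lemma EE_b_ne {ε u : ℝ} (h : ε ≠ 0 ∨ u ≠ 0) : ((ε : ℂ) - Complex.I * (u : ℂ)) ≠ 0 := by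
  intro h0
  have h1 := congrArg Complex.re h0
  have h2 := congrArg Complex.im h0
  simp at h1 h2
  rcases h with h | h
  · exact h h1
  · exact h h2

lemma EE_sq (ε u : ℝ) : (EE ε u) ^ 2 = (π : ℂ) / ((ε : ℂ) - Complex.I * (u : ℂ)) := by
  unfold EE
  have := Complex.cpow_nat_inv_pow ((π : ℂ) / ((ε : ℂ) - Complex.I * (u : ℂ))) (n := 2) (by norm_num)
  convert this using 3
  norm_num

lemma EE_norm_sq (ε u : ℝ) : ‖EE ε u‖ ^ 2 = π / ‖((ε : ℂ) - Complex.I * (u : ℂ))‖ := by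
  rw [← norm_pow, EE_sq, norm_div]
  simp [abs_of_pos Real.pi_pos]

lemma b_norm_ge (ε u : ℝ) : |u| ≤ ‖((ε : ℂ) - Complex.I * (u : ℂ))‖ := by
  have := Complex.abs_im_le_norm ((ε : ℂ) - Complex.I * (u : ℂ))
  simpa using this

lemma EE_norm_le (ε u : ℝ) (hu : u ≠ 0) : ‖EE ε u‖ ≤ √π * (√|u|)⁻¹ := by
  have h0 : 0 < |u| := abs_pos.mpr hu
  have h : ‖EE ε u‖ ^ 2 ≤ (√π * (√|u|)⁻¹) ^ 2 := by
    rw [EE_norm_sq, mul_pow, inv_pow, Real.sq_sqrt Real.pi_pos.le, Real.sq_sqrt h0.le,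
      ← div_eq_mul_inv]
    exact div_le_div_of_nonneg_left Real.pi_pos.le h0 (b_norm_ge ε u)
  exact le_of_sq_le_sq h (by positivity)

lemma EE_re_nonneg (ε u : ℝ) : 0 ≤ (EE ε u).re := by
  unfold EE
  set z : ℂ := (π : ℂ) / ((ε : ℂ) - Complex.I * (u : ℂ))
  by_cases hz : z = 0
  · rw [hz]; rw [Complex.zero_cpow (by norm_num)]; simp
  have h1 := Complex.abs_arg_le_pi z
  rw [Complex.cpow_def_of_ne_zero hz, Complex.exp_re]
  apply mul_nonneg (Real.exp_pos _).le
  apply Real.cos_nonneg_of_mem_Icc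
  have : (Complex.log z * (1 / 2 : ℂ)).im = z.arg / 2 := by
    have : (1 / 2 : ℂ) = ((1 / 2 : ℝ) : ℂ) := by norm_num
    rw [this, Complex.im_mul_ofReal, Complex.log_im]; ring
  rw [this]
  rw [abs_le] at h1
  constructor <;> linarith [h1.1, h1.2]

lemma EE_re_ge {ε : ℝ} (hε : 0 ≤ ε) (u : ℝ) : |(EE ε u).im| ≤ (EE ε u).re := by
  have h := congrArg Complex.re (EE_sq ε u)
  have h2 : 0 ≤ ((π : ℂ) / ((ε : ℂ) - Complex.I * (u : ℂ))).re := by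
    rw [Complex.div_re]
    simp
    have := Complex.normSq_nonneg ((ε : ℂ) - Complex.I * (u : ℂ))
    positivity
  rw [← h, sq, Complex.mul_re] at h2
  apply abs_le_of_sq_le_sq _ (EE_re_nonneg ε u)
  nlinarith

lemma EE_conj (ε u : ℝ) (hu : 0 ≤ ε) (hu' : u ≠ 0 ∨ 0 < ε) : 
    (starRingEnd ℂ) (EE ε u) = EE ε (-u) := by
  unfold EE
  have hb : ((ε : ℂ) - Complex.I * (u : ℂ)) ≠ 0 := EE_b_ne (by
    rcases hu' with h | h
    · exact Or.inr h
    · exact Or.inl h.ne')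
  have key := Complex.cpow_conj ((π : ℂ) / ((ε : ℂ) - Complex.I * (u : ℂ))) (1 / 2 : ℂ) (by
    intro harg
    rw [Complex.arg_eq_pi_iff] at harg
    have := harg.1
    rw [Complex.div_re] at this
    simp at this
    have h3 : 0 ≤ π * ε / (Complex.normSq (↑ε - Complex.I * ↑u)) := by
      have := Complex.normSq_nonneg (↑ε - Complex.I * ↑u)
      positivity
    linarith)
  have e1 : (starRingEnd ℂ) (1 / 2 : ℂ) = 1 / 2 := by
    have : (1 / 2 : ℂ) = ((1 / 2 : ℝ) : ℂ) := by norm_num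
    rw [this, Complex.conj_ofReal]
  rw [e1] at key
  rw [key, Complex.conj_conj]
  congr 1
  simp

lemma EE_tendsto {u : ℝ} (hu : u ≠ 0) :
    Tendsto (fun ε : ℝ => EE ε u) (𝓝[>] 0) (𝓝 (EE 0 u)) := by
  have hb : (((0 : ℝ) : ℂ) - Complex.I * (u : ℂ)) ≠ 0 := EE_b_ne (Or.inr hu)
  have : ContinuousAt (fun ε : ℝ => EE ε u) 0 := by
    unfold EE
    apply ContinuousAt.cpow
    · exact ContinuousAt.div (f := fun _ : ℝ => (π : ℂ)) (g := fun x : ℝ => (x : ℂ) - Complex.I * (u : ℂ)) continuousAt_const (by fun_prop) hb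
    · exact continuousAt_const
    · rw [Complex.mem_slitPlane_iff]
      right
      rw [Complex.div_im]
      simp
      exact hu
  exact this.tendsto.mono_left nhdsWithin_le_nhds

lemma EE_zero {u : ℝ} (hu : u ≠ 0) :
    (EE 0 u).re + (EE 0 u).im = √(2 * π) * (√u)⁻¹ := by
  have hre := congrArg Complex.re (EE_sq 0 u)
  have him := congrArg Complex.im (EE_sq 0 u)
  have h0 := EE_re_ge le_rfl u
  rw [sq, Complex.mul_re, Complex.div_re] at hre
  rw [sq, Complex.mul_im, Complex.div_im] at him
  simp [Complex.normSq_apply] at hre him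
  rw [abs_le] at h0
  set a := (EE 0 u).re
  set b := (EE 0 u).im
  have hab : a = b ∨ a = -b := by
    rcases mul_self_eq_mul_self_iff.mp (sub_eq_zero.mp hre) with h | h
    · exact Or.inl h
    · exact Or.inr h
  have hu2 : -(-(π * u) / (u * u)) = π / u := by field_simp
  rw [hu2] at him
  rcases lt_or_gt_of_ne hu with h | h
  · rw [Real.sqrt_eq_zero_of_nonpos h.le]
    rcases hab with h1 | h1
    · exfalso
      have : π / u < 0 := div_neg_of_pos_of_neg Real.pi_pos h
      nlinarith [mul_self_nonneg a]
    · simp; linarith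
  · have h3 : a = b := by
      rcases hab with h1 | h1
      · exact h1
      · have : 0 < π / u := by positivity
        nlinarith [mul_self_nonneg a]
    have h4 : (a + b) ^ 2 = (√(2 * π) * (√u)⁻¹) ^ 2 := by
      rw [mul_pow, inv_pow, Real.sq_sqrt (by positivity), Real.sq_sqrt h.le, ← h3]
      rw [← h3] at him
      have : 2 * π * u⁻¹ = 2 * (π / u) := by ring
      rw [this, ← him]; ring
    exact (pow_left_inj₀ (by linarith [h0.1]) (by positivity) two_ne_zero).mp h4

lemma EE_diff {ε u : ℝ} (h0 : 0 < ε) (h1 : ε < 1) (hu : 0 < u) :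
    ‖EE ε u - EE 1 u‖ ≤ √π * (u * √u)⁻¹ := by
  set z := EE ε u with hz
  set w := EE 1 u with hw
  set b := ((ε : ℂ) - Complex.I * (u : ℂ)) with hb
  set b' := (((1 : ℝ) : ℂ) - Complex.I * (u : ℂ)) with hb'
  have hb0 : b ≠ 0 := EE_b_ne (Or.inr hu.ne')
  have hb0' : b' ≠ 0 := EE_b_ne (Or.inr hu.ne')
  have hbn : u ≤ ‖b‖ := (le_abs_self u).trans (b_norm_ge ε u)
  have hbn' : u ≤ ‖b'‖ := (le_abs_self u).trans (b_norm_ge 1 u)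
  have e1 : ‖z‖ ^ 2 = π / ‖b‖ := EE_norm_sq ε u
  have e2 : (z - w) * (z + w) = π * (1 - ε) / (b * b') := by
    have : (z - w) * (z + w) = z ^ 2 - w ^ 2 := by ring
    rw [this, hz, hw, EE_sq, EE_sq, ← hb, ← hb']
    field_simp
    rw [hb, hb']; push_cast; ring
  have e3 : ‖z‖ ≤ ‖z + w‖ := by
    apply le_of_sq_le_sq _ (norm_nonneg _)
    rw [← Complex.normSq_eq_norm_sq, ← Complex.normSq_eq_norm_sq, Complex.normSq_apply, Complex.normSq_apply]
    simp only [Complex.add_re, Complex.add_im]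
    have g1 := EE_re_ge h0.le u
    have g2 := EE_re_ge zero_le_one u
    rw [← hz] at g1
    rw [← hw] at g2
    have : |z.im * w.im| ≤ z.re * w.re := by
      rw [abs_mul]; exact mul_le_mul g1 g2 (abs_nonneg _) (EE_re_nonneg _ _)
    have := (abs_le.mp this).1
    nlinarith [mul_self_nonneg w.re, mul_self_nonneg w.im]
  have e4 : ‖z - w‖ * ‖z + w‖ ≤ π / (‖b‖ * ‖b'‖) := by
    rw [← norm_mul, e2, norm_div, norm_mul, norm_mul]
    have h5 : ‖(1 - ε : ℂ)‖ ≤ 1 := by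
      have : (1 - ε : ℂ) = ((1 - ε : ℝ) : ℂ) := by push_cast; rfl
      rw [this, Complex.norm_real, Real.norm_eq_abs, abs_le]; constructor <;> linarith
    have h6 : ‖(π : ℂ)‖ = π := by simp [abs_of_pos Real.pi_pos]
    rw [h6]
    gcongr
    nlinarith [Real.pi_pos]
  have hzpos : 0 < ‖z‖ := by
    have : 0 < ‖z‖ ^ 2 := by rw [e1]; have := norm_pos_iff.mpr hb0; positivity
    by_contra hc
    have : ‖z‖ = 0 := le_antisymm (not_lt.mp hc) (norm_nonneg _)
    simp [this] at *
  have e5 : ‖z - w‖ * ‖z‖ ≤ ‖z‖ ^ 2 / u := by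
    calc ‖z - w‖ * ‖z‖ ≤ ‖z - w‖ * ‖z + w‖ := by gcongr
      _ ≤ π / (‖b‖ * ‖b'‖) := e4
      _ = ‖z‖ ^ 2 / ‖b'‖ := by rw [e1, div_div]
      _ ≤ _ := by gcongr
  have e6 : ‖z - w‖ ≤ ‖z‖ / u := by
    have : ‖z‖ ^ 2 / u = (‖z‖ / u) * ‖z‖ := by ring
    rw [this] at e5
    exact le_of_mul_le_mul_right e5 hzpos
  have e7 := EE_norm_le ε u hu.ne'
  rw [abs_of_pos hu] at e7
  calc ‖z - w‖ ≤ ‖z‖ / u := e6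
    _ ≤ (√π * (√u)⁻¹) / u := by gcongr
    _ = _ := by rw [mul_inv]; ring

/-- truncated time Fourier integral at frequency `σ k²` -/
def uh (f : ℝ → ℂ) (T σ k : ℝ) : ℂ :=
  ∫ s in Ioc 0 T, Complex.exp (Complex.I * ((σ * k ^ 2 * s : ℝ) : ℂ)) * f s

def SS (f : ℝ → ℂ) (T k : ℝ) : ℝ := ‖uh f T 1 k‖ ^ 2 + ‖uh f T (-1) k‖ ^ 2

def Gs (σ : ℝ) (a : ℝ → ℂ) (t : ℝ) : ℂ :=
  ∫ k : ℝ, Complex.exp (Complex.I * ((σ * k ^ 2 * t : ℝ) : ℂ)) * a k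

def yT (f : ℝ → ℂ) (T t : ℝ) : ℂ := ∫ s in Ioc 0 T, (((√(t - s))⁻¹ : ℝ) : ℂ) * f s

lemma norm_eI (x : ℝ) : ‖Complex.exp (Complex.I * (x : ℂ))‖ = 1 := by
  rw [mul_comm]; exact Complex.norm_exp_ofReal_mul_I x

/-- regularised amplitude -/
def au (f : ℝ → ℂ) (T ε σ k : ℝ) : ℂ := (Real.exp (-ε * k ^ 2) : ℂ) * uh f T σ k

lemma uh_cont {f : ℝ → ℂ} (hf : Continuous f) {M : ℝ} (hM : ∀ t, ‖f t‖ ≤ M) (T σ : ℝ) :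
    Continuous (uh f T σ) := by
  unfold uh
  apply continuous_of_dominated (bound := fun _ => M)
  · intro k
    exact (by fun_prop : Continuous _).aestronglyMeasurable
  · intro k
    exact Eventually.of_forall (fun s => by rw [norm_mul, norm_eI, one_mul]; exact hM s)
  · exact integrable_const _
  · exact Eventually.of_forall (fun s => by fun_prop)

lemma uh_bound {f : ℝ → ℂ} {M : ℝ} (hM : ∀ t, ‖f t‖ ≤ M) {T : ℝ} (hT : 0 ≤ T) (σ k : ℝ) :
    ‖uh f T σ k‖ ≤ M * T := by
  unfold uh
  have := norm_setIntegral_le_of_norm_le_const (μ := volume) (s := Ioc 0 T) (C := M)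
    (f := fun s => Complex.exp (Complex.I * ((σ * k ^ 2 * s : ℝ) : ℂ)) * f s) (by simp)
    (fun s _ => by rw [norm_mul, norm_eI, one_mul]; exact hM s)
  simpa [Measure.real, hT] using this

lemma au_norm (f : ℝ → ℂ) (T ε σ k : ℝ) : ‖au f T ε σ k‖ = Real.exp (-ε * k ^ 2) * ‖uh f T σ k‖ := by
  unfold au
  rw [norm_mul, Complex.norm_real, Real.norm_eq_abs, abs_of_pos (Real.exp_pos _)]

lemma au_cont {f : ℝ → ℂ} (hf : Continuous f) {M : ℝ} (hM : ∀ t, ‖f t‖ ≤ M) (T ε σ : ℝ) :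
    Continuous (au f T ε σ) := by
  unfold au
  have := uh_cont hf hM T σ
  fun_prop

lemma au_int {f : ℝ → ℂ} (hf : Continuous f) {M : ℝ} (hM : ∀ t, ‖f t‖ ≤ M) {T : ℝ} (hT : 0 ≤ T)
    {ε : ℝ} (hε : 0 < ε) (σ : ℝ) : Integrable (au f T ε σ) := by
  apply Integrable.mono' ((integrable_exp_neg_mul_sq hε).mul_const (M * T))
    (au_cont hf hM T ε σ).aestronglyMeasurable
  refine Eventually.of_forall (fun k => ?_)
  rw [au_norm]
  gcongr
  exact uh_bound hM hT σ k

lemma prod_int {T : ℝ} (F : ℝ → ℝ → ℂ) (hF : Continuous (Function.uncurry F)) {b : ℝ → ℝ}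
    (hb : Integrable b) (h : ∀ k s, ‖F k s‖ ≤ b k) :
    Integrable (Function.uncurry F) (volume.prod (volume.restrict (Ioc 0 T))) := by
  have h1 : Integrable (fun p : ℝ × ℝ => b p.1 * (1 : ℝ)) (volume.prod (volume.restrict (Ioc 0 T))) :=
    Integrable.mul_prod hb (integrable_const (1 : ℝ))
  apply Integrable.mono' h1 hF.aestronglyMeasurable
  exact Eventually.of_forall (fun p => by rw [mul_one]; exact h p.1 p.2)

lemma Gs_au {f : ℝ → ℂ} (hf : Continuous f) {M : ℝ} (hM : ∀ t, ‖f t‖ ≤ M) {T : ℝ}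
    {ε : ℝ} (hε : 0 < ε) (σ t : ℝ) :
    Gs σ (au f T ε (-σ)) t = ∫ s in Ioc 0 T, EE ε (σ * (t - s)) * f s := by
  have e1 : ∀ s, EE ε (σ * (t - s)) * f s = ∫ k : ℝ,
      Complex.exp (-((ε : ℂ) - Complex.I * ((σ * (t - s) : ℝ) : ℂ)) * (k : ℂ) ^ 2) * f s := by
    intro s
    rw [← EE_int hε, integral_mul_const]
  simp_rw [e1]
  unfold Gs au uh
  simp_rw [← integral_const_mul]
  rw [integral_integral_swap]
  · apply integral_congr_ae
    refine Eventually.of_forall (fun s => ?_)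
    apply integral_congr_ae
    refine Eventually.of_forall (fun k => ?_)
    simp only
    push_cast
    rw [← mul_assoc, ← mul_assoc, ← Complex.exp_add, ← Complex.exp_add]
    congr 2
    ring
  · apply prod_int _ _ ((integrable_exp_neg_mul_sq hε).mul_const M)
    · intro k s
      rw [norm_mul, norm_mul, norm_mul, norm_eI, norm_eI, one_mul, one_mul, Complex.norm_real,
        Real.norm_eq_abs, abs_of_pos (Real.exp_pos _)]
      gcongr
      exact hM s
    · unfold Function.uncurry
      fun_prop

lemma conj_eI (x : ℝ) : (starRingEnd ℂ) (Complex.exp (Complex.I * (x : ℂ))) =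
    Complex.exp (Complex.I * ((-x : ℝ) : ℂ)) := by
  rw [← Complex.exp_conj]
  simp

lemma pairing {f : ℝ → ℂ} (hf : Continuous f) {M : ℝ} (hM : ∀ t, ‖f t‖ ≤ M) {T : ℝ}
    {a : ℝ → ℂ} (ha : Integrable a) (σ τ : ℝ) :
    ∫ t in Ioc 0 T, (starRingEnd ℂ) (f t) * Gs σ a (t + τ) =
      ∫ k, Complex.exp (Complex.I * ((σ * k ^ 2 * τ : ℝ) : ℂ)) *
        (a k * (starRingEnd ℂ) (uh f T (-σ) k)) := by
  have e1 : ∀ k, (starRingEnd ℂ) (uh f T (-σ) k) =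
      ∫ s in Ioc 0 T, Complex.exp (Complex.I * ((σ * k ^ 2 * s : ℝ) : ℂ)) * (starRingEnd ℂ) (f s) := by
    intro k
    unfold uh
    rw [← integral_conj]
    apply integral_congr_ae
    refine Eventually.of_forall (fun s => ?_)
    simp only [map_mul, conj_eI]
    congr 4
    ring
  simp_rw [e1]
  unfold Gs
  simp_rw [← integral_const_mul]
  rw [← integral_integral_swap]
  · apply integral_congr_ae
    refine Eventually.of_forall (fun k => ?_)
    apply integral_congr_ae
    refine Eventually.of_forall (fun s => ?_)
    simp only
    have : Complex.exp (Complex.I * ((σ * k ^ 2 * (s + τ) : ℝ) : ℂ)) =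
      Complex.exp (Complex.I * ((σ * k ^ 2 * τ : ℝ) : ℂ)) *
      Complex.exp (Complex.I * ((σ * k ^ 2 * s : ℝ) : ℂ)) := by
      rw [← Complex.exp_add]; congr 1; push_cast; ring
    rw [this]; ring
  · have h1 : Integrable (fun p : ℝ × ℝ => ‖a p.1‖ * M) (volume.prod (volume.restrict (Ioc 0 T))) :=
      Integrable.mul_prod ha.norm (integrable_const M)
    apply Integrable.mono' h1
    · apply AEStronglyMeasurable.mul
      · exact (by fun_prop : Continuous (fun p : ℝ × ℝ => (starRingEnd ℂ) (f p.2))).aestronglyMeasurable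
      · apply AEStronglyMeasurable.mul
        · exact (by fun_prop : Continuous (fun p : ℝ × ℝ => Complex.exp (Complex.I * ((σ * p.1 ^ 2 * (p.2 + τ) : ℝ) : ℂ)))).aestronglyMeasurable
        · exact ha.aestronglyMeasurable.comp_fst
    · refine Eventually.of_forall (fun p => ?_)
      simp only [Function.uncurry]
      rw [norm_mul, norm_mul, norm_eI, one_mul, RCLike.norm_conj, mul_comm]
      gcongr
      exact hM _

lemma even_int {g : ℝ → ℝ} (hg : IntegrableOn g (Ioi 0)) : Integrable (fun u => g |u|) := by
  have hf : IntegrableOn (fun u => g |u|) (Ioi 0) := by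
    refine hg.congr_fun (fun x hx => ?_) measurableSet_Ioi
    rw [abs_of_pos (by exact hx)]
  have int_Iic : IntegrableOn (fun x ↦ g |x|) (Iic 0) := by
    rw [← Measure.map_neg_eq_self (volume : Measure ℝ)]
    let m : MeasurableEmbedding fun x : ℝ => -x := (Homeomorph.neg ℝ).measurableEmbedding
    rw [m.integrableOn_map_iff]
    simp_rw [Function.comp_def, abs_neg, neg_preimage, neg_Iic, neg_zero]
    exact Iff.mpr integrableOn_Ici_iff_integrableOn_Ioi hf
  rw [← integrableOn_univ, ← Iic_union_Ioi (a := (0:ℝ))]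
  exact int_Iic.union hf

def rr (u : ℝ) : ℝ := if |u| ≤ 1 then (√|u|)⁻¹ else 0
def JJ (u : ℝ) : ℝ := if |u| ≤ 1 then (√|u|)⁻¹ else (|u| * √|u|)⁻¹

lemma sqrt_inv_int : IntegrableOn (fun v : ℝ => (√v)⁻¹) (Ioc 0 1) := by
  have := (intervalIntegral.intervalIntegrable_rpow' (a := 0) (b := 1) (r := -(1/2:ℝ)) (by norm_num))
  rw [intervalIntegrable_iff, uIoc_of_le zero_le_one] at this
  refine this.congr_fun (fun x hx => ?_) measurableSet_Ioc
  simp only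
  rw [Real.rpow_neg hx.1.le, Real.sqrt_eq_rpow]

lemma rr_int : Integrable rr := by
  have : IntegrableOn (fun v : ℝ => if v ≤ 1 then (√v)⁻¹ else 0) (Ioi 0) := by
    rw [← Ioc_union_Ioi_eq_Ioi (zero_le_one (α := ℝ))]
    apply IntegrableOn.union
    · refine sqrt_inv_int.congr_fun (fun x hx => ?_) measurableSet_Ioc
      simp [hx.2]
    · refine (integrableOn_zero).congr_fun (fun x hx => ?_) measurableSet_Ioi
      have : ¬ x ≤ 1 := not_le.mpr hx
      simp [this]
  exact even_int this

lemma JJ_int : Integrable JJ := by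
  have : IntegrableOn (fun v : ℝ => if v ≤ 1 then (√v)⁻¹ else (v * √v)⁻¹) (Ioi 0) := by
    rw [← Ioc_union_Ioi_eq_Ioi (zero_le_one (α := ℝ))]
    apply IntegrableOn.union
    · refine sqrt_inv_int.congr_fun (fun x hx => ?_) measurableSet_Ioc
      simp [hx.2]
    · refine (integrableOn_Ioi_rpow_of_lt (a := -(3/2:ℝ)) (by norm_num) one_pos).congr_fun (fun x hx => ?_) measurableSet_Ioi
      have h1 : ¬ x ≤ 1 := not_le.mpr hx
      have h0 : 0 < x := lt_trans one_pos hx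
      simp only [h1, if_false]
      rw [Real.rpow_neg h0.le, Real.sqrt_eq_rpow, ← Real.rpow_one_add' h0.le (by norm_num)]
      norm_num
  exact even_int this

lemma rr_nonneg (u : ℝ) : 0 ≤ rr u := by unfold rr; split_ifs <;> positivity
lemma JJ_nonneg (u : ℝ) : 0 ≤ JJ u := by unfold JJ; split_ifs <;> positivity

lemma sqrt_inv_le (u : ℝ) : (√|u|)⁻¹ ≤ 1 + rr u := by
  unfold rr
  split_ifs with h
  · linarith
  · push Not at h
    have : 1 ≤ √|u| := by rw [Real.one_le_sqrt]; exact h.le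
    have := inv_le_one_of_one_le₀ this
    linarith

lemma fatouE {α : Type*} [MeasurableSpace α] {μ : Measure α} {F : ℕ → α → ENNReal} {G : α → ENNReal} {C : ENNReal}
    (hF : ∀ n, AEMeasurable (F n) μ) (hlim : ∀ᵐ x ∂μ, Tendsto (fun n => F n x) atTop (𝓝 (G x)))
    (hC : ∀ n, ∫⁻ x, F n x ∂μ ≤ C) : ∫⁻ x, G x ∂μ ≤ C := by
  have h1 : ∫⁻ x, G x ∂μ = ∫⁻ x, liminf (fun n => F n x) atTop ∂μ := by
    apply lintegral_congr_ae
    filter_upwards [hlim] with x hx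
    exact hx.liminf_eq.symm
  rw [h1]
  refine (lintegral_liminf_le' hF).trans ?_
  refine liminf_le_of_le ?_ ?_
  · isBoundedDefault
  · intro b hb
    obtain ⟨n, hn⟩ := hb.exists
    exact hn.trans (hC n)

lemma fatouR {F : ℕ → ℝ → ℝ} {G : ℝ → ℝ} {C : ℝ} (hF : ∀ n, Integrable (F n))
    (h0 : ∀ n k, 0 ≤ F n k) (hlim : ∀ k, Tendsto (fun n => F n k) atTop (𝓝 (G k)))
    (hG : AEStronglyMeasurable G volume)
    (hC : ∀ n, ∫ k, F n k ≤ C) : Integrable G ∧ ∫ k, G k ≤ C := by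
  have hG0 : ∀ k, 0 ≤ G k := fun k => ge_of_tendsto' (hlim k) (fun n => h0 n k)
  have hC0 : 0 ≤ C := (integral_nonneg (h0 0)).trans (hC 0)
  have key : ∫⁻ k, ENNReal.ofReal (G k) ≤ ENNReal.ofReal C := by
    apply fatouE (F := fun n k => ENNReal.ofReal (F n k))
    · intro n; exact (hF n).aestronglyMeasurable.aemeasurable.ennreal_ofReal
    · exact Eventually.of_forall (fun k => (ENNReal.continuous_ofReal.tendsto _).comp (hlim k))
    · intro n
      rw [← ofReal_integral_eq_lintegral_ofReal (hF n) (Eventually.of_forall (h0 n))]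
      exact ENNReal.ofReal_le_ofReal (hC n)
  have hI : Integrable G := by
    refine ⟨hG, ?_⟩
    rw [hasFiniteIntegral_iff_ofReal (Eventually.of_forall hG0)]
    exact key.trans_lt ENNReal.ofReal_lt_top
  refine ⟨hI, ?_⟩
  rw [← ofReal_integral_eq_lintegral_ofReal hI (Eventually.of_forall hG0)] at key
  exact (ENNReal.ofReal_le_ofReal_iff hC0).mp key

def en (n : ℕ) : ℝ := 1 / ((n : ℝ) + 2)
lemma en_pos (n : ℕ) : 0 < en n := by unfold en; positivity
lemma en_lt (n : ℕ) : en n < 1 := by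
  unfold en; rw [div_lt_one (by positivity)]; have : (0:ℝ) ≤ n := by positivity
  linarith
lemma en_tendsto : Tendsto en atTop (𝓝 0) := by
  have := tendsto_one_div_add_atTop_nhds_zero_nat (𝕜 := ℝ)
  have := (tendsto_add_atTop_iff_nat 1).mpr this
  refine this.congr (fun n => ?_)
  unfold en; push_cast; ring_nf
lemma en_tendsto' : Tendsto en atTop (𝓝[>] 0) :=
  tendsto_nhdsWithin_iff.mpr ⟨en_tendsto, Eventually.of_forall en_pos⟩

def KE (ε u : ℝ) : ℝ := (EE ε u).re + (EE ε u).im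
def yE (f : ℝ → ℂ) (T ε t : ℝ) : ℂ := ∫ s in Ioc 0 T, ((KE ε (t - s) : ℝ) : ℂ) * f s

lemma KE_bound (ε u : ℝ) (hu : u ≠ 0) : |KE ε u| ≤ 2 * √π * (√|u|)⁻¹ := by
  unfold KE
  have h := EE_norm_le ε u hu
  have h1 := Complex.abs_re_le_norm (EE ε u)
  have h2 := Complex.abs_im_le_norm (EE ε u)
  calc _ ≤ |(EE ε u).re| + |(EE ε u).im| := abs_add_le _ _
    _ ≤ _ := by linarith

lemma KE_cont {ε : ℝ} (hε : 0 < ε) : Continuous (KE ε) := by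
  have : Continuous (EE ε) := by
    rw [continuous_iff_continuousAt]
    intro u
    unfold EE
    apply ContinuousAt.cpow
    · apply ContinuousAt.div continuousAt_const
      · fun_prop
      · exact EE_b_ne (Or.inl hε.ne')
    · exact continuousAt_const
    · rw [Complex.mem_slitPlane_iff]
      left
      rw [Complex.div_re]
      have h1 : 0 < Complex.normSq ((ε : ℂ) - Complex.I * (u : ℂ)) :=
        Complex.normSq_pos.mpr (EE_b_ne (Or.inl hε.ne'))
      simp
      positivity
  unfold KE
  fun_prop

lemma bd_int (T t : ℝ) : IntegrableOn (fun s => 1 + rr (t - s)) (Ioc 0 T) := by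
  apply Integrable.add (integrable_const _)
  exact (rr_int.comp_sub_left t).integrableOn

lemma bd_le {T : ℝ} (hT : 0 ≤ T) (t : ℝ) : ∫ s in Ioc 0 T, (1 + rr (t - s)) ≤ T + ∫ u, rr u := by
  rw [integral_add (integrable_const _) (rr_int.comp_sub_left t).integrableOn]
  gcongr
  · simp [hT]
  · calc _ ≤ ∫ s, rr (t - s) := setIntegral_le_integral (rr_int.comp_sub_left t) (Eventually.of_forall (fun s => rr_nonneg _))
      _ = _ := integral_sub_left_eq_self rr volume t

lemma ae_ne (T t : ℝ) : ∀ᵐ s ∂(volume.restrict (Ioc 0 T)), t - s ≠ 0 := by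
  apply ae_restrict_of_ae
  have : ∀ᵐ s : ℝ, s ≠ t := by simp [ae_iff]
  filter_upwards [this] with s hs
  exact sub_ne_zero.mpr hs.symm

lemma kf_bound {f : ℝ → ℂ} {M : ℝ} (hM : ∀ t, ‖f t‖ ≤ M) {T : ℝ} (hT : 0 ≤ T) {K : ℝ → ℝ} {A : ℝ}
    (hA : 0 ≤ A) (hK : ∀ u ≠ 0, |K u| ≤ A * (√|u|)⁻¹) (t : ℝ) :
    ‖∫ s in Ioc 0 T, ((K (t - s) : ℝ) : ℂ) * f s‖ ≤ A * M * (T + ∫ u, rr u) := by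
  have hM0 : 0 ≤ M := (norm_nonneg _).trans (hM 0)
  calc _ ≤ ∫ s in Ioc 0 T, A * M * (1 + rr (t - s)) := by
        apply norm_integral_le_of_norm_le ((bd_int T t).const_mul _)
        filter_upwards [ae_ne T t] with s hs
        rw [norm_mul, Complex.norm_real, Real.norm_eq_abs]
        calc _ ≤ (A * (√|t-s|)⁻¹) * M := by gcongr; exact hK _ hs; exact hM s
          _ ≤ (A * (1 + rr (t - s))) * M := by gcongr; exact sqrt_inv_le _
          _ = _ := by ring
    _ = A * M * ∫ s in Ioc 0 T, (1 + rr (t - s)) := integral_const_mul _ _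
    _ ≤ _ := by gcongr; exact bd_le hT t

lemma sqrt_inv_abs (u : ℝ) : |(√u)⁻¹| ≤ 1 * (√|u|)⁻¹ := by
  rw [one_mul, abs_of_nonneg (by positivity)]
  rcases le_or_gt 0 u with h | h
  · rw [abs_of_nonneg h]
  · rw [Real.sqrt_eq_zero_of_nonpos h.le]; simp

lemma yT_bound {f : ℝ → ℂ} {M : ℝ} (hM : ∀ t, ‖f t‖ ≤ M) {T : ℝ} (hT : 0 ≤ T) (t : ℝ) :
    ‖yT f T t‖ ≤ M * (T + ∫ u, rr u) := by
  have := kf_bound hM hT (K := fun u => (√u)⁻¹) zero_le_one (fun u _ => sqrt_inv_abs u) t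
  simpa [yT] using this

lemma yE_bound {f : ℝ → ℂ} {M : ℝ} (hM : ∀ t, ‖f t‖ ≤ M) {T : ℝ} (hT : 0 ≤ T) (ε t : ℝ) :
    ‖yE f T ε t‖ ≤ 2 * √π * M * (T + ∫ u, rr u) :=
  kf_bound hM hT (by positivity) (KE_bound ε) t

lemma yE_tendsto {f : ℝ → ℂ} (hf : Continuous f) {M : ℝ} (hM : ∀ t, ‖f t‖ ≤ M) {T : ℝ} (t : ℝ) :
    Tendsto (fun n => yE f T (en n) t) atTop (𝓝 (((√(2 * π) : ℝ) : ℂ) * yT f T t)) := by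
  unfold yE yT
  rw [← integral_const_mul]
  have hM0 : 0 ≤ M := (norm_nonneg _).trans (hM 0)
  apply tendsto_integral_of_dominated_convergence (fun s => 2 * √π * M * (1 + rr (t - s)))
  · intro n
    have := KE_cont (en_pos n)
    exact (by fun_prop : Continuous _).aestronglyMeasurable
  · exact (bd_int T t).const_mul _
  · intro n
    filter_upwards [ae_ne T t] with s hs
    rw [norm_mul, Complex.norm_real, Real.norm_eq_abs]
    calc _ ≤ (2 * √π * (√|t-s|)⁻¹) * M := by gcongr; exact KE_bound _ _ hs; exact hM s
      _ ≤ (2 * √π * (1 + rr (t - s))) * M := by gcongr; exact sqrt_inv_le _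
      _ = _ := by ring
  · filter_upwards [ae_ne T t] with s hs
    rw [← mul_assoc]
    apply Tendsto.mul_const
    have h1 : Tendsto (fun n => EE (en n) (t - s)) atTop (𝓝 (EE 0 (t - s))) := (EE_tendsto hs).comp en_tendsto'
    have h2 : Tendsto (fun n => KE (en n) (t - s)) atTop (𝓝 (KE 0 (t - s))) :=
      ((Complex.continuous_re.tendsto _).comp h1).add ((Complex.continuous_im.tendsto _).comp h1)
    have h3 : KE 0 (t - s) = √(2 * π) * (√(t - s))⁻¹ := EE_zero hs
    rw [h3] at h2
    have := (Complex.continuous_ofReal.tendsto _).comp h2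
    simpa [Function.comp_def] using this

lemma yE_eq {f : ℝ → ℂ} (hf : Continuous f) {M : ℝ} (hM : ∀ t, ‖f t‖ ≤ M) {T : ℝ} 
    {ε : ℝ} (hε : 0 < ε) (t : ℝ) :
    yE f T ε t = (1 / 2) * ((1 - Complex.I) * Gs 1 (au f T ε (-1)) t + (1 + Complex.I) * Gs (-1) (au f T ε 1) t) := by
  have hEE : Continuous (EE ε) := by
    rw [continuous_iff_continuousAt]
    intro u
    unfold EE
    apply ContinuousAt.cpow
    · apply ContinuousAt.div continuousAt_const
      · fun_prop
      · exact EE_b_ne (Or.inl hε.ne')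
    · exact continuousAt_const
    · rw [Complex.mem_slitPlane_iff]
      left
      rw [Complex.div_re]
      have h1 : 0 < Complex.normSq ((ε : ℂ) - Complex.I * (u : ℂ)) :=
        Complex.normSq_pos.mpr (EE_b_ne (Or.inl hε.ne'))
      simp
      positivity
  have e1 := Gs_au hf hM (T := T) hε 1 t
  have e2 := Gs_au hf hM (T := T) hε (-1) t
  rw [neg_neg] at e2
  rw [e1, e2, ← integral_const_mul, ← integral_const_mul, ← integral_add, ← integral_const_mul]
  · unfold yE
    congr 1
    ext s
    rw [show (-1 : ℝ) * (t - s) = -(t - s) by ring, ← EE_conj ε (t - s) hε.le (Or.inr hε), one_mul]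
    unfold KE
    generalize EE ε (t - s) = z
    have : ((z.re + z.im : ℝ) : ℂ) = (1 / 2) * ((1 - Complex.I) * z + (1 + Complex.I) * (starRingEnd ℂ) z) := by
      apply Complex.ext <;> simp <;> ring
    rw [this]; ring
  · exact ((by fun_prop : Continuous _).integrableOn_Icc (a := 0) (b := T)).mono_set Ioc_subset_Icc_self
  · exact ((by fun_prop : Continuous _).integrableOn_Icc (a := 0) (b := T)).mono_set Ioc_subset_Icc_self

lemma Gs_cont {a : ℝ → ℂ} (ha : Integrable a) (σ : ℝ) : Continuous (Gs σ a) := by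
  unfold Gs
  apply continuous_of_dominated (bound := fun k => ‖a k‖)
  · intro t
    exact ((by fun_prop : Continuous (fun k : ℝ => Complex.exp (Complex.I * ((σ * k ^ 2 * t : ℝ) : ℂ)))).aestronglyMeasurable).mul ha.aestronglyMeasurable
  · intro t
    exact Eventually.of_forall (fun k => by rw [norm_mul, norm_eI, one_mul])
  · exact ha.norm
  · exact Eventually.of_forall (fun k => by fun_prop)

lemma yE_cont {f : ℝ → ℂ} (hf : Continuous f) {M : ℝ} (hM : ∀ t, ‖f t‖ ≤ M) {T : ℝ} (hT : 0 ≤ T)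
    {ε : ℝ} (hε : 0 < ε) : Continuous (yE f T ε) := by
  have e : yE f T ε = fun t => (1 / 2) * ((1 - Complex.I) * Gs 1 (au f T ε (-1)) t + (1 + Complex.I) * Gs (-1) (au f T ε 1) t) := by
    ext t; exact yE_eq hf hM hε t
  rw [e]
  have h1 := Gs_cont (au_int hf hM hT hε (-1)) 1
  have h2 := Gs_cont (au_int hf hM hT hε 1) (-1)
  fun_prop

lemma SS_cont {f : ℝ → ℂ} (hf : Continuous f) {M : ℝ} (hM : ∀ t, ‖f t‖ ≤ M) (T : ℝ) : Continuous (SS f T) := by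
  unfold SS
  have h1 := uh_cont hf hM T 1
  have h2 := uh_cont hf hM T (-1)
  fun_prop

lemma SS_nonneg (f : ℝ → ℂ) (T k : ℝ) : 0 ≤ SS f T k := by unfold SS; positivity

lemma SS_bound {f : ℝ → ℂ} {M : ℝ} (hM : ∀ t, ‖f t‖ ≤ M) {T : ℝ} (hT : 0 ≤ T) (k : ℝ) :
    SS f T k ≤ 2 * (M * T) ^ 2 := by
  unfold SS
  have h1 := uh_bound hM hT 1 k
  have h2 := uh_bound hM hT (-1) k
  have h3 := pow_le_pow_left₀ (norm_nonneg _) h1 2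
  have h4 := pow_le_pow_left₀ (norm_nonneg _) h2 2
  linarith

lemma eSS_int {f : ℝ → ℂ} (hf : Continuous f) {M : ℝ} (hM : ∀ t, ‖f t‖ ≤ M) {T : ℝ} (hT : 0 ≤ T)
    {ε : ℝ} (hε : 0 < ε) : Integrable (fun k => Real.exp (-ε * k ^ 2) * SS f T k) := by
  have := SS_cont hf hM T
  apply Integrable.mono' ((integrable_exp_neg_mul_sq hε).mul_const (2 * (M * T) ^ 2)) (by fun_prop : Continuous _).aestronglyMeasurable
  refine Eventually.of_forall (fun k => ?_)
  rw [norm_mul, Real.norm_eq_abs, Real.norm_eq_abs, abs_of_pos (Real.exp_pos _), abs_of_nonneg (SS_nonneg _ _ _)]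
  gcongr
  exact SS_bound hM hT k

lemma yE_pair {f : ℝ → ℂ} (hf : Continuous f) {M : ℝ} (hM : ∀ t, ‖f t‖ ≤ M) {T : ℝ} (hT : 0 ≤ T)
    {ε : ℝ} (hε : 0 < ε) (τ : ℝ) :
    (∫ t in Ioc 0 T, (starRingEnd ℂ) (f t) * yE f T ε (t + τ)).re =
      ∫ k, (1 / 2) * (Real.exp (-ε * k ^ 2) * SS f T k * (Real.cos (k ^ 2 * τ) + Real.sin (k ^ 2 * τ))) := by
  have g1 := Gs_cont (au_int hf hM hT hε (-1)) 1
  have g2 := Gs_cont (au_int hf hM hT hε 1) (-1)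
  have p1 := pairing hf hM (T := T) (au_int hf hM hT hε (-1)) 1 τ
  have p2 := pairing hf hM (T := T) (au_int hf hM hT hε 1) (-1) τ
  rw [neg_neg] at p2
  have ib : ∀ σ σ' : ℝ, Integrable (fun k => Complex.exp (Complex.I * ((σ' * k ^ 2 * τ : ℝ) : ℂ)) *
        (au f T ε σ k * (starRingEnd ℂ) (uh f T σ k))) := by
    intro σ σ'
    have c1 := au_cont hf hM T ε σ
    have c2 := uh_cont hf hM T σ
    apply Integrable.mono' ((au_int hf hM hT hε σ).norm.mul_const (M * T)) (by fun_prop : Continuous _).aestronglyMeasurable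
    refine Eventually.of_forall (fun k => ?_)
    rw [norm_mul, norm_mul, norm_eI, one_mul, RCLike.norm_conj]
    gcongr
    exact uh_bound hM hT σ k
  have e : ∫ t in Ioc 0 T, (starRingEnd ℂ) (f t) * yE f T ε (t + τ) =
     ∫ k, (1 / 2) * ((1 - Complex.I) * (Complex.exp (Complex.I * ((1 * k ^ 2 * τ : ℝ) : ℂ)) *
        (au f T ε (-1) k * (starRingEnd ℂ) (uh f T (-1) k))) + (1 + Complex.I) * (Complex.exp (Complex.I * ((-1 * k ^ 2 * τ : ℝ) : ℂ)) *
        (au f T ε 1 k * (starRingEnd ℂ) (uh f T 1 k)))) := by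
    rw [integral_const_mul, integral_add ((ib _ _).const_mul _) ((ib _ _).const_mul _), integral_const_mul, integral_const_mul, ← p1, ← p2,
      ← integral_const_mul, ← integral_const_mul, ← integral_add, ← integral_const_mul]
    · congr 1
      ext t
      rw [yE_eq hf hM hε]
      ring
    · exact ((by fun_prop : Continuous _).integrableOn_Icc (a := 0) (b := T)).mono_set Ioc_subset_Icc_self
    · exact ((by fun_prop : Continuous _).integrableOn_Icc (a := 0) (b := T)).mono_set Ioc_subset_Icc_self
  rw [e]
  have hre := integral_re (𝕜 := ℂ) (((((ib (-1) 1).const_mul (1 - Complex.I))).add (((ib 1 (-1)).const_mul (1 + Complex.I)))).const_mul (1/2))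
  simp only [Pi.add_apply, RCLike.re_to_complex] at hre
  rw [← hre]
  congr 1
  ext k
  have n1 : ∀ σ, au f T ε σ k * (starRingEnd ℂ) (uh f T σ k) = ((Real.exp (-ε * k ^ 2) * ‖uh f T σ k‖ ^ 2 : ℝ) : ℂ) := by
    intro σ
    unfold au
    rw [mul_assoc, Complex.mul_conj']
    push_cast; rfl
  rw [n1, n1, mul_comm Complex.I, mul_comm Complex.I, Complex.exp_mul_I, Complex.exp_mul_I]
  unfold SS
  rw [← Complex.ofReal_cos, ← Complex.ofReal_sin, ← Complex.ofReal_cos, ← Complex.ofReal_sin]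
  rw [show -1 * k ^ 2 * τ = -(k ^ 2 * τ) by ring, Real.cos_neg, Real.sin_neg, one_mul]
  simp [-Complex.ofReal_cos, -Complex.ofReal_sin, -Complex.ofReal_exp, -Complex.ofReal_pow]
  ring

lemma exp_en_tendsto (k : ℝ) : Tendsto (fun n => Real.exp (-(en n) * k ^ 2)) atTop (𝓝 1) := by
  have h : Tendsto (fun n => -(en n) * k ^ 2) atTop (𝓝 (-0 * k ^ 2)) := (en_tendsto.neg).mul_const _
  have := (Real.continuous_exp.tendsto _).comp h
  simpa [Function.comp_def] using this

lemma yT_meas {f : ℝ → ℂ} (hf : Continuous f) {M : ℝ} (hM : ∀ t, ‖f t‖ ≤ M) {T : ℝ} (hT : 0 ≤ T) :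
    StronglyMeasurable (yT f T) := by
  unfold yT
  apply StronglyMeasurable.integral_prod_right (f := fun t s => (((√(t - s))⁻¹ : ℝ) : ℂ) * f s)
  apply Measurable.stronglyMeasurable
  unfold Function.uncurry
  have := hf.measurable
  fun_prop

lemma SS_int {f : ℝ → ℂ} (hf : Continuous f) {M : ℝ} (hM : ∀ t, ‖f t‖ ≤ M) {T : ℝ} (hT : 0 ≤ T) :
    Integrable (SS f T) := by
  refine (fatouR (F := fun n k => Real.exp (-(en n) * k ^ 2) * SS f T k)
    (C := 2 * (M * (2 * √π * M * (T + ∫ u, rr u)) * T)) (fun n => eSS_int hf hM hT (en_pos n)) ?_ ?_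
    (SS_cont hf hM T).aestronglyMeasurable ?_).1
  · intro n k; have := SS_nonneg f T k; positivity
  · intro k
    simpa using (exp_en_tendsto k).mul_const (SS f T k)
  · intro n
    have h := yE_pair hf hM hT (en_pos n) 0
    simp only [mul_zero, Real.cos_zero, Real.sin_zero, add_zero, mul_one] at h
    rw [integral_const_mul] at h
    have h2 : ‖∫ t in Ioc 0 T, (starRingEnd ℂ) (f t) * yE f T (en n) t‖ ≤ M * (2 * √π * M * (T + ∫ u, rr u)) * T := by
      have := norm_setIntegral_le_of_norm_le_const (μ := volume) (s := Ioc 0 T) (C := M * (2 * √π * M * (T + ∫ u, rr u)))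
        (f := fun t => (starRingEnd ℂ) (f t) * yE f T (en n) t) (by simp)
        (fun t _ => by
          rw [norm_mul, RCLike.norm_conj]
          have h0 : 0 ≤ M := (norm_nonneg _).trans (hM 0)
          gcongr
          · exact hM t
          · exact yE_bound hM hT _ t)
      simpa [Measure.real, hT] using this
    have h3 := Complex.re_le_norm (∫ t in Ioc 0 T, (starRingEnd ℂ) (f t) * yE f T (en n) t)
    linarith

lemma yT_pair {f : ℝ → ℂ} (hf : Continuous f) {M : ℝ} (hM : ∀ t, ‖f t‖ ≤ M) {T : ℝ} (hT : 0 ≤ T)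
    (τ : ℝ) :
    √(2 * π) * (∫ t in Ioc 0 T, (starRingEnd ℂ) (f t) * yT f T (t + τ)).re =
      ∫ k, (1 / 2) * (SS f T k * (Real.cos (k ^ 2 * τ) + Real.sin (k ^ 2 * τ))) := by
  have h0 : 0 ≤ M := (norm_nonneg _).trans (hM 0)
  have l1 : Tendsto (fun n => (∫ t in Ioc 0 T, (starRingEnd ℂ) (f t) * yE f T (en n) (t + τ)).re) atTop
      (𝓝 (∫ t in Ioc 0 T, (starRingEnd ℂ) (f t) * ((√(2 * π) : ℝ) * yT f T (t + τ))).re) := by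
    apply (Complex.continuous_re.tendsto _).comp
    apply tendsto_integral_of_dominated_convergence (fun _ => M * (2 * √π * M * (T + ∫ u, rr u)))
    · intro n
      have := yE_cont hf hM hT (en_pos n)
      exact (by fun_prop : Continuous _).aestronglyMeasurable
    · exact integrable_const _
    · intro n
      refine Eventually.of_forall (fun t => ?_)
      rw [norm_mul, RCLike.norm_conj]
      gcongr
      · exact hM t
      · exact yE_bound hM hT _ _
    · refine Eventually.of_forall (fun t => ?_)
      exact (yE_tendsto hf hM _).const_mul _
  have e : (∫ t in Ioc 0 T, (starRingEnd ℂ) (f t) * ((√(2 * π) : ℝ) * yT f T (t + τ))).re = 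
     √(2 * π) * (∫ t in Ioc 0 T, (starRingEnd ℂ) (f t) * yT f T (t + τ)).re := by
    rw [← Complex.re_ofReal_mul, ← integral_const_mul]
    congr 2
    ext t; ring
  rw [e] at l1
  refine tendsto_nhds_unique l1 ?_
  simp_rw [yE_pair hf hM hT (en_pos _)]
  apply tendsto_integral_of_dominated_convergence (fun k => SS f T k)
  · intro n
    have := SS_cont hf hM T
    exact (by fun_prop : Continuous _).aestronglyMeasurable
  · exact SS_int hf hM hT
  · intro n
    refine Eventually.of_forall (fun k => ?_)
    have h1 : |Real.cos (k ^ 2 * τ) + Real.sin (k ^ 2 * τ)| ≤ 2 :=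
      (abs_add_le _ _).trans (by linarith [Real.abs_cos_le_one (k ^ 2 * τ), Real.abs_sin_le_one (k ^ 2 * τ)])
    have h2 := SS_nonneg f T k
    have h3 : Real.exp (-en n * k ^ 2) ≤ 1 := by
      rw [Real.exp_le_one_iff]; have := en_pos n; nlinarith [sq_nonneg k]
    rw [Real.norm_eq_abs, abs_mul, abs_mul, abs_mul, abs_of_nonneg h2, abs_of_pos (Real.exp_pos _), abs_of_pos (by norm_num : (0:ℝ) < 1/2)]
    calc _ ≤ 1 / 2 * (1 * SS f T k * 2) := by gcongr
      _ = _ := by ring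
  · refine Eventually.of_forall (fun k => ?_)
    apply Tendsto.const_mul
    apply Tendsto.mul_const
    simpa using (exp_en_tendsto k).mul_const (SS f T k)

def Gam (δ v : ℝ) : ℝ := √(π / δ) * Real.exp (-v ^ 2 / (4 * δ))

lemma Gam_nonneg (δ v : ℝ) : 0 ≤ Gam δ v := by unfold Gam; positivity

lemma Gam_lint {δ : ℝ} (hδ : 0 < δ) (c : ℝ) : ∫⁻ v, ENNReal.ofReal (Gam δ (c - v)) = ENNReal.ofReal (2 * π) := by
  rw [lintegral_sub_left_eq_self (fun v => ENNReal.ofReal (Gam δ v)) c]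
  have hb : 0 < 1 / (4 * δ) := by positivity
  have e : ∀ v, Gam δ v = √(π / δ) * Real.exp (-(1 / (4 * δ)) * v ^ 2) := by
    intro v; unfold Gam; congr 2; field_simp
  simp_rw [e]
  rw [← ofReal_integral_eq_lintegral_ofReal ((integrable_exp_neg_mul_sq hb).const_mul _) (Eventually.of_forall (fun v => by positivity)),
    integral_const_mul, integral_gaussian, ← Real.sqrt_mul (by positivity)]
  congr 1
  rw [show π / δ * (π / (1 / (4 * δ))) = (2 * π) ^ 2 by field_simp; norm_num]
  exact Real.sqrt_sq (by positivity)

lemma half_ker (s : Set ℝ) (hs : MeasurableSet s) (hinj : InjOn (fun l : ℝ => l ^ 2) s) {δ : ℝ} (hδ : 0 < δ) (c : ℝ) :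
    ∫⁻ l in s, ENNReal.ofReal |l| * ENNReal.ofReal (Gam δ (c - l ^ 2)) ≤ ENNReal.ofReal π := by
  have h := lintegral_image_eq_lintegral_abs_deriv_mul (f := fun l : ℝ => l ^ 2) (f' := fun l => 2 * l) hs
    (fun x _ => by simpa using (hasDerivAt_pow 2 x).hasDerivWithinAt) hinj (fun v => ENNReal.ofReal (Gam δ (c - v)))
  have h2 : ∫⁻ l in s, ENNReal.ofReal |2 * l| * ENNReal.ofReal (Gam δ (c - l ^ 2)) ≤ ENNReal.ofReal (2 * π) := by
    rw [← h, ← Gam_lint hδ c]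
    exact setLIntegral_le_lintegral _ _
  have h3 : ∀ l : ℝ, ENNReal.ofReal |2 * l| * ENNReal.ofReal (Gam δ (c - l ^ 2)) = 2 * (ENNReal.ofReal |l| * ENNReal.ofReal (Gam δ (c - l ^ 2))) := by
    intro l
    rw [abs_mul, ENNReal.ofReal_mul (by positivity), mul_assoc]
    simp
  simp_rw [h3] at h2
  rw [lintegral_const_mul' _ _ (by simp), ENNReal.ofReal_mul (by norm_num)] at h2
  have : ENNReal.ofReal 2 = 2 := by simp
  rw [this] at h2
  exact (ENNReal.mul_le_mul_iff_right (by simp) (by simp)).mp h2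

lemma schur_ker {δ : ℝ} (hδ : 0 < δ) (c : ℝ) :
    ∫⁻ l, ENNReal.ofReal |l| * ENNReal.ofReal (Gam δ (c - l ^ 2)) ≤ ENNReal.ofReal (2 * π) := by
  have h1 := half_ker (Ioi 0) measurableSet_Ioi (fun x hx y hy h => by
    exact (sq_eq_sq₀ (le_of_lt hx) (le_of_lt hy)).mp h) hδ c
  have h2 := half_ker (Iic 0) measurableSet_Iic (fun x hx y hy h => by
    have : (-x) ^ 2 = (-y) ^ 2 := by simpa using h
    have := (sq_eq_sq₀ (by simpa using hx) (by simpa using hy)).mp this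
    linarith) hδ c
  rw [← setLIntegral_univ, ← Iic_union_Ioi (a := (0:ℝ)), lintegral_union measurableSet_Ioi (Iic_disjoint_Ioi le_rfl)]
  calc _ ≤ ENNReal.ofReal π + ENNReal.ofReal π := by gcongr
    _ = _ := by rw [← ENNReal.ofReal_add (by positivity) (by positivity)]; ring_nf

/-- weight -/
def wA (a : ℝ → ℂ) (k : ℝ) : ENNReal := ENNReal.ofReal (‖a k‖ ^ 2 / |k|)

lemma schur_half {a : ℝ → ℂ} (ha : AEStronglyMeasurable a volume) {δ : ℝ} (hδ : 0 < δ) :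
    ∫⁻ k, ∫⁻ l, wA a k * (ENNReal.ofReal |l| * ENNReal.ofReal (Gam δ (k ^ 2 - l ^ 2))) ≤
      ENNReal.ofReal (2 * π) * ∫⁻ k, wA a k := by
  rw [← lintegral_const_mul' _ _ ENNReal.ofReal_ne_top]
  gcongr with k
  rw [lintegral_const_mul' _ _ (by simp [wA]), mul_comm]
  gcongr
  exact schur_ker hδ _

lemma schur_dbl {a : ℝ → ℂ} (ha : AEStronglyMeasurable a volume) {δ : ℝ} (hδ : 0 < δ) :
    ∫⁻ k, ∫⁻ l, ENNReal.ofReal (‖a k‖ * ‖a l‖ * Gam δ (k ^ 2 - l ^ 2)) ≤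
      ENNReal.ofReal (2 * π) * ∫⁻ k, wA a k := by
  have hw : AEMeasurable (wA a) volume := by
    unfold wA
    have := ha.norm.aemeasurable
    fun_prop
  have hG : Continuous (Gam δ) := by unfold Gam; fun_prop
  have hsym : ∀ v, Gam δ (-v) = Gam δ v := by intro v; unfold Gam; simp
  have hm : AEMeasurable (fun p : ℝ × ℝ => wA a p.1 * (ENNReal.ofReal |p.2| * ENNReal.ofReal (Gam δ (p.1 ^ 2 - p.2 ^ 2)))) (volume.prod volume) := by
    apply AEMeasurable.mul hw.comp_fst
    have := hG.measurable
    exact (by fun_prop : Measurable _).aemeasurable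
  have hm2 : AEMeasurable (fun p : ℝ × ℝ => wA a p.2 * (ENNReal.ofReal |p.1| * ENNReal.ofReal (Gam δ (p.2 ^ 2 - p.1 ^ 2)))) (volume.prod volume) := by
    apply AEMeasurable.mul hw.comp_snd
    have := hG.measurable
    exact (by fun_prop : Measurable _).aemeasurable
  have h1 := schur_half ha hδ
  have h2 : ∫⁻ k, ∫⁻ l, wA a l * (ENNReal.ofReal |k| * ENNReal.ofReal (Gam δ (l ^ 2 - k ^ 2))) ≤
      ENNReal.ofReal (2 * π) * ∫⁻ k, wA a k := by
    rw [lintegral_lintegral_swap hm2]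
    exact h1
  have ne0 : ∀ᵐ k : ℝ, k ≠ 0 := by simp [ae_iff]
  have h3 : ∫⁻ k, ∫⁻ l, 2 * ENNReal.ofReal (‖a k‖ * ‖a l‖ * Gam δ (k ^ 2 - l ^ 2)) ≤
      ∫⁻ k, ∫⁻ l, (wA a k * (ENNReal.ofReal |l| * ENNReal.ofReal (Gam δ (k ^ 2 - l ^ 2))) + wA a l * (ENNReal.ofReal |k| * ENNReal.ofReal (Gam δ (l ^ 2 - k ^ 2)))) := by
    apply lintegral_mono_ae
    filter_upwards [ne0] with k hk
    apply lintegral_mono_ae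
    filter_upwards [ne0] with l hl
    have hk' := abs_pos.mpr hk
    have hl' := abs_pos.mpr hl
    have hGn := Gam_nonneg δ (k ^ 2 - l ^ 2)
    rw [show l ^ 2 - k ^ 2 = -(k ^ 2 - l ^ 2) by ring, hsym]
    unfold wA
    rw [← ENNReal.ofReal_mul (by positivity), ← ENNReal.ofReal_mul (by positivity), ← ENNReal.ofReal_mul (by positivity), ← ENNReal.ofReal_mul (by positivity),
      ← ENNReal.ofReal_add (by positivity) (by positivity), show (2 : ENNReal) = ENNReal.ofReal 2 by simp, ← ENNReal.ofReal_mul (by norm_num)]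
    apply ENNReal.ofReal_le_ofReal
    have : 2 * (‖a k‖ * ‖a l‖) ≤ ‖a k‖ ^ 2 / |k| * |l| + ‖a l‖ ^ 2 / |l| * |k| := by
      rw [div_mul_eq_mul_div, div_mul_eq_mul_div, div_add_div _ _ hk'.ne' hl'.ne', le_div_iff₀ (by positivity)]
      nlinarith [sq_nonneg (‖a k‖ * |l| - ‖a l‖ * |k|)]
    calc _ = (2 * (‖a k‖ * ‖a l‖)) * Gam δ (k ^ 2 - l ^ 2) := by ring
      _ ≤ (‖a k‖ ^ 2 / |k| * |l| + ‖a l‖ ^ 2 / |l| * |k|) * Gam δ (k ^ 2 - l ^ 2) := by gcongr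
      _ = _ := by ring
  have h4 : ∫⁻ k, ∫⁻ l, 2 * ENNReal.ofReal (‖a k‖ * ‖a l‖ * Gam δ (k ^ 2 - l ^ 2)) = 2 * ∫⁻ k, ∫⁻ l, ENNReal.ofReal (‖a k‖ * ‖a l‖ * Gam δ (k ^ 2 - l ^ 2)) := by
    simp_rw [lintegral_const_mul' (2 : ENNReal) _ (by simp)]
  have h5 : ∫⁻ k, ∫⁻ l, (wA a k * (ENNReal.ofReal |l| * ENNReal.ofReal (Gam δ (k ^ 2 - l ^ 2))) + wA a l * (ENNReal.ofReal |k| * ENNReal.ofReal (Gam δ (l ^ 2 - k ^ 2)))) ≤ 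
      2 * (ENNReal.ofReal (2 * π) * ∫⁻ k, wA a k) := by
    have : ∀ k, ∫⁻ l, (wA a k * (ENNReal.ofReal |l| * ENNReal.ofReal (Gam δ (k ^ 2 - l ^ 2))) + wA a l * (ENNReal.ofReal |k| * ENNReal.ofReal (Gam δ (l ^ 2 - k ^ 2)))) = 
       (∫⁻ l, wA a k * (ENNReal.ofReal |l| * ENNReal.ofReal (Gam δ (k ^ 2 - l ^ 2)))) + ∫⁻ l, wA a l * (ENNReal.ofReal |k| * ENNReal.ofReal (Gam δ (l ^ 2 - k ^ 2))) := by
      intro k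
      apply lintegral_add_left
      have := hG.measurable
      fun_prop
    simp_rw [this]
    rw [lintegral_add_left' hm.lintegral_prod_right', two_mul]
    gcongr
  rw [h4] at h3
  exact (ENNReal.mul_le_mul_iff_right (by simp) (by simp)).mp (h3.trans h5)

lemma gauss_time {δ : ℝ} (hδ : 0 < δ) (θ : ℝ) :
    ∫ t : ℝ, (Real.exp (-δ * t ^ 2) : ℂ) * Complex.exp (Complex.I * ((θ * t : ℝ) : ℂ)) = ((Gam δ θ : ℝ) : ℂ) := by
  have h := fourierIntegral_gaussian (b := (δ : ℂ)) (by simpa using hδ) (θ : ℂ)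
  have e : ∀ t : ℝ, (Real.exp (-δ * t ^ 2) : ℂ) * Complex.exp (Complex.I * ((θ * t : ℝ) : ℂ)) =
      Complex.exp (Complex.I * θ * t) * Complex.exp (-δ * (t : ℂ) ^ 2) := by
    intro t; push_cast; rw [mul_comm, mul_assoc]
  simp_rw [e]
  rw [h]
  unfold Gam
  rw [Real.sqrt_eq_rpow]
  push_cast
  rw [Complex.ofReal_cpow (by positivity)]
  push_cast
  rfl

lemma Gs_sq_w {a : ℝ → ℂ} (ha : Integrable a) {σ : ℝ} (hσ : σ ^ 2 = 1) {δ : ℝ} (hδ : 0 < δ) :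
    ∫⁻ t, ENNReal.ofReal (Real.exp (-δ * t ^ 2) * ‖Gs σ a t‖ ^ 2) ≤ ENNReal.ofReal (2 * π) * ∫⁻ k, wA a k := by
  have hGb : ∀ t, ‖Gs σ a t‖ ≤ ∫ k, ‖a k‖ := by
    intro t
    unfold Gs
    refine (norm_integral_le_integral_norm _).trans (le_of_eq ?_)
    congr 1; ext k; rw [norm_mul, norm_eI, one_mul]
  have hGc := Gs_cont ha σ
  have hI : Integrable (fun t => Real.exp (-δ * t ^ 2) * ‖Gs σ a t‖ ^ 2) := by
    apply Integrable.mono' ((integrable_exp_neg_mul_sq hδ).mul_const ((∫ k, ‖a k‖) ^ 2)) (by fun_prop : Continuous _).aestronglyMeasurable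
    refine Eventually.of_forall (fun t => ?_)
    rw [Real.norm_eq_abs, abs_of_nonneg (by positivity)]
    gcongr
    exact hGb t
  rw [← ofReal_integral_eq_lintegral_ofReal hI (Eventually.of_forall (fun t => by positivity))]
  refine le_trans ?_ (schur_dbl ha.aestronglyMeasurable hδ)
  have hcj : Integrable (fun k => (starRingEnd ℂ) (a k)) := by
    refine ha.norm.mono' (Complex.continuous_conj.comp_aestronglyMeasurable ha.aestronglyMeasurable) (Eventually.of_forall (fun k => by rw [RCLike.norm_conj]))
  have hab : Integrable (fun p : ℝ × ℝ => a p.1 * (starRingEnd ℂ) (a p.2)) (volume.prod volume) := ha.mul_prod hcj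
  have e1 : ∀ t : ℝ, ((Real.exp (-δ * t ^ 2) * ‖Gs σ a t‖ ^ 2 : ℝ) : ℂ) = ∫ p : ℝ × ℝ,
      (Real.exp (-δ * t ^ 2) : ℂ) * Complex.exp (Complex.I * ((σ * (p.1 ^ 2 - p.2 ^ 2) * t : ℝ) : ℂ)) * (a p.1 * (starRingEnd ℂ) (a p.2)) := by
    intro t
    have : ∀ p : ℝ × ℝ, (Real.exp (-δ * t ^ 2) : ℂ) * Complex.exp (Complex.I * ((σ * (p.1 ^ 2 - p.2 ^ 2) * t : ℝ) : ℂ)) * (a p.1 * (starRingEnd ℂ) (a p.2)) = 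
      (Real.exp (-δ * t ^ 2) : ℂ) * ((Complex.exp (Complex.I * ((σ * p.1 ^ 2 * t : ℝ) : ℂ)) * a p.1) * (starRingEnd ℂ) (Complex.exp (Complex.I * ((σ * p.2 ^ 2 * t : ℝ) : ℂ)) * a p.2)) := by
      intro p
      rw [map_mul, conj_eI]
      have : Complex.exp (Complex.I * ((σ * (p.1 ^ 2 - p.2 ^ 2) * t : ℝ) : ℂ)) = Complex.exp (Complex.I * ((σ * p.1 ^ 2 * t : ℝ) : ℂ)) * Complex.exp (Complex.I * ((-(σ * p.2 ^ 2 * t) : ℝ) : ℂ)) := by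
        rw [← Complex.exp_add]; congr 1; push_cast; ring
      rw [this]; ring
    simp_rw [this]
    rw [integral_const_mul]
    have h2 := integral_prod_mul (μ := volume) (ν := volume) (fun k : ℝ => Complex.exp (Complex.I * ((σ * k ^ 2 * t : ℝ) : ℂ)) * a k) (fun k : ℝ => (starRingEnd ℂ) (Complex.exp (Complex.I * ((σ * k ^ 2 * t : ℝ) : ℂ)) * a k))
    rw [Measure.volume_eq_prod, h2, integral_conj]
    change _ = _ * (Gs σ a t * (starRingEnd ℂ) (Gs σ a t))
    rw [Complex.mul_conj']
    push_cast; rfl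
  have hdbl : Integrable (fun p : ℝ × ℝ => ‖a p.1‖ * ‖a p.2‖ * Gam δ (p.1 ^ 2 - p.2 ^ 2)) (volume.prod volume) := by
    apply Integrable.mono' (hab.norm.mul_const (Gam δ 0))
    · have h1 : AEStronglyMeasurable (fun p : ℝ × ℝ => ‖a p.1‖ * ‖a p.2‖) (volume.prod volume) :=
        (ha.norm.mul_prod ha.norm).aestronglyMeasurable
      have h2 : Continuous (fun p : ℝ × ℝ => Gam δ (p.1 ^ 2 - p.2 ^ 2)) := by unfold Gam; fun_prop
      exact h1.mul h2.aestronglyMeasurable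
    · refine Eventually.of_forall (fun p => ?_)
      have hG := Gam_nonneg δ (p.1 ^ 2 - p.2 ^ 2)
      rw [Real.norm_eq_abs, abs_of_nonneg (by positivity), norm_mul, RCLike.norm_conj]
      unfold Gam
      apply mul_le_mul_of_nonneg_left _ (by positivity)
      apply mul_le_mul_of_nonneg_left _ (by positivity)
      apply Real.exp_le_exp.mpr
      rw [div_le_div_iff_of_pos_right (by positivity)]
      nlinarith [sq_nonneg (p.1 ^ 2 - p.2 ^ 2)]
  have e2 : ((∫ t, Real.exp (-δ * t ^ 2) * ‖Gs σ a t‖ ^ 2 : ℝ) : ℂ) = ∫ p : ℝ × ℝ, ((Gam δ (p.1 ^ 2 - p.2 ^ 2) : ℝ) : ℂ) * (a p.1 * (starRingEnd ℂ) (a p.2)) := by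
    rw [← integral_complex_ofReal]
    simp_rw [e1]
    rw [integral_integral_swap]
    · congr 1
      ext p
      rw [integral_mul_const, gauss_time hδ]
      congr 2
      unfold Gam
      rw [mul_pow, hσ, one_mul]
    · have hb : Integrable (fun q : ℝ × (ℝ × ℝ) => Real.exp (-δ * q.1 ^ 2) * ‖a q.2.1 * (starRingEnd ℂ) (a q.2.2)‖) (volume.prod (volume.prod volume)) :=
        (integrable_exp_neg_mul_sq hδ).mul_prod hab.norm
      apply Integrable.mono' hb
      · apply AEStronglyMeasurable.mul
        · exact (by fun_prop : Continuous (fun q : ℝ × (ℝ × ℝ) => (Real.exp (-δ * q.1 ^ 2) : ℂ) * Complex.exp (Complex.I * ((σ * (q.2.1 ^ 2 - q.2.2 ^ 2) * q.1 : ℝ) : ℂ)))).aestronglyMeasurable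
        · exact hab.aestronglyMeasurable.comp_snd
      · refine Eventually.of_forall (fun q => ?_)
        simp only [Function.uncurry]
        rw [norm_mul, norm_mul, norm_eI, mul_one, Complex.norm_real, Real.norm_eq_abs, abs_of_pos (Real.exp_pos _)]
  have e3 : ∫ t, Real.exp (-δ * t ^ 2) * ‖Gs σ a t‖ ^ 2 ≤ ∫ p : ℝ × ℝ, ‖a p.1‖ * ‖a p.2‖ * Gam δ (p.1 ^ 2 - p.2 ^ 2) := by
    calc _ ≤ ‖((∫ t, Real.exp (-δ * t ^ 2) * ‖Gs σ a t‖ ^ 2 : ℝ) : ℂ)‖ := by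
          rw [Complex.norm_real]; exact le_abs_self _
      _ ≤ _ := by
        rw [e2]
        refine (norm_integral_le_integral_norm _).trans (le_of_eq ?_)
        congr 1; ext p
        rw [norm_mul, norm_mul, RCLike.norm_conj, Complex.norm_real, Real.norm_eq_abs, abs_of_nonneg (Gam_nonneg _ _)]
        ring
  refine (ENNReal.ofReal_le_ofReal e3).trans (le_of_eq ?_)
  rw [Measure.volume_eq_prod, ofReal_integral_eq_lintegral_ofReal hdbl (Eventually.of_forall (fun p => by have := Gam_nonneg δ (p.1 ^ 2 - p.2 ^ 2); positivity)),
    lintegral_prod _ hdbl.aestronglyMeasurable.aemeasurable.ennreal_ofReal]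

lemma Gs_sq {a : ℝ → ℂ} (ha : Integrable a) {σ : ℝ} (hσ : σ ^ 2 = 1) :
    ∫⁻ t, ENNReal.ofReal (‖Gs σ a t‖ ^ 2) ≤ ENNReal.ofReal (2 * π) * ∫⁻ k, wA a k := by
  have hGc := Gs_cont ha σ
  apply fatouE (F := fun n t => ENNReal.ofReal (Real.exp (-(en n) * t ^ 2) * ‖Gs σ a t‖ ^ 2))
  · intro n
    exact (by fun_prop : Continuous (fun t => Real.exp (-(en n) * t ^ 2) * ‖Gs σ a t‖ ^ 2)).measurable.ennreal_ofReal.aemeasurable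
  · refine Eventually.of_forall (fun t => ?_)
    apply (ENNReal.continuous_ofReal.tendsto _).comp
    simpa using (exp_en_tendsto t).mul_const (‖Gs σ a t‖ ^ 2)
  · intro n
    exact Gs_sq_w ha hσ (en_pos n)

def mk (k τ : ℝ) : ℝ := ‖Complex.exp (Complex.I * ((k ^ 2 * τ : ℝ) : ℂ)) - 1‖ ^ 2

lemma mk_sigma (k τ : ℝ) {σ : ℝ} (hσ : σ = 1 ∨ σ = -1) :
    ‖Complex.exp (Complex.I * ((σ * k ^ 2 * τ : ℝ) : ℂ)) - 1‖ ^ 2 = mk k τ := by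
  unfold mk
  rcases hσ with rfl | rfl
  · rw [one_mul]
  · rw [show -1 * k ^ 2 * τ = -(k ^ 2 * τ) by ring, ← conj_eI, ← RCLike.norm_conj]
    simp

lemma mk_nonneg (k τ : ℝ) : 0 ≤ mk k τ := by unfold mk; positivity

lemma mk_cont : Continuous (fun p : ℝ × ℝ => mk p.1 p.2) := by unfold mk; fun_prop

lemma dGs {a : ℝ → ℂ} (ha : Integrable a) {σ : ℝ} (hσ : σ = 1 ∨ σ = -1) (τ : ℝ) :
    ∫⁻ t, ENNReal.ofReal (‖Gs σ a (t + τ) - Gs σ a t‖ ^ 2) ≤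
      ENNReal.ofReal (2 * π) * ∫⁻ k, ENNReal.ofReal (mk k τ * ‖a k‖ ^ 2 / |k|) := by
  have hE : ∀ t : ℝ, Integrable (fun k : ℝ => Complex.exp (Complex.I * ((σ * k ^ 2 * t : ℝ) : ℂ)) * a k) := by
    intro t
    refine ha.norm.mono' ((by fun_prop : Continuous (fun k : ℝ => Complex.exp (Complex.I * ((σ * k ^ 2 * t : ℝ) : ℂ)))).aestronglyMeasurable.mul ha.aestronglyMeasurable) (Eventually.of_forall (fun k => ?_))
    rw [norm_mul, norm_eI, one_mul]
  have hb : Integrable (fun k : ℝ => (Complex.exp (Complex.I * ((σ * k ^ 2 * τ : ℝ) : ℂ)) - 1) * a k) := by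
    refine ((hE τ).sub ha).congr (Eventually.of_forall (fun k => ?_))
    simp only [Pi.sub_apply]; ring
  have e : ∀ t, Gs σ a (t + τ) - Gs σ a t = Gs σ (fun k : ℝ => (Complex.exp (Complex.I * ((σ * k ^ 2 * τ : ℝ) : ℂ)) - 1) * a k) t := by
    intro t
    unfold Gs
    rw [← integral_sub (hE _) (hE _)]
    congr 1
    ext k
    have : Complex.exp (Complex.I * ((σ * k ^ 2 * (t + τ) : ℝ) : ℂ)) = Complex.exp (Complex.I * ((σ * k ^ 2 * t : ℝ) : ℂ)) * Complex.exp (Complex.I * ((σ * k ^ 2 * τ : ℝ) : ℂ)) := by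
      rw [← Complex.exp_add]; congr 1; push_cast; ring
    rw [this]; ring
  simp_rw [e]
  refine (Gs_sq hb (by rcases hσ with rfl | rfl <;> norm_num)).trans (le_of_eq ?_)
  congr 1
  unfold wA
  simp_rw [norm_mul, mul_pow, mk_sigma _ _ hσ]

lemma dyE {f : ℝ → ℂ} (hf : Continuous f) {M : ℝ} (hM : ∀ t, ‖f t‖ ≤ M) {T : ℝ} (hT : 0 ≤ T)
    {ε : ℝ} (hε : 0 < ε) (τ : ℝ) :
    ∫⁻ t, ENNReal.ofReal (‖yE f T ε (t + τ) - yE f T ε t‖ ^ 2) ≤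
      ENNReal.ofReal (2 * π) * ∫⁻ k, ENNReal.ofReal (mk k τ * SS f T k / |k|) := by
  have g1 := Gs_cont (au_int hf hM hT hε (-1)) 1
  have g2 := Gs_cont (au_int hf hM hT hε 1) (-1)
  have d1 := dGs (au_int hf hM hT hε (-1)) (σ := 1) (Or.inl rfl) τ
  have d2 := dGs (au_int hf hM hT hε 1) (σ := -1) (Or.inr rfl) τ
  have c1 := au_cont hf hM T ε 1
  have c2 := au_cont hf hM T ε (-1)
  have hmk : Continuous (fun k => mk k τ) := by unfold mk; fun_prop
  have hp : ∀ t, ‖yE f T ε (t + τ) - yE f T ε t‖ ^ 2 ≤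
      ‖Gs 1 (au f T ε (-1)) (t + τ) - Gs 1 (au f T ε (-1)) t‖ ^ 2 + ‖Gs (-1) (au f T ε 1) (t + τ) - Gs (-1) (au f T ε 1) t‖ ^ 2 := by
    intro t
    rw [yE_eq hf hM hε, yE_eq hf hM hε]
    set x := Gs 1 (au f T ε (-1)) (t + τ) - Gs 1 (au f T ε (-1)) t with hx
    set y := Gs (-1) (au f T ε 1) (t + τ) - Gs (-1) (au f T ε 1) t with hy
    have : (1 / 2 : ℂ) * ((1 - Complex.I) * Gs 1 (au f T ε (-1)) (t + τ) + (1 + Complex.I) * Gs (-1) (au f T ε 1) (t + τ)) -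
       (1 / 2 : ℂ) * ((1 - Complex.I) * Gs 1 (au f T ε (-1)) t + (1 + Complex.I) * Gs (-1) (au f T ε 1) t) =
       (1 / 2 : ℂ) * ((1 - Complex.I) * x + (1 + Complex.I) * y) := by rw [hx, hy]; ring
    rw [this]
    clear_value x y
    rw [← Complex.normSq_eq_norm_sq, ← Complex.normSq_eq_norm_sq, ← Complex.normSq_eq_norm_sq]
    simp [Complex.normSq_apply]
    nlinarith [sq_nonneg (x.re + y.im), sq_nonneg (x.im - y.re), sq_nonneg (x.re - y.im), sq_nonneg (x.im + y.re)]
  calc _ ≤ ∫⁻ t, (ENNReal.ofReal (‖Gs 1 (au f T ε (-1)) (t + τ) - Gs 1 (au f T ε (-1)) t‖ ^ 2) + ENNReal.ofReal (‖Gs (-1) (au f T ε 1) (t + τ) - Gs (-1) (au f T ε 1) t‖ ^ 2)) := by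
        gcongr with t
        rw [← ENNReal.ofReal_add (by positivity) (by positivity)]
        exact ENNReal.ofReal_le_ofReal (hp t)
    _ = (∫⁻ t, ENNReal.ofReal (‖Gs 1 (au f T ε (-1)) (t + τ) - Gs 1 (au f T ε (-1)) t‖ ^ 2)) + ∫⁻ t, ENNReal.ofReal (‖Gs (-1) (au f T ε 1) (t + τ) - Gs (-1) (au f T ε 1) t‖ ^ 2) := by
        apply lintegral_add_left
        exact (by fun_prop : Continuous (fun t => ‖Gs 1 (au f T ε (-1)) (t + τ) - Gs 1 (au f T ε (-1)) t‖ ^ 2)).measurable.ennreal_ofReal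
    _ ≤ ENNReal.ofReal (2 * π) * (∫⁻ k, ENNReal.ofReal (mk k τ * ‖au f T ε (-1) k‖ ^ 2 / |k|)) + ENNReal.ofReal (2 * π) * ∫⁻ k, ENNReal.ofReal (mk k τ * ‖au f T ε 1 k‖ ^ 2 / |k|) := by
        gcongr
    _ = ENNReal.ofReal (2 * π) * ∫⁻ k, (ENNReal.ofReal (mk k τ * ‖au f T ε (-1) k‖ ^ 2 / |k|) + ENNReal.ofReal (mk k τ * ‖au f T ε 1 k‖ ^ 2 / |k|)) := by
        rw [lintegral_add_left, mul_add]
        have : Measurable (fun k => mk k τ * ‖au f T ε (-1) k‖ ^ 2 / |k|) :=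
          ((by fun_prop : Continuous (fun k => mk k τ * ‖au f T ε (-1) k‖ ^ 2)).measurable).div (by fun_prop)
        exact this.ennreal_ofReal
    _ ≤ _ := by
        gcongr with k
        have hm := mk_nonneg k τ
        rw [← ENNReal.ofReal_add (by positivity) (by positivity)]
        apply ENNReal.ofReal_le_ofReal
        rw [← add_div, ← mul_add]
        gcongr
        rw [au_norm, au_norm]
        unfold SS
        have he : Real.exp (-ε * k ^ 2) ≤ 1 := by
          rw [Real.exp_le_one_iff]; nlinarith [sq_nonneg k]
        have h1 : Real.exp (-ε * k ^ 2) * ‖uh f T 1 k‖ ≤ 1 * ‖uh f T 1 k‖ := by gcongr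
        have h2 : Real.exp (-ε * k ^ 2) * ‖uh f T (-1) k‖ ≤ 1 * ‖uh f T (-1) k‖ := by gcongr
        rw [one_mul] at h1 h2
        have := pow_le_pow_left₀ (by positivity) h1 2
        have := pow_le_pow_left₀ (by positivity) h2 2
        linarith

lemma dyT {f : ℝ → ℂ} (hf : Continuous f) {M : ℝ} (hM : ∀ t, ‖f t‖ ≤ M) {T : ℝ} (hT : 0 ≤ T)
    (τ : ℝ) :
    ∫⁻ t, ENNReal.ofReal (‖yT f T (t + τ) - yT f T t‖ ^ 2) ≤
      ∫⁻ k, ENNReal.ofReal (mk k τ * SS f T k / |k|) := by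
  have h : ∫⁻ t, ENNReal.ofReal (2 * π) * ENNReal.ofReal (‖yT f T (t + τ) - yT f T t‖ ^ 2) ≤
      ENNReal.ofReal (2 * π) * ∫⁻ k, ENNReal.ofReal (mk k τ * SS f T k / |k|) := by
    apply fatouE (F := fun n t => ENNReal.ofReal (‖yE f T (en n) (t + τ) - yE f T (en n) t‖ ^ 2))
    · intro n
      have := yE_cont hf hM hT (en_pos n)
      exact (by fun_prop : Continuous (fun t => ‖yE f T (en n) (t + τ) - yE f T (en n) t‖ ^ 2)).measurable.ennreal_ofReal.aemeasurable
    · refine Eventually.of_forall (fun t => ?_)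
      rw [← ENNReal.ofReal_mul (by positivity)]
      apply (ENNReal.continuous_ofReal.tendsto _).comp
      have l1 := ((yE_tendsto hf hM (T := T) (t + τ)).sub (yE_tendsto hf hM (T := T) t)).norm.pow 2
      rw [← mul_sub, norm_mul, mul_pow, Complex.norm_real, Real.norm_eq_abs, sq_abs, Real.sq_sqrt (by positivity)] at l1
      exact l1
    · intro n
      exact dyE hf hM hT (en_pos n) τ
  rw [lintegral_const_mul' _ _ ENNReal.ofReal_ne_top] at h
  exact (ENNReal.mul_le_mul_iff_right (by simp [Real.pi_pos]) ENNReal.ofReal_ne_top).mp h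

def hT (a f : ℝ → ℂ) (T : ℝ) (c : ℂ) (t : ℝ) : ℂ := ((2 * π)⁻¹ : ℝ) * Gs 1 a t - c * yT f T t

def BB (a f : ℝ → ℂ) (T k : ℝ) : ℝ := ‖a k‖ ^ 2 + SS f T k

lemma BB_nonneg (a f : ℝ → ℂ) (T k : ℝ) : 0 ≤ BB a f T k := by
  unfold BB; have := SS_nonneg f T k; positivity

lemma dh {f : ℝ → ℂ} (hf : Continuous f) {M : ℝ} (hM : ∀ t, ‖f t‖ ≤ M) {T : ℝ} (hT0 : 0 ≤ T)
    {a : ℝ → ℂ} (ha : Integrable a) {c : ℂ} (hc : ‖c‖ ^ 2 = (2 * π)⁻¹) (τ : ℝ) :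
    ∫⁻ t, ENNReal.ofReal (‖hT a f T c (t + τ) - hT a f T c t‖ ^ 2) ≤
      ∫⁻ k, ENNReal.ofReal (mk k τ * BB a f T k / |k|) := by
  have d1 := dGs ha (σ := 1) (Or.inl rfl) τ
  have d2 := dyT hf hM hT0 τ
  have g1 := Gs_cont ha 1
  have hp : ∀ t, ‖hT a f T c (t + τ) - hT a f T c t‖ ^ 2 ≤
     (2 * π)⁻¹ * ‖Gs 1 a (t + τ) - Gs 1 a t‖ ^ 2 + ‖yT f T (t + τ) - yT f T t‖ ^ 2 := by
    intro t
    have e : hT a f T c (t + τ) - hT a f T c t = ((2 * π)⁻¹ : ℝ) * (Gs 1 a (t + τ) - Gs 1 a t) - c * (yT f T (t + τ) - yT f T t) := by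
      unfold hT; ring
    rw [e]
    set x := Gs 1 a (t + τ) - Gs 1 a t
    set y := yT f T (t + τ) - yT f T t
    have h1 : ‖((2 * π)⁻¹ : ℝ) * x - c * y‖ ≤ (2 * π)⁻¹ * ‖x‖ + ‖c‖ * ‖y‖ := by
      refine (norm_sub_le _ _).trans (le_of_eq ?_)
      rw [norm_mul, norm_mul, Complex.norm_real, Real.norm_eq_abs, abs_of_nonneg (by positivity)]
    have h2 := pow_le_pow_left₀ (norm_nonneg _) h1 2
    have h3 : (2 * π)⁻¹ ≤ 1 / 2 := by
      rw [inv_le_comm₀ (by positivity) (by norm_num)]; have := Real.pi_gt_three; norm_num; linarith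
    have h4 : 0 ≤ (2 * π)⁻¹ := by positivity
    generalize (2 * π)⁻¹ = p at *
    have h5 : (p * ‖x‖ + ‖c‖ * ‖y‖) ^ 2 ≤ 2 * (p ^ 2 * ‖x‖ ^ 2) + 2 * (‖c‖ ^ 2 * ‖y‖ ^ 2) := by
      nlinarith [sq_nonneg (p * ‖x‖ - ‖c‖ * ‖y‖)]
    rw [hc] at h5
    have h6 : p ^ 2 * ‖x‖ ^ 2 ≤ (1 / 2 * p) * ‖x‖ ^ 2 := by
      gcongr; nlinarith
    have h7 : p * ‖y‖ ^ 2 ≤ 1 / 2 * ‖y‖ ^ 2 := by gcongr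
    linarith
  calc _ ≤ ∫⁻ t, (ENNReal.ofReal (2 * π)⁻¹ * ENNReal.ofReal (‖Gs 1 a (t + τ) - Gs 1 a t‖ ^ 2) + ENNReal.ofReal (‖yT f T (t + τ) - yT f T t‖ ^ 2)) := by
        gcongr with t
        rw [← ENNReal.ofReal_mul (by positivity), ← ENNReal.ofReal_add (by positivity) (by positivity)]
        exact ENNReal.ofReal_le_ofReal (hp t)
    _ = ENNReal.ofReal (2 * π)⁻¹ * (∫⁻ t, ENNReal.ofReal (‖Gs 1 a (t + τ) - Gs 1 a t‖ ^ 2)) + ∫⁻ t, ENNReal.ofReal (‖yT f T (t + τ) - yT f T t‖ ^ 2) := by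
        rw [lintegral_add_left, lintegral_const_mul' _ _ ENNReal.ofReal_ne_top]
        exact ((by fun_prop : Continuous (fun t => ‖Gs 1 a (t + τ) - Gs 1 a t‖ ^ 2)).measurable.ennreal_ofReal).const_mul _
    _ ≤ ENNReal.ofReal (2 * π)⁻¹ * (ENNReal.ofReal (2 * π) * ∫⁻ k, ENNReal.ofReal (mk k τ * ‖a k‖ ^ 2 / |k|)) + ∫⁻ k, ENNReal.ofReal (mk k τ * SS f T k / |k|) := by
        gcongr
    _ = (∫⁻ k, ENNReal.ofReal (mk k τ * ‖a k‖ ^ 2 / |k|)) + ∫⁻ k, ENNReal.ofReal (mk k τ * SS f T k / |k|) := by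
        rw [← mul_assoc, ← ENNReal.ofReal_mul (by positivity), inv_mul_cancel₀ (by positivity)]
        simp
    _ = ∫⁻ k, (ENNReal.ofReal (mk k τ * ‖a k‖ ^ 2 / |k|) + ENNReal.ofReal (mk k τ * SS f T k / |k|)) := by
        rw [lintegral_add_right]
        have h1 := SS_cont hf hM T
        have h2 : Continuous (fun k => mk k τ) := by unfold mk; fun_prop
        have : Measurable (fun k => mk k τ * SS f T k / |k|) :=
          ((by fun_prop : Continuous (fun k => mk k τ * SS f T k)).measurable).div (by fun_prop)
        exact this.ennreal_ofReal
    _ = _ := by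
        congr 1; ext k
        have := mk_nonneg k τ
        have := SS_nonneg f T k
        rw [← ENNReal.ofReal_add (by positivity) (by positivity)]
        unfold BB; congr 1; ring

lemma mk_le4 (k τ : ℝ) : mk k τ ≤ 4 := by
  unfold mk
  have : ‖Complex.exp (Complex.I * ((k ^ 2 * τ : ℝ) : ℂ)) - 1‖ ≤ 2 := by
    refine (norm_sub_le _ _).trans ?_
    rw [norm_eI]; norm_num
  nlinarith [norm_nonneg (Complex.exp (Complex.I * ((k ^ 2 * τ : ℝ) : ℂ)) - 1)]

lemma mk_le (k τ : ℝ) : mk k τ ≤ (k ^ 2 * |τ|) ^ 2 := by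
  unfold mk
  have := Real.norm_exp_I_mul_ofReal_sub_one_le (x := k ^ 2 * τ)
  refine pow_le_pow_left₀ (norm_nonneg _) (this.trans (le_of_eq ?_)) 2
  rw [Real.norm_eq_abs, abs_mul, abs_of_nonneg (sq_nonneg k)]

lemma mk_32 (k τ : ℝ) : mk k τ ≤ 2 * ((k ^ 2 * |τ|) * (|k| * √|τ|)) := by
  have h4 := mk_le4 k τ
  have h2 := mk_le k τ
  have hs : (|k| * √|τ|) ^ 2 = k ^ 2 * |τ| := by
    rw [mul_pow, sq_abs, Real.sq_sqrt (abs_nonneg _)]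
  have hy : 0 ≤ |k| * √|τ| := by positivity
  rw [← hs] at h2 ⊢
  set y := |k| * √|τ|
  rcases le_or_gt y 2 with h | h
  · have : 0 ≤ y ^ 3 := by positivity
    nlinarith
  · have : 8 ≤ y ^ 2 * y := by nlinarith
    linarith

def t32 (u : ℝ) : ℝ := (|u| * √|u|)⁻¹
lemma t32_nonneg (u : ℝ) : 0 ≤ t32 u := by unfold t32; positivity
lemma t32_meas : Measurable t32 := by unfold t32; fun_prop

def CJ : ℝ := ∫ u, JJ u
lemma CJ_nonneg : 0 ≤ CJ := integral_nonneg JJ_nonneg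

lemma mk_JJ {k : ℝ} (hk : k ≠ 0) (τ : ℝ) : mk k τ * t32 τ ≤ 4 * |k| ^ 3 * JJ (k ^ 2 * τ) := by
  rcases eq_or_ne τ 0 with rfl | hτ
  · have := JJ_nonneg 0
    simp only [t32, abs_zero, zero_mul, inv_zero, mul_zero]
    positivity
  have hk' := abs_pos.mpr hk
  have hτ' := abs_pos.mpr hτ
  have ev : |k ^ 2 * τ| = k ^ 2 * |τ| := by rw [abs_mul, abs_of_nonneg (sq_nonneg k)]
  have es : √|k ^ 2 * τ| = |k| * √|τ| := by
    rw [ev, Real.sqrt_mul (sq_nonneg k), Real.sqrt_sq_eq_abs]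
  unfold JJ t32
  rw [es, ev]
  have hs := Real.sqrt_pos.mpr hτ'
  have hss : √|τ| * √|τ| = |τ| := Real.mul_self_sqrt hτ'.le
  have hkk : k ^ 2 = |k| ^ 2 := (sq_abs k).symm
  split_ifs with h
  · have h2 := mk_le k τ
    have h3 : (k ^ 2 * |τ|) ^ 2 ≤ k ^ 2 * |τ| := by
      have : 0 ≤ k ^ 2 * |τ| := by positivity
      nlinarith
    calc mk k τ * (|τ| * √|τ|)⁻¹ ≤ (k ^ 2 * |τ|) * (|τ| * √|τ|)⁻¹ := by gcongr; exact h2.trans h3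
      _ = |k| ^ 3 * (|k| * √|τ|)⁻¹ := by rw [hkk]; field_simp
      _ ≤ _ := by
        have : 0 ≤ |k| ^ 3 * (|k| * √|τ|)⁻¹ := by positivity
        linarith
  · calc mk k τ * (|τ| * √|τ|)⁻¹ ≤ 4 * (|τ| * √|τ|)⁻¹ := by gcongr; exact mk_le4 k τ
      _ = _ := by rw [hkk]; field_simp

lemma tau_int {k : ℝ} (hk : k ≠ 0) :
    ∫⁻ τ, ENNReal.ofReal (mk k τ * t32 τ) ≤ ENNReal.ofReal (4 * CJ * |k|) := by
  have hk' := abs_pos.mpr hk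
  have hI : Integrable (fun τ => 4 * |k| ^ 3 * JJ (k ^ 2 * τ)) :=
    (JJ_int.comp_mul_left' (by positivity)).const_mul _
  calc _ ≤ ∫⁻ τ, ENNReal.ofReal (4 * |k| ^ 3 * JJ (k ^ 2 * τ)) :=
        lintegral_mono (fun τ => ENNReal.ofReal_le_ofReal (mk_JJ hk τ))
    _ = ENNReal.ofReal (∫ τ, 4 * |k| ^ 3 * JJ (k ^ 2 * τ)) := by
        rw [ofReal_integral_eq_lintegral_ofReal hI]
        exact Eventually.of_forall (fun τ => by have := JJ_nonneg (k ^ 2 * τ); positivity)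
    _ = _ := by
        rw [integral_const_mul, Measure.integral_comp_mul_left]
        congr 1
        rw [abs_of_nonneg (by positivity : (0:ℝ) ≤ (k ^ 2)⁻¹), smul_eq_mul, ← sq_abs]
        unfold CJ
        field_simp

lemma tau_dbl {B : ℝ → ℝ} (hB : AEMeasurable B volume) (hB0 : ∀ k, 0 ≤ B k) :
    ∫⁻ τ, ENNReal.ofReal (t32 τ) * ∫⁻ k, ENNReal.ofReal (mk k τ * B k / |k|) ≤
      ENNReal.ofReal (4 * CJ) * ∫⁻ k, ENNReal.ofReal (B k) := by
  have hmk := mk_cont.measurable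
  have ht := t32_meas
  have e : ∀ τ, ENNReal.ofReal (t32 τ) * ∫⁻ k, ENNReal.ofReal (mk k τ * B k / |k|) =
      ∫⁻ k, ENNReal.ofReal (B k / |k|) * ENNReal.ofReal (mk k τ * t32 τ) := by
    intro τ
    rw [← lintegral_const_mul' _ _ ENNReal.ofReal_ne_top]
    congr 1; ext k
    have := hB0 k
    rw [← ENNReal.ofReal_mul (t32_nonneg τ), ← ENNReal.ofReal_mul (by positivity)]
    congr 1; ring
  simp_rw [e]
  rw [lintegral_lintegral_swap]
  · rw [← lintegral_const_mul' _ _ ENNReal.ofReal_ne_top]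
    apply lintegral_mono_ae
    have ne0 : ∀ᵐ k : ℝ, k ≠ 0 := by simp [ae_iff]
    filter_upwards [ne0] with k hk
    have h1 := hB0 k
    have hk' := abs_pos.mpr hk
    have h2 := CJ_nonneg
    rw [lintegral_const_mul' _ _ ENNReal.ofReal_ne_top]
    calc _ ≤ ENNReal.ofReal (B k / |k|) * ENNReal.ofReal (4 * CJ * |k|) := by gcongr; exact tau_int hk
      _ = _ := by
        rw [← ENNReal.ofReal_mul (by positivity), ← ENNReal.ofReal_mul (by positivity)]
        congr 1; field_simp
  · have h1 : AEMeasurable (fun k => B k / |k|) volume := hB.div (by fun_prop)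
    have h2 : Measurable (fun p : ℝ × ℝ => mk p.2 p.1) := by
      have := hmk.comp (measurable_snd.prodMk measurable_fst : Measurable (fun p : ℝ × ℝ => (p.2, p.1)))
      exact this
    have h3 : AEMeasurable (fun p : ℝ × ℝ => ENNReal.ofReal (B p.2 / |p.2|)) (volume.prod volume) :=
      (h1.comp_snd (μ := volume)).ennreal_ofReal
    have h4 : AEMeasurable (fun p : ℝ × ℝ => ENNReal.ofReal (mk p.2 p.1 * t32 p.1)) (volume.prod volume) :=
      ((h2.mul (ht.comp measurable_fst)).ennreal_ofReal).aemeasurable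
    exact h3.mul h4

def mu2 (T : ℝ) : Measure (ℝ × ℝ) := (volume.restrict (Ioc 0 T)).prod (volume.restrict (Ioc 0 T))

def Df (f : ℝ → ℂ) (T : ℝ) : ENNReal :=
  ∫⁻ p, ENNReal.ofReal (‖f p.1 - f p.2‖ ^ 2 * t32 (p.1 - p.2)) ∂(mu2 T)

lemma Df_le {f : ℝ → ℂ} (hf : Continuous f) {M : ℝ} (hM : ∀ t, ‖f t‖ ≤ M) {T : ℝ} (hT0 : 0 ≤ T)
    {a : ℝ → ℂ} (ha : Integrable a) {c : ℂ} (hc : ‖c‖ ^ 2 = (2 * π)⁻¹) {L : ℝ} (_hL0 : 0 ≤ L)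
    (hL : ∀ t ∈ Ioc 0 T, ∀ s ∈ Ioc 0 T, ‖f t - f s‖ ≤ L * ‖hT a f T c t - hT a f T c s‖) :
    Df f T ≤ ENNReal.ofReal (L ^ 2 * (4 * CJ)) * ∫⁻ k, ENNReal.ofReal (BB a f T k) := by
  have hm := t32_meas
  have hfm := hf.measurable
  unfold Df mu2
  rw [Measure.prod_restrict, ← lintegral_indicator (measurableSet_Ioc.prod measurableSet_Ioc)]
  set Q : ℝ × ℝ → ENNReal := (Ioc 0 T ×ˢ Ioc 0 T).indicator (fun p => ENNReal.ofReal (‖f p.1 - f p.2‖ ^ 2 * t32 (p.1 - p.2))) with hQ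
  have hQm : Measurable Q := by
    apply Measurable.indicator _ (measurableSet_Ioc.prod measurableSet_Ioc)
    fun_prop
  rw [lintegral_prod_symm' _ hQm]
  have e : ∀ s, ∫⁻ t, Q (t, s) = ∫⁻ τ, Q (τ + s, s) := fun s => (lintegral_add_right_eq_self (fun t => Q (t, s)) s).symm
  simp_rw [e]
  rw [lintegral_lintegral_swap (by
    exact (hQm.comp (by fun_prop : Measurable (fun p : ℝ × ℝ => (p.2 + p.1, p.1)))).aemeasurable)]
  have hp : ∀ τ s, Q (τ + s, s) ≤ ENNReal.ofReal (L ^ 2) * (ENNReal.ofReal (t32 τ) * ENNReal.ofReal (‖hT a f T c (s + τ) - hT a f T c s‖ ^ 2)) := by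
    intro τ s
    rw [hQ]
    by_cases h : (τ + s, s) ∈ Ioc 0 T ×ˢ Ioc 0 T
    · rw [indicator_of_mem h, ← ENNReal.ofReal_mul (t32_nonneg τ), ← ENNReal.ofReal_mul (by positivity)]
      apply ENNReal.ofReal_le_ofReal
      simp only [add_sub_cancel_right]
      have h1 := hL _ h.1 _ h.2
      simp only at h1
      have h2 := pow_le_pow_left₀ (norm_nonneg _) h1 2
      have h3 := t32_nonneg τ
      rw [add_comm s τ]
      calc _ ≤ (L * ‖hT a f T c (τ + s) - hT a f T c s‖) ^ 2 * t32 τ := by gcongr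
        _ = _ := by ring
    · rw [indicator_of_notMem h]; exact zero_le
  have hSc := SS_cont hf hM T
  have hBm : AEMeasurable (BB a f T) volume := by
    unfold BB
    have := ha.aestronglyMeasurable.norm.aemeasurable
    have := hSc.measurable
    fun_prop
  calc _ ≤ ∫⁻ τ, ∫⁻ s, ENNReal.ofReal (L ^ 2) * (ENNReal.ofReal (t32 τ) * ENNReal.ofReal (‖hT a f T c (s + τ) - hT a f T c s‖ ^ 2)) := by
        gcongr with τ s
        exact hp τ s
    _ = ENNReal.ofReal (L ^ 2) * ∫⁻ τ, ENNReal.ofReal (t32 τ) * ∫⁻ s, ENNReal.ofReal (‖hT a f T c (s + τ) - hT a f T c s‖ ^ 2) := by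
        simp_rw [lintegral_const_mul' _ _ ENNReal.ofReal_ne_top]
    _ ≤ ENNReal.ofReal (L ^ 2) * ∫⁻ τ, ENNReal.ofReal (t32 τ) * ∫⁻ k, ENNReal.ofReal (mk k τ * BB a f T k / |k|) :=
        mul_le_mul' le_rfl (lintegral_mono (fun τ => mul_le_mul' le_rfl (dh hf hM hT0 ha hc τ)))
    _ ≤ ENNReal.ofReal (L ^ 2) * (ENNReal.ofReal (4 * CJ) * ∫⁻ k, ENNReal.ofReal (BB a f T k)) := by
        gcongr
        exact tau_dbl hBm (BB_nonneg a f T)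
    _ = _ := by
        rw [← mul_assoc, ← ENNReal.ofReal_mul (by positivity)]

instance mu2_fin (T : ℝ) : IsFiniteMeasure (mu2 T) := by unfold mu2; infer_instance

lemma bint {α : Type*} [TopologicalSpace α] [MeasurableSpace α] [OpensMeasurableSpace α] [SecondCountableTopology α]
    {E : Type*} [NormedAddCommGroup E] [SecondCountableTopology E]
    (μ : Measure α) [IsFiniteMeasure μ] {g : α → E} (hg : Continuous g) (C : ℝ)
    (hC : ∀ p, ‖g p‖ ≤ C) : Integrable g μ :=
  (integrable_const C).mono' hg.aestronglyMeasurable (Eventually.of_forall hC)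

lemma SS_dbl {f : ℝ → ℂ} (hf : Continuous f) {M : ℝ} (hM : ∀ t, ‖f t‖ ≤ M) (T k : ℝ) :
    SS f T k = ∫ p, 2 * cos (k ^ 2 * (p.1 - p.2)) * (f p.1 * (starRingEnd ℂ) (f p.2)).re ∂(mu2 T) := by
  have hM0 : 0 ≤ M := (norm_nonneg _).trans (hM 0)
  have h : ∀ σ : ℝ, ((‖uh f T σ k‖ ^ 2 : ℝ) : ℂ) =
      ∫ p, Complex.exp (Complex.I * ((σ * k ^ 2 * (p.1 - p.2) : ℝ) : ℂ)) * (f p.1 * (starRingEnd ℂ) (f p.2)) ∂(mu2 T) := by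
    intro σ
    rw [Complex.ofReal_pow, ← Complex.mul_conj']
    unfold uh
    rw [← integral_conj, mu2, ← integral_prod_mul]
    congr 1; ext p
    rw [map_mul, conj_eI]
    rw [show Complex.I * ((σ * k ^ 2 * (p.1 - p.2) : ℝ) : ℂ) = Complex.I * ((σ * k ^ 2 * p.1 : ℝ) : ℂ) +
      Complex.I * ((-(σ * k ^ 2 * p.2) : ℝ) : ℂ) by push_cast; ring, Complex.exp_add]
    ring
  have hi : ∀ σ : ℝ, Integrable (fun p : ℝ × ℝ => Complex.exp (Complex.I * ((σ * k ^ 2 * (p.1 - p.2) : ℝ) : ℂ)) * (f p.1 * (starRingEnd ℂ) (f p.2))) (mu2 T) := by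
    intro σ
    apply bint _ _ (M * M)
    · intro p
      rw [norm_mul, norm_eI, one_mul, norm_mul, RCLike.norm_conj]
      gcongr <;> apply hM
    · have := Complex.continuous_conj
      fun_prop
  have hsum : ((SS f T k : ℝ) : ℂ) = ∫ p, (Complex.exp (Complex.I * ((1 * k ^ 2 * (p.1 - p.2) : ℝ) : ℂ)) * (f p.1 * (starRingEnd ℂ) (f p.2)) + Complex.exp (Complex.I * ((-1 * k ^ 2 * (p.1 - p.2) : ℝ) : ℂ)) * (f p.1 * (starRingEnd ℂ) (f p.2))) ∂(mu2 T) := by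
    rw [integral_add (hi 1) (hi (-1)), ← h 1, ← h (-1)]
    unfold SS; push_cast; rfl
  have h2 := congrArg Complex.re hsum
  rw [Complex.ofReal_re] at h2
  have hi12 : Integrable (fun p : ℝ × ℝ => (Complex.exp (Complex.I * ((1 * k ^ 2 * (p.1 - p.2) : ℝ) : ℂ)) * (f p.1 * (starRingEnd ℂ) (f p.2)) + Complex.exp (Complex.I * ((-1 * k ^ 2 * (p.1 - p.2) : ℝ) : ℂ)) * (f p.1 * (starRingEnd ℂ) (f p.2)))) (mu2 T) := (hi 1).add (hi (-1))
  rw [h2, ← RCLike.re_eq_complex_re, ← integral_re hi12]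
  congr 1; ext p
  rw [← add_mul]
  have : Complex.exp (Complex.I * ((1 * k ^ 2 * (p.1 - p.2) : ℝ) : ℂ)) + Complex.exp (Complex.I * ((-1 * k ^ 2 * (p.1 - p.2) : ℝ) : ℂ)) = ((2 * cos (k ^ 2 * (p.1 - p.2)) : ℝ) : ℂ) := by
    push_cast
    rw [Complex.two_cos]
    congr 2 <;> ring
  rw [this, RCLike.re_eq_complex_re, Complex.re_ofReal_mul]

lemma sin_int (q T t : ℝ) (hT : 0 ≤ T) : ∫ s in Ioc 0 T, q * cos (q * (t - s)) = sin (q * t) + sin (q * (T - t)) := by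
  rw [← intervalIntegral.integral_of_le hT]
  have hd : ∀ s ∈ uIcc 0 T, HasDerivAt (fun s => - sin (q * (t - s))) (q * cos (q * (t - s))) s := by
    intro s _
    have h1 : HasDerivAt (fun s => q * (t - s)) (q * (-1)) s := ((hasDerivAt_id s).const_sub t).const_mul q
    have := (h1.sin).neg
    refine this.congr_deriv ?_
    ring
  rw [intervalIntegral.integral_eq_sub_of_hasDerivAt hd (by apply Continuous.intervalIntegrable; fun_prop)]
  rw [show q * (T - t) = -(q * (t - T)) by ring, sin_neg]
  simp; ring

lemma k2SS {f : ℝ → ℂ} (hf : Continuous f) {M : ℝ} (hM : ∀ t, ‖f t‖ ≤ M) {T : ℝ} (hT : 0 ≤ T) (k : ℝ) :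
    k ^ 2 * SS f T k = 2 * (∫ t in Ioc 0 T, ‖f t‖ ^ 2 * (sin (k ^ 2 * t) + sin (k ^ 2 * (T - t)))) -
      ∫ p, k ^ 2 * cos (k ^ 2 * (p.1 - p.2)) * ‖f p.1 - f p.2‖ ^ 2 ∂(mu2 T) := by
  have hM0 : 0 ≤ M := (norm_nonneg _).trans (hM 0)
  have hc : ∀ x : ℝ, |cos x| ≤ 1 := Real.abs_cos_le_one
  have b1 : ∀ p : ℝ × ℝ, ‖k ^ 2 * cos (k ^ 2 * (p.1 - p.2)) * ‖f p.1‖ ^ 2‖ ≤ k ^ 2 * 1 * M ^ 2 := by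
    intro p
    rw [norm_mul, norm_mul, norm_pow, norm_pow, norm_norm, Real.norm_eq_abs k, sq_abs, Real.norm_eq_abs]
    gcongr
    · apply hc
    · apply hM
  have i1 : Integrable (fun p : ℝ × ℝ => k ^ 2 * cos (k ^ 2 * (p.1 - p.2)) * ‖f p.1‖ ^ 2) (mu2 T) :=
    bint _ (by fun_prop) _ b1
  have i2 : Integrable (fun p : ℝ × ℝ => k ^ 2 * cos (k ^ 2 * (p.1 - p.2)) * ‖f p.2‖ ^ 2) (mu2 T) := by
    refine bint _ (by fun_prop) (k ^ 2 * 1 * M ^ 2) (fun p => ?_)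
    have := b1 (p.2, p.1)
    simp only at this
    rwa [show k ^ 2 * (p.2 - p.1) = -(k ^ 2 * (p.1 - p.2)) by ring, cos_neg] at this
  have i3 : Integrable (fun p : ℝ × ℝ => k ^ 2 * cos (k ^ 2 * (p.1 - p.2)) * ‖f p.1 - f p.2‖ ^ 2) (mu2 T) := by
    refine bint _ (by fun_prop) (k ^ 2 * 1 * (M + M) ^ 2) (fun p => ?_)
    rw [norm_mul, norm_mul, norm_pow, norm_pow, norm_norm, Real.norm_eq_abs k, sq_abs, Real.norm_eq_abs]
    gcongr
    · apply hc
    · exact (norm_sub_le _ _).trans (add_le_add (hM _) (hM _))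
  have e1 : ∫ p, k ^ 2 * cos (k ^ 2 * (p.1 - p.2)) * ‖f p.1‖ ^ 2 ∂(mu2 T) =
      ∫ t in Ioc 0 T, ‖f t‖ ^ 2 * (sin (k ^ 2 * t) + sin (k ^ 2 * (T - t))) := by
    rw [mu2] at i1 ⊢
    rw [integral_prod _ i1]
    congr 1; ext t
    simp only
    rw [integral_mul_const, sin_int _ _ _ hT, mul_comm]
  have e2 : ∫ p, k ^ 2 * cos (k ^ 2 * (p.1 - p.2)) * ‖f p.2‖ ^ 2 ∂(mu2 T) =
      ∫ p, k ^ 2 * cos (k ^ 2 * (p.1 - p.2)) * ‖f p.1‖ ^ 2 ∂(mu2 T) := by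
    unfold mu2
    rw [← integral_prod_swap]
    congr 1; ext p
    simp only [Prod.fst_swap, Prod.snd_swap]
    rw [show k ^ 2 * (p.2 - p.1) = -(k ^ 2 * (p.1 - p.2)) by ring, cos_neg]
  rw [SS_dbl hf hM, ← integral_const_mul, ← e1, two_mul]
  nth_rw 2 [← e2]
  have i12 : Integrable (fun p : ℝ × ℝ => k ^ 2 * cos (k ^ 2 * (p.1 - p.2)) * ‖f p.1‖ ^ 2 + k ^ 2 * cos (k ^ 2 * (p.1 - p.2)) * ‖f p.2‖ ^ 2) (mu2 T) := i1.add i2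
  rw [← integral_add i1 i2, ← integral_sub i12 i3]
  congr 1; ext p
  have : ‖f p.1 - f p.2‖ ^ 2 = ‖f p.1‖ ^ 2 + ‖f p.2‖ ^ 2 - 2 * (f p.1 * (starRingEnd ℂ) (f p.2)).re := by
    rw [← Complex.normSq_eq_norm_sq, ← Complex.normSq_eq_norm_sq, ← Complex.normSq_eq_norm_sq, Complex.normSq_sub]
  rw [this]; ring

def we (ε k : ℝ) : ℝ := Real.exp (-ε * k ^ 2) - Real.exp (-1 * k ^ 2)
lemma we_nonneg {ε : ℝ} (h1 : ε < 1) (k : ℝ) : 0 ≤ we ε k := by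
  unfold we
  have : Real.exp (-1 * k ^ 2) ≤ Real.exp (-ε * k ^ 2) := by
    apply Real.exp_le_exp.mpr; nlinarith [sq_nonneg k]
  linarith
lemma we_cont (ε : ℝ) : Continuous (we ε) := by unfold we; fun_prop
lemma we_int {ε : ℝ} (h0 : 0 < ε) : Integrable (we ε) :=
  (integrable_exp_neg_mul_sq h0).sub (integrable_exp_neg_mul_sq one_pos)
lemma k2exp_int {ε : ℝ} (h0 : 0 < ε) : Integrable (fun k : ℝ => k ^ 2 * Real.exp (-ε * k ^ 2)) := by
  have := integrable_rpow_mul_exp_neg_mul_sq h0 (s := 2) (by norm_num)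
  simpa using this
lemma k2we_int {ε : ℝ} (h0 : 0 < ε) : Integrable (fun k => k ^ 2 * we ε k) := by
  have := (k2exp_int h0).sub (k2exp_int one_pos)
  refine this.congr (Eventually.of_forall (fun k => ?_))
  simp only [Pi.sub_apply, we]; ring

lemma cexp_re (ε u k : ℝ) : Complex.exp (-((ε : ℂ) - Complex.I * (u : ℂ)) * (k : ℂ) ^ 2) =
    ((Real.exp (-ε * k ^ 2) * cos (k ^ 2 * u) : ℝ) : ℂ) + ((Real.exp (-ε * k ^ 2) * sin (k ^ 2 * u) : ℝ) : ℂ) * Complex.I := by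
  rw [show -((ε : ℂ) - Complex.I * (u : ℂ)) * (k : ℂ) ^ 2 = ((-ε * k ^ 2 : ℝ) : ℂ) + ((k ^ 2 * u : ℝ) : ℂ) * Complex.I by push_cast; ring]
  rw [Complex.exp_add, Complex.exp_mul_I]
  push_cast; ring

lemma ce_int {ε : ℝ} (h0 : 0 < ε) (u : ℝ) : Integrable (fun k : ℝ => Complex.exp (-((ε : ℂ) - Complex.I * (u : ℂ)) * (k : ℂ) ^ 2)) := by
  apply integrable_cexp_neg_mul_sq; simpa using h0

def Rw (ε u : ℝ) : ℝ := ∫ k, we ε k * sin (k ^ 2 * u)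
def rw2 (ε u : ℝ) : ℝ := ∫ k, we ε k * (k ^ 2 * cos (k ^ 2 * u))

lemma Rw_eq {ε : ℝ} (h0 : 0 < ε) (u : ℝ) : Rw ε u = (EE ε u - EE 1 u).im := by
  rw [← EE_int h0, ← EE_int one_pos, ← integral_sub (ce_int h0 u) (ce_int one_pos u)]
  refine Eq.trans ?_ (integral_im (𝕜 := ℂ) ((ce_int h0 u).sub (ce_int one_pos u)))
  unfold Rw we
  congr 1; ext k
  rw [cexp_re, cexp_re]
  simp only [RCLike.im_eq_complex_im, Complex.sub_im, Complex.add_im, Complex.ofReal_im, Complex.mul_im, Complex.ofReal_re, Complex.I_im, Complex.I_re]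
  ring

lemma Rw_le {ε : ℝ} (h0 : 0 < ε) (h1 : ε < 1) {u : ℝ} (hu : 0 ≤ u) : |Rw ε u| ≤ 2 * √π * JJ u := by
  rcases hu.eq_or_lt with rfl | hu
  · have := JJ_nonneg 0
    simp [Rw]; positivity
  have hb : |Rw ε u| ≤ ‖EE ε u - EE 1 u‖ := by rw [Rw_eq h0]; exact Complex.abs_im_le_norm _
  refine hb.trans ?_
  unfold JJ
  rw [abs_of_pos hu]
  have hs := Real.sqrt_pos.mpr hu
  split_ifs with h
  · have e1 := EE_norm_le ε u hu.ne'
    have e2 := EE_norm_le 1 u hu.ne'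
    rw [abs_of_pos hu] at e1 e2
    linarith [norm_sub_le (EE ε u) (EE 1 u)]
  · have e := EE_diff h0 h1 hu
    have : 0 ≤ √π * (u * √u)⁻¹ := by positivity
    linarith

lemma k2ce {ε : ℝ} (h0 : 0 < ε) (u : ℝ) :
    Integrable (fun k : ℝ => (k : ℂ) ^ 2 * Complex.exp (-((ε : ℂ) - Complex.I * (u : ℂ)) * (k : ℂ) ^ 2)) ∧
    ∫ k : ℝ, (k : ℂ) ^ 2 * Complex.exp (-((ε : ℂ) - Complex.I * (u : ℂ)) * (k : ℂ) ^ 2) =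
      (2 * ((ε : ℂ) - Complex.I * (u : ℂ)))⁻¹ * EE ε u := by
  set b := ((ε : ℂ) - Complex.I * (u : ℂ)) with hb
  have hb0 : b ≠ 0 := by
    intro h; have := congrArg Complex.re h; simp [hb] at this; exact h0.ne' this
  have hi2 : Integrable (fun k : ℝ => (k : ℂ) ^ 2 * Complex.exp (-b * (k : ℂ) ^ 2)) := by
    refine (k2exp_int h0).mono' (by fun_prop) (Eventually.of_forall (fun k => ?_))
    rw [norm_mul, Complex.norm_exp, norm_pow, Complex.norm_real, Real.norm_eq_abs, sq_abs]
    apply le_of_eq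
    congr 2
    rw [show -b * (k : ℂ) ^ 2 = ((k ^ 2 : ℝ) : ℂ) * (-b) by push_cast; ring, Complex.re_ofReal_mul]
    simp [hb]; ring
  refine ⟨hi2, ?_⟩
  have hbre : 0 < b.re := by simpa [hb] using h0
  have hi1 := integrable_mul_cexp_neg_mul_sq hbre
  have hi0 : Integrable (fun k : ℝ => Complex.exp (-b * (k : ℂ) ^ 2)) := ce_int h0 u
  have hv : ∀ k : ℝ, HasDerivAt (fun k : ℝ => Complex.exp (-b * (k : ℂ) ^ 2)) (-(2 * b) * ((k : ℂ) * Complex.exp (-b * (k : ℂ) ^ 2))) k := by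
    intro k
    have h1 : HasDerivAt (fun k : ℝ => (k : ℂ)) 1 k := Complex.ofRealCLM.hasDerivAt
    have h2 := ((h1.pow 2).const_mul (-b)).cexp
    refine h2.congr_deriv ?_
    simp; ring
  have hu' : ∀ k : ℝ, HasDerivAt (fun k : ℝ => (k : ℂ)) 1 k := fun k => Complex.ofRealCLM.hasDerivAt
  have key := integral_mul_deriv_eq_deriv_mul_of_integrable (u := fun k : ℝ => (k : ℂ)) (v := fun k : ℝ => Complex.exp (-b * (k : ℂ) ^ 2))
    (u' := fun _ => 1) (v' := fun k : ℝ => -(2 * b) * ((k : ℂ) * Complex.exp (-b * (k : ℂ) ^ 2))) (fun k _ => hu' k) (fun k _ => hv k)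
    (by
      refine (hi2.const_mul (-(2 * b))).congr (Eventually.of_forall (fun k => ?_))
      simp; ring)
    (by refine hi0.congr (Eventually.of_forall (fun k => ?_)); simp)
    (by exact hi1)
  have e1 : ∫ k : ℝ, (k : ℂ) * (-(2 * b) * ((k : ℂ) * Complex.exp (-b * (k : ℂ) ^ 2))) = -(2 * b) * ∫ k : ℝ, (k : ℂ) ^ 2 * Complex.exp (-b * (k : ℂ) ^ 2) := by
    rw [← integral_const_mul]; congr 1; ext k; ring
  rw [e1] at key
  simp only [one_mul] at key
  rw [EE_int h0 u] at key
  have h2 : 2 * b ≠ 0 := mul_ne_zero two_ne_zero hb0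
  rw [eq_inv_mul_iff_mul_eq₀ h2]
  linear_combination -key

lemma rw2_le {ε : ℝ} (h0 : 0 < ε) {u : ℝ} (hu : u ≠ 0) : |rw2 ε u| ≤ √π * t32 u := by
  have hA : ∀ δ : ℝ, 0 < δ → ‖∫ k : ℝ, (k : ℂ) ^ 2 * Complex.exp (-((δ : ℂ) - Complex.I * (u : ℂ)) * (k : ℂ) ^ 2)‖ ≤ √π * t32 u / 2 := by
    intro δ hδ
    have hu' := abs_pos.mpr hu
    rw [(k2ce hδ u).2, norm_mul, norm_inv, norm_mul]
    have h1 := b_norm_ge δ u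
    have h2 := EE_norm_le δ u hu
    unfold t32
    have hs := Real.sqrt_pos.mpr hu'
    calc _ ≤ (2 * |u|)⁻¹ * (√π * (√|u|)⁻¹) := by
          gcongr
          · simp
      _ = _ := by field_simp
  have e : rw2 ε u = ((∫ k : ℝ, (k : ℂ) ^ 2 * Complex.exp (-((ε : ℂ) - Complex.I * (u : ℂ)) * (k : ℂ) ^ 2)) - ∫ k : ℝ, (k : ℂ) ^ 2 * Complex.exp (-(((1 : ℝ) : ℂ) - Complex.I * (u : ℂ)) * (k : ℂ) ^ 2)).re := by
    rw [← integral_sub (k2ce h0 u).1 (k2ce one_pos u).1]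
    refine Eq.trans ?_ (integral_re (𝕜 := ℂ) ((k2ce h0 u).1.sub (k2ce one_pos u).1))
    unfold rw2 we
    congr 1; ext k
    rw [cexp_re, cexp_re]
    rw [← Complex.ofReal_pow, RCLike.re_eq_complex_re, Complex.sub_re, Complex.re_ofReal_mul, Complex.re_ofReal_mul]
    simp only [Complex.add_re, Complex.ofReal_im, Complex.mul_re, Complex.ofReal_re, Complex.I_im, Complex.I_re]
    ring
  rw [e]
  refine (Complex.abs_re_le_norm _).trans ((norm_sub_le _ _).trans ?_)
  linarith [hA ε h0, hA 1 one_pos]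

lemma dom_prod {α : Type*} [TopologicalSpace α] [MeasurableSpace α] [OpensMeasurableSpace α] [SecondCountableTopology α]
    (μ : Measure α) [IsFiniteMeasure μ] {w : ℝ → ℝ} (hw : Integrable w) (hwc : Continuous w) (hw0 : ∀ k, 0 ≤ w k)
    {g : ℝ × α → ℝ} (hg : Continuous g) (C : ℝ) (hC : ∀ p, |g p| ≤ C) :
    Integrable (fun p : ℝ × α => w p.1 * g p) (volume.prod μ) := by
  have h1 : Integrable (fun p : ℝ × α => w p.1 * C) (volume.prod μ) := hw.mul_prod (integrable_const C)
  refine h1.mono' (by fun_prop) (Eventually.of_forall (fun p => ?_))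
  rw [norm_mul, Real.norm_eq_abs, Real.norm_eq_abs, abs_of_nonneg (hw0 _)]
  exact mul_le_mul_of_nonneg_left (hC p) (hw0 _)

lemma lemA_eq {f : ℝ → ℂ} (hf : Continuous f) {M : ℝ} (hM : ∀ t, ‖f t‖ ≤ M) {T : ℝ} (hT : 0 ≤ T)
    {ε : ℝ} (h0 : 0 < ε) (h1 : ε < 1) :
    ∫ k, we ε k * (k ^ 2 * SS f T k) = 2 * (∫ t in Ioc 0 T, ‖f t‖ ^ 2 * (Rw ε t + Rw ε (T - t))) -
      ∫ p, rw2 ε (p.1 - p.2) * ‖f p.1 - f p.2‖ ^ 2 ∂(mu2 T) := by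
  have hM0 : 0 ≤ M := (norm_nonneg _).trans (hM 0)
  have hwc := we_cont ε
  have hwk : Continuous (fun k => k ^ 2 * we ε k) := by fun_prop
  have hwk0 : ∀ k, 0 ≤ k ^ 2 * we ε k := fun k => mul_nonneg (sq_nonneg k) (we_nonneg h1 k)
  have hwi := we_int h0
  have iS : ∀ u, Integrable (fun k => we ε k * sin (k ^ 2 * u)) := by
    intro u
    refine hwi.mono' (by fun_prop) (Eventually.of_forall (fun k => ?_))
    rw [norm_mul, Real.norm_eq_abs, abs_of_nonneg (we_nonneg h1 k)]
    exact mul_le_of_le_one_right (we_nonneg h1 k) (Real.abs_sin_le_one _)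
  have d1 : Integrable (fun p : ℝ × ℝ => we ε p.1 * (‖f p.2‖ ^ 2 * (sin (p.1 ^ 2 * p.2) + sin (p.1 ^ 2 * (T - p.2))))) (volume.prod (volume.restrict (Ioc 0 T))) := by
    apply dom_prod _ hwi hwc (we_nonneg h1) (by fun_prop) (M ^ 2 * (1 + 1))
    intro p
    rw [abs_mul, abs_of_nonneg (sq_nonneg _)]
    gcongr
    · apply hM
    · exact (abs_add_le _ _).trans (add_le_add (Real.abs_sin_le_one _) (Real.abs_sin_le_one _))
  have d2 : Integrable (fun p : ℝ × (ℝ × ℝ) => p.1 ^ 2 * we ε p.1 * (cos (p.1 ^ 2 * (p.2.1 - p.2.2)) * ‖f p.2.1 - f p.2.2‖ ^ 2)) (volume.prod (mu2 T)) := by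
    apply dom_prod _ (k2we_int h0) hwk hwk0 (by fun_prop) (1 * (M + M) ^ 2)
    intro p
    rw [abs_mul, abs_of_nonneg (sq_nonneg ‖_‖)]
    gcongr
    · exact Real.abs_cos_le_one _
    · exact (norm_sub_le _ _).trans (add_le_add (hM _) (hM _))
  have e : ∀ k, we ε k * (k ^ 2 * SS f T k) =
      2 * (∫ t in Ioc 0 T, we ε k * (‖f t‖ ^ 2 * (sin (k ^ 2 * t) + sin (k ^ 2 * (T - t))))) -
      ∫ p, k ^ 2 * we ε k * (cos (k ^ 2 * (p.1 - p.2)) * ‖f p.1 - f p.2‖ ^ 2) ∂(mu2 T) := by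
    intro k
    rw [k2SS hf hM hT, integral_const_mul, integral_const_mul, mul_sub]
    simp_rw [mul_assoc (k ^ 2)]
    rw [integral_const_mul]
    ring
  simp_rw [e]
  rw [integral_sub (d1.integral_prod_left.const_mul 2) d2.integral_prod_left, integral_const_mul,
    integral_integral_swap (f := fun k t => we ε k * (‖f t‖ ^ 2 * (sin (k ^ 2 * t) + sin (k ^ 2 * (T - t))))) d1,
    integral_integral_swap (f := fun k (p : ℝ × ℝ) => k ^ 2 * we ε k * (cos (k ^ 2 * (p.1 - p.2)) * ‖f p.1 - f p.2‖ ^ 2)) d2]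
  congr 1
  · congr 2; ext t
    unfold Rw
    rw [← integral_add (iS _) (iS _), ← integral_const_mul]
    congr 1; ext k; ring
  · congr 1; ext p
    unfold rw2
    rw [← integral_mul_const]
    congr 1; ext k; ring

lemma lemA_n {f : ℝ → ℂ} (hf : Continuous f) {M : ℝ} (hM : ∀ t, ‖f t‖ ≤ M) {T : ℝ} (hT : 0 ≤ T)
    {ε : ℝ} (h0 : 0 < ε) (h1 : ε < 1) :
    ∫⁻ k, ENNReal.ofReal (we ε k * (k ^ 2 * SS f T k)) ≤
      ENNReal.ofReal (8 * √π * CJ * M ^ 2) + ENNReal.ofReal √π * Df f T := by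
  have hM0 : 0 ≤ M := (norm_nonneg _).trans (hM 0)
  have hSc := SS_cont hf hM T
  have hwc := we_cont ε
  have hI : Integrable (fun k => we ε k * (k ^ 2 * SS f T k)) := by
    refine ((k2we_int h0).mul_const (2 * (M * T) ^ 2)).mono' (by fun_prop) (Eventually.of_forall (fun k => ?_))
    have := we_nonneg h1 k
    have h2 := SS_nonneg f T k
    rw [Real.norm_eq_abs, abs_of_nonneg (by positivity)]
    have h3 := SS_bound hM hT k
    calc we ε k * (k ^ 2 * SS f T k) = (k ^ 2 * we ε k) * SS f T k := by ring
      _ ≤ _ := by gcongr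
  rw [← ofReal_integral_eq_lintegral_ofReal hI (Eventually.of_forall (fun k => by
    have := we_nonneg h1 k
    have h2 := SS_nonneg f T k
    show (0:ℝ) ≤ _
    positivity)), lemA_eq hf hM hT h0 h1]
  have hJT : Integrable (fun t => JJ (T - t)) := JJ_int.comp_sub_left T
  have hJT2 : ∫ t, JJ (T - t) = CJ := by unfold CJ; rw [integral_sub_left_eq_self JJ]
  have hb : ∫ t in Ioc 0 T, ‖f t‖ ^ 2 * (Rw ε t + Rw ε (T - t)) ≤ 4 * √π * CJ * M ^ 2 := by
    have i3 : Integrable (fun t => M ^ 2 * (2 * √π) * (JJ t + JJ (T - t))) := (JJ_int.add hJT).const_mul _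
    calc _ ≤ ‖∫ t in Ioc 0 T, ‖f t‖ ^ 2 * (Rw ε t + Rw ε (T - t))‖ := Real.le_norm_self _
      _ ≤ ∫ t in Ioc 0 T, M ^ 2 * (2 * √π) * (JJ t + JJ (T - t)) := by
        apply norm_integral_le_of_norm_le i3.integrableOn
        filter_upwards [ae_restrict_mem measurableSet_Ioc] with t ht
        have r1 := Rw_le h0 h1 ht.1.le
        have r2 := Rw_le h0 h1 (sub_nonneg.mpr ht.2)
        rw [norm_mul, norm_pow, norm_norm, mul_assoc]
        gcongr
        · apply hM
        · rw [Real.norm_eq_abs]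
          linarith [abs_add_le (Rw ε t) (Rw ε (T - t))]
      _ ≤ ∫ t, M ^ 2 * (2 * √π) * (JJ t + JJ (T - t)) := by
        apply setIntegral_le_integral i3
        refine Eventually.of_forall (fun t => ?_)
        have := JJ_nonneg t
        have := JJ_nonneg (T - t)
        show (0:ℝ) ≤ _
        positivity
      _ = _ := by
        rw [integral_const_mul, integral_add JJ_int hJT, hJT2]
        unfold CJ; ring
  have hd : ENNReal.ofReal (- ∫ p, rw2 ε (p.1 - p.2) * ‖f p.1 - f p.2‖ ^ 2 ∂(mu2 T)) ≤ ENNReal.ofReal √π * Df f T := by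
    calc _ ≤ ‖∫ p, rw2 ε (p.1 - p.2) * ‖f p.1 - f p.2‖ ^ 2 ∂(mu2 T)‖ₑ := by
          rw [← ofReal_norm]
          exact ENNReal.ofReal_le_ofReal (by rw [← norm_neg]; exact Real.le_norm_self _)
      _ ≤ ∫⁻ p, ‖rw2 ε (p.1 - p.2) * ‖f p.1 - f p.2‖ ^ 2‖ₑ ∂(mu2 T) := enorm_integral_le_lintegral_enorm _
      _ ≤ ∫⁻ p, ENNReal.ofReal √π * ENNReal.ofReal (‖f p.1 - f p.2‖ ^ 2 * t32 (p.1 - p.2)) ∂(mu2 T) := by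
          apply lintegral_mono
          intro p
          simp only
          rw [← ofReal_norm, ← ENNReal.ofReal_mul (by positivity)]
          apply ENNReal.ofReal_le_ofReal
          rcases eq_or_ne p.1 p.2 with h | h
          · simp [h]
          · have := rw2_le h0 (sub_ne_zero.mpr h)
            rw [norm_mul, norm_pow, norm_norm, Real.norm_eq_abs]
            calc _ ≤ (√π * t32 (p.1 - p.2)) * ‖f p.1 - f p.2‖ ^ 2 := by gcongr
              _ = _ := by ring
      _ = _ := by rw [lintegral_const_mul' _ _ ENNReal.ofReal_ne_top]; rfl
  rw [sub_eq_add_neg]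
  refine ENNReal.ofReal_add_le.trans (add_le_add (ENNReal.ofReal_le_ofReal (by linarith)) hd)

lemma lemA {f : ℝ → ℂ} (hf : Continuous f) {M : ℝ} (hM : ∀ t, ‖f t‖ ≤ M) {T : ℝ} (hT : 0 ≤ T) :
    ∫⁻ k, ENNReal.ofReal ((1 - Real.exp (-1 * k ^ 2)) * (k ^ 2 * SS f T k)) ≤
      ENNReal.ofReal (8 * √π * CJ * M ^ 2) + ENNReal.ofReal √π * Df f T := by
  have hSc := SS_cont hf hM T
  apply fatouE (F := fun n k => ENNReal.ofReal (we (en n) k * (k ^ 2 * SS f T k)))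
  · intro n
    have hwc := we_cont (en n)
    exact (by fun_prop : Continuous (fun k => we (en n) k * (k ^ 2 * SS f T k))).measurable.ennreal_ofReal.aemeasurable
  · refine Eventually.of_forall (fun k => (ENNReal.continuous_ofReal.tendsto _).comp ?_)
    apply Tendsto.mul_const
    unfold we
    apply Tendsto.sub_const
    have : Tendsto (fun n => Real.exp (-en n * k ^ 2)) atTop (𝓝 (Real.exp (-0 * k ^ 2))) := by
      apply (Real.continuous_exp.tendsto _).comp
      exact (en_tendsto.neg).mul_const _
    simpa using this
  · intro n
    exact lemA_n hf hM hT (en_pos n) (en_lt n)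

lemma k2_le (k : ℝ) : k ^ 2 ≤ 1 + 2 * (k ^ 2 * (1 - Real.exp (-1 * k ^ 2))) := by
  rcases le_or_gt (k ^ 2) 1 with h | h
  · have : Real.exp (-1 * k ^ 2) ≤ 1 := Real.exp_le_one_iff.mpr (by nlinarith [sq_nonneg k])
    nlinarith [sq_nonneg k, mul_nonneg (sq_nonneg k) (sub_nonneg.mpr this)]
  · have h2 : Real.exp (-1 * k ^ 2) ≤ 1 / 2 := by
      calc Real.exp (-1 * k ^ 2) ≤ Real.exp (-1) := Real.exp_le_exp.mpr (by linarith)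
        _ ≤ 1 / 2 := by
          rw [Real.exp_neg, ← one_div]
          apply one_div_le_one_div_of_le (by norm_num)
          linarith [Real.add_one_le_exp (1:ℝ)]
    nlinarith [sq_nonneg k]

def CA : ℝ := 8 * √π * CJ
def CD : ℝ := √π * (4 * CJ)
lemma CA_nonneg : 0 ≤ CA := by have := CJ_nonneg; unfold CA; positivity
lemma CD_nonneg : 0 ≤ CD := by have := CJ_nonneg; unfold CD; positivity

lemma lemP {f : ℝ → ℂ} (hf : Continuous f) {M : ℝ} (hM : ∀ t, ‖f t‖ ≤ M) {T : ℝ} (hT0 : 0 ≤ T)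
    {a : ℝ → ℂ} (ha : Integrable a) (ha2 : Integrable (fun k => ‖a k‖ ^ 2)) {c : ℂ} (hc : ‖c‖ ^ 2 = (2 * π)⁻¹) {L : ℝ} (hL0 : 0 ≤ L)
    (hL : ∀ t ∈ Ioc 0 T, ∀ s ∈ Ioc 0 T, ‖f t - f s‖ ≤ L * ‖hT a f T c t - hT a f T c s‖) :
    Integrable (fun k => k ^ 2 * SS f T k) ∧
    ∫ k, k ^ 2 * SS f T k ≤ (∫ k, SS f T k) + 2 * (CA * M ^ 2 + L ^ 2 * CD * ((∫ k, ‖a k‖ ^ 2) + ∫ k, SS f T k)) := by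
  have hSc := SS_cont hf hM T
  have hSi := SS_int hf hM hT0
  have hS0 := SS_nonneg f T
  have hA := lemA hf hM hT0
  have hD := Df_le hf hM hT0 ha hc hL0 hL
  have hCJ := CJ_nonneg
  have hBi : Integrable (BB a f T) := ha2.add hSi
  have hBe : ∫⁻ k, ENNReal.ofReal (BB a f T k) = ENNReal.ofReal ((∫ k, ‖a k‖ ^ 2) + ∫ k, SS f T k) := by
    rw [← ofReal_integral_eq_lintegral_ofReal hBi (Eventually.of_forall (BB_nonneg a f T)), ← integral_add ha2 hSi]
    rfl
  have hI1 : 0 ≤ ∫ k, ‖a k‖ ^ 2 := integral_nonneg (fun k => by positivity)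
  have hI2 : 0 ≤ ∫ k, SS f T k := integral_nonneg hS0
  rw [hBe, ← ENNReal.ofReal_mul (by positivity)] at hD
  have hA2 : ∫⁻ k, ENNReal.ofReal ((1 - Real.exp (-1 * k ^ 2)) * (k ^ 2 * SS f T k)) ≤
      ENNReal.ofReal (CA * M ^ 2 + L ^ 2 * CD * ((∫ k, ‖a k‖ ^ 2) + ∫ k, SS f T k)) := by
    refine hA.trans ((add_le_add le_rfl (mul_le_mul' le_rfl hD)).trans (le_of_eq ?_))
    rw [← ENNReal.ofReal_mul (by positivity), ← ENNReal.ofReal_add (by positivity) (by positivity)]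
    congr 1; unfold CA CD; ring
  have hCA := CA_nonneg
  have hCD := CD_nonneg
  have h1e : ∀ k : ℝ, 0 ≤ 1 - Real.exp (-1 * k ^ 2) := fun k => by
    have : Real.exp (-1 * k ^ 2) ≤ 1 := Real.exp_le_one_iff.mpr (by nlinarith [sq_nonneg k])
    linarith
  have key : ∫⁻ k, ENNReal.ofReal (k ^ 2 * SS f T k) ≤ ENNReal.ofReal ((∫ k, SS f T k) + 2 * (CA * M ^ 2 + L ^ 2 * CD * ((∫ k, ‖a k‖ ^ 2) + ∫ k, SS f T k))) := by
    calc _ ≤ ∫⁻ k, (ENNReal.ofReal (SS f T k) + ENNReal.ofReal 2 * ENNReal.ofReal ((1 - Real.exp (-1 * k ^ 2)) * (k ^ 2 * SS f T k))) := by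
          apply lintegral_mono
          intro k
          simp only
          have := hS0 k
          have := h1e k
          rw [← ENNReal.ofReal_mul (by norm_num), ← ENNReal.ofReal_add (by positivity) (by positivity)]
          apply ENNReal.ofReal_le_ofReal
          nlinarith [k2_le k]
      _ = (∫⁻ k, ENNReal.ofReal (SS f T k)) + ENNReal.ofReal 2 * ∫⁻ k, ENNReal.ofReal ((1 - Real.exp (-1 * k ^ 2)) * (k ^ 2 * SS f T k)) := by
          rw [lintegral_add_left (hSc.measurable.ennreal_ofReal), lintegral_const_mul' _ _ ENNReal.ofReal_ne_top]
      _ ≤ ENNReal.ofReal (∫ k, SS f T k) + ENNReal.ofReal 2 * ENNReal.ofReal (CA * M ^ 2 + L ^ 2 * CD * ((∫ k, ‖a k‖ ^ 2) + ∫ k, SS f T k)) := by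
          rw [ofReal_integral_eq_lintegral_ofReal hSi (Eventually.of_forall hS0)]
          exact add_le_add le_rfl (mul_le_mul' le_rfl hA2)
      _ = _ := by
          rw [← ENNReal.ofReal_mul (by norm_num), ← ENNReal.ofReal_add (by positivity) (by positivity)]
  have h0 : ∀ k, 0 ≤ k ^ 2 * SS f T k := fun k => mul_nonneg (sq_nonneg k) (hS0 k)
  have hint : Integrable (fun k => k ^ 2 * SS f T k) := by
    refine ⟨by fun_prop, ?_⟩
    rw [hasFiniteIntegral_iff_ofReal (Eventually.of_forall h0)]
    exact key.trans_lt ENNReal.ofReal_lt_top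
  refine ⟨hint, ?_⟩
  rw [← ofReal_integral_eq_lintegral_ofReal hint (Eventually.of_forall h0)] at key
  exact (ENNReal.ofReal_le_ofReal_iff (by positivity)).mp key

structure Hyp (a f : ℝ → ℂ) (c : ℂ) (h : ℝ → ℂ) (M Mh L : ℝ) : Prop where
  hf : Continuous f
  hM : ∀ t, ‖f t‖ ≤ M
  ha : Integrable a
  ha2 : Integrable (fun k => ‖a k‖ ^ 2)
  hak : Integrable (fun k => k ^ 2 * ‖a k‖ ^ 2)
  hc : ‖c‖ ^ 2 = (2 * π)⁻¹
  heq : ∀ T t, 0 ≤ t → t ≤ T → h t = hT a f T c t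
  hb : ∀ t, 0 ≤ t → ‖h t‖ ≤ Mh
  hL0 : 0 ≤ L
  hL : ∀ t s, 0 ≤ t → 0 ≤ s → ‖f t - f s‖ ≤ L * ‖h t - h s‖

section
variable {a f : ℝ → ℂ} {c : ℂ} {h : ℝ → ℂ} {M Mh L : ℝ}

lemma Hyp.P (H : Hyp a f c h M Mh L) {T : ℝ} (hT0 : 0 ≤ T) : Integrable (fun k => k ^ 2 * SS f T k) ∧
    ∫ k, k ^ 2 * SS f T k ≤ (∫ k, SS f T k) + 2 * (CA * M ^ 2 + L ^ 2 * CD * ((∫ k, ‖a k‖ ^ 2) + ∫ k, SS f T k)) := by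
  refine lemP H.hf H.hM hT0 H.ha H.ha2 H.hc H.hL0 (fun t ht s hs => ?_)
  rw [← H.heq T t ht.1.le ht.2, ← H.heq T s hs.1.le hs.2]
  exact H.hL t s ht.1.le hs.1.le

lemma bmi {μ : Measure ℝ} [IsFiniteMeasure μ] {g : ℝ → ℂ} (hg : StronglyMeasurable g) (C : ℝ)
    (hC : ∀ p, ‖g p‖ ≤ C) : Integrable g μ :=
  (integrable_const C).mono' hg.aestronglyMeasurable (Eventually.of_forall hC)

lemma Gs_bound (a : ℝ → ℂ) (σ t : ℝ) : ‖Gs σ a t‖ ≤ ∫ k, ‖a k‖ := by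
  unfold Gs
  refine (norm_integral_le_integral_norm _).trans (le_of_eq ?_)
  congr 1; ext k; rw [norm_mul, norm_eI, one_mul]

lemma fy_int (H : Hyp a f c h M Mh L) {T : ℝ} (hT0 : 0 ≤ T) (τ : ℝ) :
    IntegrableOn (fun t => (starRingEnd ℂ) (f t) * yT f T (t + τ)) (Ioc 0 T) := by
  have hm := yT_meas H.hf H.hM hT0
  have hM0 : 0 ≤ M := (norm_nonneg _).trans (H.hM 0)
  apply bmi _ (M * (M * (T + ∫ u, rr u)))
  · intro t
    rw [norm_mul, RCLike.norm_conj]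
    gcongr
    · exact H.hM t
    · exact yT_bound H.hM hT0 _
  · exact ((Complex.continuous_conj.comp H.hf).stronglyMeasurable).mul (hm.comp_measurable (measurable_add_const τ))

lemma fg_int (H : Hyp a f c h M Mh L) (T τ : ℝ) :
    IntegrableOn (fun t => (starRingEnd ℂ) (f t) * Gs 1 a (t + τ)) (Ioc 0 T) := by
  have hm := Gs_cont H.ha 1
  have hM0 : 0 ≤ M := (norm_nonneg _).trans (H.hM 0)
  apply bmi _ (M * (∫ k, ‖a k‖))
  · intro t
    rw [norm_mul, RCLike.norm_conj]
    gcongr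
    · exact H.hM t
    · exact Gs_bound _ _ _
  · exact ((Complex.continuous_conj.comp H.hf).mul (hm.comp (continuous_add_const τ))).stronglyMeasurable

lemma uh_sq_le (f : ℝ → ℂ) (T k : ℝ) : ‖uh f T (-1) k‖ ^ 2 ≤ SS f T k := by
  unfold SS; nlinarith [sq_nonneg ‖uh f T 1 k‖]

lemma neg_bound (H : Hyp a f c h M Mh L) (hcc : c = -Complex.I * ((√(2 * π))⁻¹ : ℝ))
    (hre : ∀ t, 0 ≤ t → ((starRingEnd ℂ) (f t) * h t).im = 0) {T : ℝ} (hT0 : 0 ≤ T) :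
    ∫ k, SS f T k ≤ 4 * ∫ k, ‖a k‖ ^ 2 := by
  have hSi := SS_int H.hf H.hM hT0
  have hs : 0 < √(2 * π) := Real.sqrt_pos.mpr (by positivity)
  have hss : √(2 * π) * √(2 * π) = 2 * π := Real.mul_self_sqrt (by positivity)
  have hp := yT_pair H.hf H.hM hT0 0
  have hq := pairing (T := T) H.hf H.hM H.ha 1 0
  simp only [mul_zero, Real.cos_zero, Real.sin_zero, add_zero, mul_one] at hp
  simp only [mul_zero, Complex.ofReal_zero, Complex.exp_zero, one_mul, add_zero] at hq
  have i1 := fy_int H hT0 0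
  have i2 := fg_int H T 0
  simp only [add_zero] at i1 i2
  have e : (∫ t in Ioc 0 T, (starRingEnd ℂ) (f t) * yT f T t).re =
      (Complex.I * ((√(2 * π) * (2 * π)⁻¹ : ℝ) : ℂ) * ∫ t in Ioc 0 T, (starRingEnd ℂ) (f t) * Gs 1 a t).re := by
    rw [← integral_const_mul]
    refine ((integral_re (𝕜 := ℂ) i1).symm.trans ?_).trans (integral_re (𝕜 := ℂ) (i2.const_mul _))
    apply setIntegral_congr_fun measurableSet_Ioc
    intro t ht
    simp only [RCLike.re_eq_complex_re]
    have hh := H.heq T t ht.1.le ht.2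
    have hr := hre t ht.1.le
    have e1 : yT f T t = Complex.I * ((√(2 * π) : ℝ) : ℂ) * ((((2 * π)⁻¹ : ℝ) : ℂ) * Gs 1 a t - h t) := by
      rw [hh, hT, hcc]
      have hsc : ((√(2 * π) : ℝ) : ℂ) ≠ 0 := by exact_mod_cast hs.ne'
      rw [Complex.ofReal_inv (√(2 * π))]
      field_simp
      linear_combination (yT f T t) * Complex.I_sq
    rw [e1]
    have e2 : (starRingEnd ℂ) (f t) * (Complex.I * ((√(2 * π) : ℝ) : ℂ) * ((((2 * π)⁻¹ : ℝ) : ℂ) * Gs 1 a t - h t)) =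
       Complex.I * ((√(2 * π) * (2 * π)⁻¹ : ℝ) : ℂ) * ((starRingEnd ℂ) (f t) * Gs 1 a t) - ((√(2 * π) : ℝ) : ℂ) * (Complex.I * ((starRingEnd ℂ) (f t) * h t)) := by
      push_cast; ring
    rw [e2, Complex.sub_re, Complex.re_ofReal_mul, Complex.I_mul_re, hr]; ring
  rw [e, hq, mul_comm Complex.I, mul_assoc, Complex.re_ofReal_mul, ← mul_assoc, ← mul_assoc, hss,
    mul_inv_cancel₀ (by positivity), one_mul, integral_const_mul] at hp
  have hd : ‖∫ k, a k * (starRingEnd ℂ) (uh f T (-1) k)‖ ≤ ∫ k, (‖a k‖ ^ 2 + 1 / 4 * SS f T k) := by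
    apply norm_integral_le_of_norm_le (H.ha2.add (hSi.const_mul _))
    refine Eventually.of_forall (fun k => ?_)
    rw [norm_mul, RCLike.norm_conj]
    have := uh_sq_le f T k
    show _ ≤ ‖a k‖ ^ 2 + 1 / 4 * SS f T k
    nlinarith [sq_nonneg (‖a k‖ - ‖uh f T (-1) k‖ / 2)]
  rw [integral_add H.ha2 (hSi.const_mul _), integral_const_mul] at hd
  have h3 := (Complex.abs_re_le_norm (Complex.I * ∫ k, a k * (starRingEnd ℂ) (uh f T (-1) k)))
  rw [norm_mul, Complex.norm_I, one_mul] at h3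
  have h4 := le_abs_self (Complex.I * ∫ k, a k * (starRingEnd ℂ) (uh f T (-1) k)).re
  linarith

end

section
variable {a f : ℝ → ℂ} {c : ℂ} {h : ℝ → ℂ} {M Mh L : ℝ}

lemma ki_int (hf : Continuous f) (hM : ∀ t, ‖f t‖ ≤ M) (T t : ℝ) :
    IntegrableOn (fun s => (((√(t - s))⁻¹ : ℝ) : ℂ) * f s) (Ioc 0 T) := by
  have hM0 : 0 ≤ M := (norm_nonneg _).trans (hM 0)
  refine ((bd_int T t).mul_const M).mono' ?_ (Eventually.of_forall (fun s => ?_))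
  · have : Measurable f := hf.measurable
    exact (by fun_prop : Measurable (fun s => (((√(t - s))⁻¹ : ℝ) : ℂ) * f s)).aestronglyMeasurable
  · rw [norm_mul, Complex.norm_real, Real.norm_eq_abs]
    have h1 := sqrt_inv_abs (t - s)
    have h2 := sqrt_inv_le (t - s)
    have h3 := rr_nonneg (t - s)
    gcongr
    · linarith
    · exact hM s

lemma hT_bd (H : Hyp a f c h M Mh L) {T t : ℝ} (hT0 : 0 ≤ T) (h0 : 0 ≤ t) (h1 : t ≤ T + 1) :
    ‖hT a f T c t‖ ≤ Mh + ‖c‖ * (M * ∫ u, rr u) := by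
  have hM0 : 0 ≤ M := (norm_nonneg _).trans (H.hM 0)
  have e : hT a f T c t = h t + c * ∫ s in Ioc T (T + 1), (((√(t - s))⁻¹ : ℝ) : ℂ) * f s := by
    rw [H.heq (T + 1) t h0 h1]
    unfold hT
    have : yT f (T + 1) t = yT f T t + ∫ s in Ioc T (T + 1), (((√(t - s))⁻¹ : ℝ) : ℂ) * f s := by
      have hi := ki_int H.hf H.hM (T + 1) t
      unfold yT
      rw [← Ioc_union_Ioc_eq_Ioc hT0 (by linarith : T ≤ T + 1)] at hi ⊢
      rw [setIntegral_union (Ioc_disjoint_Ioc_of_le le_rfl) measurableSet_Ioc hi.left_of_union hi.right_of_union]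
    rw [this]; ring
  rw [e]
  refine (norm_add_le _ _).trans (add_le_add (H.hb t h0) ?_)
  rw [norm_mul]
  gcongr
  have hri : Integrable (fun s => M * rr (t - s)) := (rr_int.comp_sub_left t).const_mul M
  calc _ ≤ ∫ s in Ioc T (T + 1), M * rr (t - s) := by
        apply norm_integral_le_of_norm_le hri.integrableOn
        filter_upwards [ae_restrict_mem measurableSet_Ioc] with s hs
        rw [norm_mul, Complex.norm_real, Real.norm_eq_abs, abs_of_nonneg (by positivity), mul_comm]
        have h3 := rr_nonneg (t - s)
        gcongr
        · exact H.hM s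
        · rcases le_or_gt (t - s) 0 with h4 | h4
          · rw [Real.sqrt_eq_zero_of_nonpos h4]; simpa using h3
          · unfold rr
            rw [abs_of_pos h4, if_pos (by linarith [hs.1])]
    _ ≤ ∫ s, M * rr (t - s) := by
        apply setIntegral_le_integral hri
        exact Eventually.of_forall (fun s => mul_nonneg hM0 (rr_nonneg _))
    _ = _ := by rw [integral_const_mul, integral_sub_left_eq_self rr]

lemma hT_glob (H : Hyp a f c h M Mh L) {T : ℝ} (hT0 : 0 ≤ T) : ∃ C, ∀ t, ‖hT a f T c t‖ ≤ C := by
  refine ⟨(2 * π)⁻¹ * (∫ k, ‖a k‖) + ‖c‖ * (M * (T + ∫ u, rr u)), fun t => ?_⟩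
  unfold hT
  refine (norm_sub_le _ _).trans ?_
  rw [norm_mul, norm_mul, Complex.norm_real, Real.norm_eq_abs, abs_of_nonneg (by positivity)]
  gcongr
  · exact Gs_bound _ _ _
  · exact yT_bound H.hM hT0 t

lemma hT_meas (H : Hyp a f c h M Mh L) {T : ℝ} (hT0 : 0 ≤ T) : StronglyMeasurable (hT a f T c) := by
  have h1 := yT_meas H.hf H.hM hT0
  have h2 := (Gs_cont H.ha 1).stronglyMeasurable
  exact (h2.const_mul _).sub (h1.const_mul _)

lemma Dsq (H : Hyp a f c h M Mh L) {T : ℝ} (hT0 : 0 ≤ T) {τ : ℝ} (hτ : 0 < τ) :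
    IntegrableOn (fun t => ‖hT a f T c (t + τ) - hT a f T c t‖ ^ 2) (Ioc 0 T) ∧
    ∫ t in Ioc 0 T, ‖hT a f T c (t + τ) - hT a f T c t‖ ^ 2 ≤ 2 * τ * √τ * ((∫ k, k ^ 2 * ‖a k‖ ^ 2) + ∫ k, k ^ 2 * SS f T k) := by
  obtain ⟨C, hC⟩ := hT_glob H hT0
  have hm := hT_meas H hT0
  have hmm : StronglyMeasurable (fun t => ‖hT a f T c (t + τ) - hT a f T c t‖ ^ 2) :=
    (((hm.comp_measurable (measurable_add_const τ)).sub hm).norm).pow 2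
  have hi : IntegrableOn (fun t => ‖hT a f T c (t + τ) - hT a f T c t‖ ^ 2) (Ioc 0 T) := by
    refine (integrable_const ((C + C) ^ 2)).mono' hmm.aestronglyMeasurable (Eventually.of_forall (fun t => ?_))
    rw [norm_pow, norm_norm]
    gcongr
    exact (norm_sub_le _ _).trans (add_le_add (hC _) (hC _))
  refine ⟨hi, ?_⟩
  have hX := (H.P hT0).1
  have hBi : Integrable (fun k => 2 * τ * √τ * (k ^ 2 * BB a f T k)) := by
    apply Integrable.const_mul
    refine (H.hak.add hX).congr (Eventually.of_forall (fun k => ?_))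
    simp only [Pi.add_apply, BB]; ring
  have e : ∫ k, 2 * τ * √τ * (k ^ 2 * BB a f T k) = 2 * τ * √τ * ((∫ k, k ^ 2 * ‖a k‖ ^ 2) + ∫ k, k ^ 2 * SS f T k) := by
    rw [integral_const_mul, ← integral_add H.hak hX]
    congr 2; ext k; unfold BB; ring
  have hB0 := BB_nonneg a f T
  have h0 : ∀ k, 0 ≤ 2 * τ * √τ * (k ^ 2 * BB a f T k) := fun k => by have := hB0 k; positivity
  rw [← e, ← ENNReal.ofReal_le_ofReal_iff (integral_nonneg h0)]
  rw [ofReal_integral_eq_lintegral_ofReal hi (Eventually.of_forall (fun t => by positivity)),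
    ofReal_integral_eq_lintegral_ofReal hBi (Eventually.of_forall h0)]
  refine (setLIntegral_le_lintegral _ _).trans ((dh H.hf H.hM hT0 H.ha H.hc τ).trans (lintegral_mono (fun k => ENNReal.ofReal_le_ofReal ?_)))
  rcases eq_or_ne k 0 with rfl | hk
  · simp
  have hk' := abs_pos.mpr hk
  rw [div_le_iff₀ hk']
  have h3 := mk_32 k τ
  rw [abs_of_pos hτ] at h3
  calc _ ≤ 2 * ((k ^ 2 * τ) * (|k| * √τ)) * BB a f T k := by gcongr; exact hB0 k
    _ = _ := by ring

lemma gpart (H : Hyp a f c h M Mh L) {T : ℝ} (hT0 : 0 ≤ T) {τ : ℝ} (hτ : 0 < τ) :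
    (∫ t in Ioc 0 T, ((starRingEnd ℂ) (f t) * Gs 1 a (t + τ) - (starRingEnd ℂ) (f t) * Gs 1 a (t + 0))).re ≤
      τ * ((∫ k, k ^ 2 * ‖a k‖ ^ 2) + 1 / 4 * ∫ k, k ^ 2 * SS f T k) := by
  have hX := (H.P hT0).1
  have hi : ∀ τ : ℝ, Integrable (fun k => Complex.exp (Complex.I * ((1 * k ^ 2 * τ : ℝ) : ℂ)) *
        (a k * (starRingEnd ℂ) (uh f T (-1) k))) := by
    intro τ
    have hu := uh_cont H.hf H.hM T (-1)
    have hcj := Complex.continuous_conj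
    have h1 : Integrable (fun k => (starRingEnd ℂ) (uh f T (-1) k) * a k) := by
      apply H.ha.bdd_mul (c := M * T) (by fun_prop)
      exact Eventually.of_forall (fun k => by rw [RCLike.norm_conj]; exact uh_bound H.hM hT0 _ _)
    have h2 : Integrable (fun k => Complex.exp (Complex.I * ((1 * k ^ 2 * τ : ℝ) : ℂ)) * ((starRingEnd ℂ) (uh f T (-1) k) * a k)) := by
      apply h1.bdd_mul (c := 1) (by fun_prop)
      exact Eventually.of_forall (fun k => by rw [norm_eI])
    refine h2.congr (Eventually.of_forall (fun k => ?_))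
    simp only; ring
  rw [integral_sub (fg_int H T τ) (fg_int H T 0), pairing H.hf H.hM H.ha, pairing H.hf H.hM H.ha, ← integral_sub (hi τ) (hi 0)]
  refine (Complex.re_le_norm _).trans ?_
  have hR : Integrable (fun k => τ * (k ^ 2 * ‖a k‖ ^ 2 + 1 / 4 * (k ^ 2 * SS f T k))) := (H.hak.add (hX.const_mul _)).const_mul τ
  calc _ ≤ ∫ k, τ * (k ^ 2 * ‖a k‖ ^ 2 + 1 / 4 * (k ^ 2 * SS f T k)) := by
        apply norm_integral_le_of_norm_le hR
        refine Eventually.of_forall (fun k => ?_)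
        simp only [mul_zero, Complex.ofReal_zero, Complex.exp_zero]
        rw [← sub_mul, norm_mul, norm_mul, RCLike.norm_conj]
        have h1 := Real.norm_exp_I_mul_ofReal_sub_one_le (x := 1 * k ^ 2 * τ)
        rw [Real.norm_eq_abs, abs_of_nonneg (by positivity)] at h1
        have h2 := uh_sq_le f T k
        have h3 : ‖a k‖ * ‖uh f T (-1) k‖ ≤ ‖a k‖ ^ 2 + 1 / 4 * SS f T k := by
          nlinarith [sq_nonneg (‖a k‖ - ‖uh f T (-1) k‖ / 2)]
        calc _ ≤ (1 * k ^ 2 * τ) * (‖a k‖ ^ 2 + 1 / 4 * SS f T k) := by gcongr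
          _ = _ := by ring
    _ = _ := by
        rw [integral_const_mul, integral_add H.hak (hX.const_mul _), integral_const_mul]

end

section
variable {a f : ℝ → ℂ} {c : ℂ} {h : ℝ → ℂ} {M Mh L : ℝ}

lemma cs_le (x : ℝ) : |cos x + sin x - 1| ≤ 2 * |x| := by
  have h := Real.norm_exp_I_mul_ofReal_sub_one_le (x := x)
  rw [Real.norm_eq_abs] at h
  have h1 := (Complex.abs_re_le_norm _).trans h
  have h2 := (Complex.abs_im_le_norm _).trans h
  rw [mul_comm, Complex.exp_mul_I, ← Complex.ofReal_cos, ← Complex.ofReal_sin] at h1 h2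
  simp [Complex.cos_ofReal_re, Complex.sin_ofReal_re] at h1 h2
  calc |cos x + sin x - 1| = |(cos x - 1) + sin x| := by ring_nf
    _ ≤ _ := (abs_add_le _ _).trans (by linarith)

lemma cs_lim (q : ℝ) : Tendsto (fun n => (cos (q * en n) + sin (q * en n) - 1) / en n) atTop (𝓝 q) := by
  have hd : HasDerivAt (fun τ : ℝ => cos (q * τ) + sin (q * τ)) q 0 := by
    have h1 : HasDerivAt (fun τ : ℝ => q * τ) (q * 1) 0 := (hasDerivAt_id 0).const_mul q
    have := h1.cos.add h1.sin
    refine this.congr_deriv ?_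
    simp
  have h2 := hasDerivAt_iff_tendsto_slope_zero.mp hd
  have h3 : Tendsto en atTop (𝓝[≠] 0) := tendsto_nhdsWithin_iff.mpr ⟨en_tendsto, Eventually.of_forall (fun n => (en_pos n).ne')⟩
  refine (h2.comp h3).congr (fun n => ?_)
  simp; ring

lemma Vdiff {V : ℝ → ℝ} (hV : StronglyMeasurable V) {K : ℝ} (hK : ∀ t, |V t| ≤ K) {T τ m : ℝ} (hT0 : 0 ≤ T) (hτ : 0 < τ) (hτ1 : τ ≤ 1)
    (hm : ∀ t, 0 ≤ t → t ≤ T + 1 → |V t| ≤ m) :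
    ∫ t in Ioc 0 T, (V (t + τ) - V t) ≤ 2 * τ * m := by
  have hi : ∀ μ : Measure ℝ, IsFiniteMeasure μ → Integrable V μ := fun μ _ =>
    (integrable_const K).mono' hV.aestronglyMeasurable (Eventually.of_forall hK)
  have hiτ : IntegrableOn (fun t => V (t + τ)) (Ioc 0 T) :=
    (integrable_const K).mono' (hV.comp_measurable (measurable_add_const τ)).aestronglyMeasurable (Eventually.of_forall (fun t => hK _))
  have hii : ∀ x y, IntervalIntegrable V volume x y := fun x y => ⟨hi _ inferInstance, hi _ inferInstance⟩
  rw [integral_sub hiτ (hi _ inferInstance), ← intervalIntegral.integral_of_le hT0, ← intervalIntegral.integral_of_le hT0,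
    intervalIntegral.integral_comp_add_right]
  have e : (∫ t in (0 + τ)..(T + τ), V t) - ∫ t in (0:ℝ)..T, V t = (∫ t in T..(T + τ), V t) - ∫ t in (0:ℝ)..(0 + τ), V t := by
    have h1 := intervalIntegral.integral_add_adjacent_intervals (hii 0 (0 + τ)) (hii (0 + τ) (T + τ))
    have h2 := intervalIntegral.integral_add_adjacent_intervals (hii 0 T) (hii T (T + τ))
    linarith
  rw [e]
  have b1 : ‖∫ t in T..(T + τ), V t‖ ≤ m * |T + τ - T| := by
    apply intervalIntegral.norm_integral_le_of_norm_le_const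
    intro t ht
    rw [uIoc_of_le (by linarith)] at ht
    exact hm t (by linarith [ht.1]) (by linarith [ht.2])
  have b2 : ‖∫ t in (0:ℝ)..(0 + τ), V t‖ ≤ m * |0 + τ - 0| := by
    apply intervalIntegral.norm_integral_le_of_norm_le_const
    intro t ht
    rw [uIoc_of_le (by linarith)] at ht
    exact hm t (by linarith [ht.1]) (by linarith [ht.2])
  rw [show T + τ - T = τ by ring, abs_of_pos hτ] at b1
  rw [show 0 + τ - 0 = τ by ring, abs_of_pos hτ] at b2
  have := Real.le_norm_self (∫ t in T..(T + τ), V t)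
  have h2 := neg_le_abs (∫ t in (0:ℝ)..(0 + τ), V t)
  rw [← Real.norm_eq_abs] at h2
  linarith

lemma pos_tau (H : Hyp a f c h M Mh L) (hcc : c = ((√(2 * π))⁻¹ : ℝ)) {U : ℂ → ℝ} (hU : Continuous U)
    {m L2 : ℝ} (hm : ∀ z, ‖z‖ ≤ Mh + ‖c‖ * (M * ∫ u, rr u) → |U z| ≤ m)
    (hTay : ∀ t, 0 ≤ t → ∀ w, ‖w‖ ≤ Mh + ‖c‖ * (M * ∫ u, rr u) →
      U (h t) - U w - L2 * ‖w - h t‖ ^ 2 ≤ ((starRingEnd ℂ) (f t) * (w - h t)).re) (hL2 : 0 ≤ L2)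
    {T : ℝ} (hT0 : 0 ≤ T) {τ : ℝ} (hτ : 0 < τ) (hτ1 : τ ≤ 1) :
    (4 * π)⁻¹ * ∫ k, SS f T k * (cos (k ^ 2 * τ) + sin (k ^ 2 * τ) - 1) ≤
      τ * ((2 * π)⁻¹ * ((∫ k, k ^ 2 * ‖a k‖ ^ 2) + 1 / 4 * ∫ k, k ^ 2 * SS f T k) + 2 * m +
        L2 * (2 * √τ * ((∫ k, k ^ 2 * ‖a k‖ ^ 2) + ∫ k, k ^ 2 * SS f T k))) := by
  have hSi := SS_int H.hf H.hM hT0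
  have hSc := SS_cont H.hf H.hM T
  have hs : 0 < √(2 * π) := Real.sqrt_pos.mpr (by positivity)
  have hss : √(2 * π) * √(2 * π) = 2 * π := Real.mul_self_sqrt (by positivity)
  obtain ⟨C, hC⟩ := hT_glob H hT0
  have hmeas := hT_meas H hT0
  obtain ⟨K, hK⟩ : ∃ K, ∀ t, |U (hT a f T c t)| ≤ K := by
    obtain ⟨K, hK⟩ := (isCompact_closedBall (0:ℂ) C).exists_bound_of_continuousOn hU.continuousOn
    exact ⟨K, fun t => hK _ (by simpa using hC t)⟩
  have hVm : StronglyMeasurable (fun t => U (hT a f T c t)) := hU.comp_stronglyMeasurable hmeas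
  have hVd := Vdiff hVm hK hT0 hτ hτ1 (m := m) (fun t h0 h1 => hm _ (hT_bd H hT0 h0 h1))
  have hVi : IntegrableOn (fun t => U (hT a f T c (t + τ)) - U (hT a f T c t)) (Ioc 0 T) := by
    refine Integrable.sub ?_ ?_
    · exact (integrable_const K).mono' (hVm.comp_measurable (measurable_add_const τ)).aestronglyMeasurable (Eventually.of_forall (fun t => hK _))
    · exact (integrable_const K).mono' hVm.aestronglyMeasurable (Eventually.of_forall hK)
  obtain ⟨hDi, hDle⟩ := Dsq H hT0 hτ
  have hg := gpart H hT0 hτ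
  have yi : IntegrableOn (fun t => (starRingEnd ℂ) (f t) * yT f T (t + τ) - (starRingEnd ℂ) (f t) * yT f T (t + 0)) (Ioc 0 T) :=
    (fy_int H hT0 τ).sub (fy_int H hT0 0)
  have gi : IntegrableOn (fun t => (starRingEnd ℂ) (f t) * Gs 1 a (t + τ) - (starRingEnd ℂ) (f t) * Gs 1 a (t + 0)) (Ioc 0 T) :=
    (fg_int H T τ).sub (fg_int H T 0)
  have yre := integral_re (𝕜 := ℂ) yi
  have gre := integral_re (𝕜 := ℂ) gi
  simp only [RCLike.re_eq_complex_re] at yre gre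
  have yrei : IntegrableOn (fun t => ((starRingEnd ℂ) (f t) * yT f T (t + τ) - (starRingEnd ℂ) (f t) * yT f T (t + 0)).re) (Ioc 0 T) := yi.re
  have grei : IntegrableOn (fun t => ((starRingEnd ℂ) (f t) * Gs 1 a (t + τ) - (starRingEnd ℂ) (f t) * Gs 1 a (t + 0)).re) (Ioc 0 T) := gi.re
  have hVD : IntegrableOn (fun t => (U (hT a f T c (t + τ)) - U (hT a f T c t)) + L2 * ‖hT a f T c (t + τ) - hT a f T c t‖ ^ 2) (Ioc 0 T) :=
    hVi.add (hDi.const_mul _)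
  have hmono : ∫ t in Ioc 0 T, (√(2 * π))⁻¹ * ((starRingEnd ℂ) (f t) * yT f T (t + τ) - (starRingEnd ℂ) (f t) * yT f T (t + 0)).re ≤
     ∫ t in Ioc 0 T, ((2 * π)⁻¹ * ((starRingEnd ℂ) (f t) * Gs 1 a (t + τ) - (starRingEnd ℂ) (f t) * Gs 1 a (t + 0)).re +
       ((U (hT a f T c (t + τ)) - U (hT a f T c t)) + L2 * ‖hT a f T c (t + τ) - hT a f T c t‖ ^ 2)) := by
    apply setIntegral_mono_on (yrei.const_mul _) ((grei.const_mul _).add hVD) measurableSet_Ioc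
    intro t ht
    have hT1 := hTay t ht.1.le (hT a f T c (t + τ)) (hT_bd H hT0 (by linarith [ht.1]) (by linarith [ht.2]))
    rw [H.heq T t ht.1.le ht.2] at hT1
    have e : (starRingEnd ℂ) (f t) * (hT a f T c (t + τ) - hT a f T c t) =
       (((2 * π)⁻¹ : ℝ) : ℂ) * ((starRingEnd ℂ) (f t) * Gs 1 a (t + τ) - (starRingEnd ℂ) (f t) * Gs 1 a (t + 0)) -
       (((√(2 * π))⁻¹ : ℝ) : ℂ) * ((starRingEnd ℂ) (f t) * yT f T (t + τ) - (starRingEnd ℂ) (f t) * yT f T (t + 0)) := by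
      unfold hT; rw [hcc, add_zero]; ring
    rw [e, Complex.sub_re, Complex.re_ofReal_mul, Complex.re_ofReal_mul] at hT1
    simp only [Pi.add_apply]
    linarith
  rw [integral_add (grei.const_mul _) hVD, integral_add hVi (hDi.const_mul _), integral_const_mul, integral_const_mul,
    integral_const_mul, yre, gre] at hmono
  have hp1 := yT_pair H.hf H.hM hT0 τ
  have hp0 := yT_pair H.hf H.hM hT0 0
  have e1 : √(2 * π) * (∫ t in Ioc 0 T, ((starRingEnd ℂ) (f t) * yT f T (t + τ) - (starRingEnd ℂ) (f t) * yT f T (t + 0))).re =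
      1 / 2 * ∫ k, SS f T k * (cos (k ^ 2 * τ) + sin (k ^ 2 * τ) - 1) := by
    rw [integral_sub (fy_int H hT0 τ) (fy_int H hT0 0), Complex.sub_re, mul_sub, hp1, hp0]
    rw [← integral_const_mul, ← integral_sub]
    · congr 1; ext k; simp; ring
    · have : Integrable (fun k => (1 / 2 * (cos (k ^ 2 * τ) + sin (k ^ 2 * τ))) * SS f T k) := by
        apply hSi.bdd_mul (c := 1 / 2 * (1 + 1)) (by fun_prop)
        refine Eventually.of_forall (fun k => ?_)
        rw [norm_mul, Real.norm_eq_abs (_ + _), Real.norm_of_nonneg (by norm_num)]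
        gcongr
        exact (abs_add_le _ _).trans (add_le_add (Real.abs_cos_le_one _) (Real.abs_sin_le_one _))
      refine this.congr (Eventually.of_forall (fun k => ?_))
      simp only; ring
    · refine (hSi.const_mul (1 / 2)).congr (Eventually.of_forall (fun k => ?_))
      simp
  have e2 : (√(2 * π))⁻¹ * (∫ t in Ioc 0 T, ((starRingEnd ℂ) (f t) * yT f T (t + τ) - (starRingEnd ℂ) (f t) * yT f T (t + 0))).re =
      (4 * π)⁻¹ * ∫ k, SS f T k * (cos (k ^ 2 * τ) + sin (k ^ 2 * τ) - 1) := by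
    rw [show (4 * π)⁻¹ = (√(2 * π))⁻¹ * (√(2 * π))⁻¹ * (1 / 2) by rw [← mul_inv, hss]; ring, mul_assoc, ← e1]
    field_simp
  rw [e2] at hmono
  have h5 : (2 * π)⁻¹ * (∫ t in Ioc 0 T, ((starRingEnd ℂ) (f t) * Gs 1 a (t + τ) - (starRingEnd ℂ) (f t) * Gs 1 a (t + 0))).re ≤
     (2 * π)⁻¹ * (τ * ((∫ k, k ^ 2 * ‖a k‖ ^ 2) + 1 / 4 * ∫ k, k ^ 2 * SS f T k)) := by gcongr
  have h6 := mul_le_mul_of_nonneg_left hDle hL2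
  linarith

lemma pos_bound (H : Hyp a f c h M Mh L) (hcc : c = ((√(2 * π))⁻¹ : ℝ)) {U : ℂ → ℝ} (hU : Continuous U)
    {m L2 : ℝ} (hm : ∀ z, ‖z‖ ≤ Mh + ‖c‖ * (M * ∫ u, rr u) → |U z| ≤ m)
    (hTay : ∀ t, 0 ≤ t → ∀ w, ‖w‖ ≤ Mh + ‖c‖ * (M * ∫ u, rr u) →
      U (h t) - U w - L2 * ‖w - h t‖ ^ 2 ≤ ((starRingEnd ℂ) (f t) * (w - h t)).re) (hL2 : 0 ≤ L2)
    {T : ℝ} (hT0 : 0 ≤ T) :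
    ∫ k, k ^ 2 * SS f T k ≤ 4 * (∫ k, k ^ 2 * ‖a k‖ ^ 2) + 16 * π * m := by
  have hX := (H.P hT0).1
  have hSc := SS_cont H.hf H.hM T
  have hS0 := SS_nonneg f T
  have lim1 : Tendsto (fun n => ∫ k, SS f T k * ((cos (k ^ 2 * en n) + sin (k ^ 2 * en n) - 1) / en n)) atTop (𝓝 (∫ k, SS f T k * k ^ 2)) := by
    apply tendsto_integral_of_dominated_convergence (fun k => 2 * (k ^ 2 * SS f T k))
    · intro n; exact (by fun_prop : Continuous _).aestronglyMeasurable
    · exact hX.const_mul 2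
    · intro n
      refine Eventually.of_forall (fun k => ?_)
      have h1 := cs_le (k ^ 2 * en n)
      have h2 := en_pos n
      rw [abs_of_nonneg (by positivity : 0 ≤ k ^ 2 * en n)] at h1
      rw [norm_mul, norm_div, Real.norm_of_nonneg (hS0 k), Real.norm_of_nonneg h2.le, Real.norm_eq_abs]
      have : |cos (k ^ 2 * en n) + sin (k ^ 2 * en n) - 1| / en n ≤ 2 * k ^ 2 := by
        rw [div_le_iff₀ h2]; linarith
      have := mul_le_mul_of_nonneg_left this (hS0 k)
      linarith
    · exact Eventually.of_forall (fun k => (cs_lim (k ^ 2)).const_mul _)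
  have lim2 : Tendsto (fun n => (2 * π)⁻¹ * ((∫ k, k ^ 2 * ‖a k‖ ^ 2) + 1 / 4 * ∫ k, k ^ 2 * SS f T k) + 2 * m +
        L2 * (2 * √(en n) * ((∫ k, k ^ 2 * ‖a k‖ ^ 2) + ∫ k, k ^ 2 * SS f T k))) atTop
      (𝓝 ((2 * π)⁻¹ * ((∫ k, k ^ 2 * ‖a k‖ ^ 2) + 1 / 4 * ∫ k, k ^ 2 * SS f T k) + 2 * m +
        L2 * (2 * √0 * ((∫ k, k ^ 2 * ‖a k‖ ^ 2) + ∫ k, k ^ 2 * SS f T k)))) := by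
    have := (Real.continuous_sqrt.tendsto 0).comp en_tendsto
    exact (((this.const_mul 2).mul_const _).const_mul L2).const_add _
  have hle := le_of_tendsto_of_tendsto' (lim1.const_mul (4 * π)⁻¹) lim2 (fun n => by
    have h1 := pos_tau H hcc hU hm hTay hL2 hT0 (en_pos n) (en_lt n).le
    have h2 := en_pos n
    rw [← mul_le_mul_iff_right₀ h2]
    refine le_trans (le_of_eq ?_) h1
    rw [mul_left_comm, ← integral_const_mul (en n)]
    congr 2; ext k
    field_simp)
  rw [Real.sqrt_zero] at hle
  have e : ∫ k, SS f T k * k ^ 2 = ∫ k, k ^ 2 * SS f T k := by congr 1; ext k; ring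
  rw [e] at hle
  set X := ∫ k, k ^ 2 * SS f T k
  set Y := ∫ k, k ^ 2 * ‖a k‖ ^ 2
  have hπ := Real.pi_pos
  have h3 := mul_le_mul_of_nonneg_left hle (by positivity : 0 ≤ 8 * π)
  have e1 : 8 * π * ((4 * π)⁻¹ * X) = 2 * X := by field_simp; ring
  have e2 : 8 * π * ((2 * π)⁻¹ * (Y + 1 / 4 * X) + 2 * m + L2 * (2 * 0 * (Y + X))) = 4 * (Y + 1 / 4 * X) + 16 * π * m := by
    field_simp; ring
  rw [e1, e2] at h3
  linarith

end

section
variable {a f : ℝ → ℂ} {c : ℂ} {h : ℝ → ℂ} {M Mh L : ℝ}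

def KX (ε u x : ℝ) : ℂ := EE ε (-u) * Complex.exp (-((√2 * x : ℝ) : ℂ) ^ 2 / (4 * ((ε : ℂ) - Complex.I * ((-u : ℝ) : ℂ))))

lemma EE_cont {ε : ℝ} (hε : 0 < ε) : Continuous (EE ε) := by
  rw [continuous_iff_continuousAt]
  intro u
  unfold EE
  apply ContinuousAt.cpow
  · apply ContinuousAt.div continuousAt_const
    · fun_prop
    · exact EE_b_ne (Or.inl hε.ne')
  · exact continuousAt_const
  · rw [Complex.mem_slitPlane_iff]
    left
    rw [Complex.div_re]
    have h1 : 0 < Complex.normSq ((ε : ℂ) - Complex.I * (u : ℂ)) :=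
      Complex.normSq_pos.mpr (EE_b_ne (Or.inl hε.ne'))
    simp
    positivity

lemma KX_cont {ε : ℝ} (hε : 0 < ε) (x : ℝ) : Continuous (fun u => KX ε u x) := by
  have h1 := EE_cont hε
  unfold KX
  refine Continuous.mul (by fun_prop) (Complex.continuous_exp.comp (Continuous.div (by fun_prop) (by fun_prop) (fun u => ?_)))
  exact mul_ne_zero (by norm_num) (EE_b_ne (Or.inl hε.ne'))

lemma KX_bound {ε : ℝ} (hε : 0 ≤ ε) {u : ℝ} (hu : u ≠ 0) (x : ℝ) : ‖KX ε u x‖ ≤ √π * (√|u|)⁻¹ := by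
  unfold KX
  have h1 := EE_norm_le ε (-u) (neg_ne_zero.mpr hu)
  rw [abs_neg] at h1
  rw [norm_mul, Complex.norm_exp]
  refine (mul_le_of_le_one_right (norm_nonneg _) ?_).trans h1
  rw [Real.exp_le_one_iff]
  have e : -((√2 * x : ℝ) : ℂ) ^ 2 = ((-(√2 * x) ^ 2 : ℝ) : ℂ) := by push_cast; ring
  rw [e, Complex.div_re]
  simp only [Complex.ofReal_re, Complex.ofReal_im, zero_mul, zero_div, add_zero]
  apply div_nonpos_of_nonpos_of_nonneg _ (Complex.normSq_nonneg _)
  have : (4 * ((ε : ℂ) - Complex.I * ((-u : ℝ) : ℂ))).re = 4 * ε := by simp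
  rw [this]
  nlinarith [sq_nonneg (√2 * x)]

lemma KX_lim {u : ℝ} (hu : u ≠ 0) (x : ℝ) : Tendsto (fun n => KX (en n) u x) atTop (𝓝 (KX 0 u x)) := by
  have h1 : Tendsto (fun n => EE (en n) (-u)) atTop (𝓝 (EE 0 (-u))) := (EE_tendsto (neg_ne_zero.mpr hu)).comp en_tendsto'
  refine h1.mul ?_
  have hb : 4 * (((0 : ℝ) : ℂ) - Complex.I * ((-u : ℝ) : ℂ)) ≠ 0 := mul_ne_zero (by norm_num) (EE_b_ne (Or.inr (neg_ne_zero.mpr hu)))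
  have : ContinuousAt (fun ε : ℝ => Complex.exp (-((√2 * x : ℝ) : ℂ) ^ 2 / (4 * ((ε : ℂ) - Complex.I * ((-u : ℝ) : ℂ))))) 0 := by
    apply ContinuousAt.cexp
    exact ContinuousAt.div continuousAt_const (by fun_prop) hb
  exact this.tendsto.comp en_tendsto

lemma EE_neg {s : ℝ} (hs : 0 < s) : EE 0 (-s) = ((√(π / (2 * s)) : ℝ) : ℂ) * (1 - Complex.I) := by
  have h1 := EE_sq 0 (-s)
  have hr := EE_re_nonneg 0 (-s)
  have hp : 0 < √(π / (2 * s)) := Real.sqrt_pos.mpr (by positivity)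
  have hs' : (s : ℂ) ≠ 0 := by exact_mod_cast hs.ne'
  have h2 : EE 0 (-s) ^ 2 = (((√(π / (2 * s)) : ℝ) : ℂ) * (1 - Complex.I)) ^ 2 := by
    rw [h1, mul_pow, ← Complex.ofReal_pow, Real.sq_sqrt (by positivity)]
    push_cast
    have hI : Complex.I ≠ 0 := Complex.I_ne_zero
    have hI2 := Complex.I_sq
    have hI3 : Complex.I ^ 3 = -Complex.I := by rw [pow_succ, hI2]; ring
    rw [zero_sub, mul_neg, neg_neg]
    field_simp
    ring_nf
    rw [hI2, hI3]; ring
  rcases sq_eq_sq_iff_eq_or_eq_neg.mp h2 with h3 | h3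
  · exact h3
  · exfalso
    rw [h3] at hr
    simp at hr
    linarith

lemma free_pos {s : ℝ} (hs : 0 < s) : ((2 * π * s : ℝ) : ℂ) ^ (-(1 / 2 : ℂ)) = (((√(2 * π))⁻¹ * (√s)⁻¹ : ℝ) : ℂ) := by
  have e : (-(1 / 2 : ℂ)) = ((-(1 / 2) : ℝ) : ℂ) := by push_cast; ring
  rw [e, ← Complex.ofReal_cpow (by positivity), Real.rpow_neg (by positivity), ← Real.sqrt_eq_rpow, Real.sqrt_mul (by positivity), mul_inv]

lemma free_eq {s : ℝ} (hs : 0 < s) (x : ℝ) : freeKernel s x = (1 + Complex.I) / (2 * π) * KX 0 s x := by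
  unfold freeKernel KX
  rw [EE_neg hs, free_pos hs]
  have h2 : (1 + Complex.I) / (2 * π) * (((√(π / (2 * s)) : ℝ) : ℂ) * (1 - Complex.I)) = (((√(2 * π))⁻¹ * (√s)⁻¹ : ℝ) : ℂ) := by
    have e1 : (1 + Complex.I) * (1 - Complex.I) = 2 := by ring_nf; rw [Complex.I_sq]; ring
    have e2 : √(π / (2 * s)) / π = (√(2 * π))⁻¹ * (√s)⁻¹ := by
      rw [← mul_inv, ← Real.sqrt_mul (by positivity), ← Real.sqrt_inv, div_eq_iff Real.pi_pos.ne']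
      have e3 : π / (2 * s) = (2 * π * s)⁻¹ * π ^ 2 := by field_simp
      rw [e3, Real.sqrt_mul (by positivity), Real.sqrt_sq Real.pi_pos.le]
    rw [← e2]
    push_cast
    have : (π : ℂ) ≠ 0 := by exact_mod_cast Real.pi_pos.ne'
    field_simp
    linear_combination ((√(π / (2 * s)) : ℝ) : ℂ) * e1
  rw [← mul_assoc, h2]
  congr 2
  have hs' : (s : ℂ) ≠ 0 := by exact_mod_cast hs.ne'
  have h3 : ((√2 * x : ℝ) : ℂ) ^ 2 = 2 * (x : ℂ) ^ 2 := by
    rw [← Complex.ofReal_pow, mul_pow, Real.sq_sqrt (by norm_num)]; push_cast; ring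
  rw [h3]
  push_cast
  have hI : Complex.I ≠ 0 := Complex.I_ne_zero
  rw [zero_sub]
  field_simp
  rw [Complex.I_sq]; ring

lemma KX_int {ε : ℝ} (hε : 0 < ε) (u x : ℝ) :
    KX ε u x = ∫ k : ℝ, Complex.exp (Complex.I * ((√2 * k * x : ℝ) : ℂ)) * ((Real.exp (-ε * k ^ 2) : ℝ) : ℂ) * Complex.exp (Complex.I * ((-k ^ 2 * u : ℝ) : ℂ)) := by
  have hb : 0 < ((ε : ℂ) - Complex.I * ((-u : ℝ) : ℂ)).re := by simpa using hε
  have := fourierIntegral_gaussian hb ((√2 * x : ℝ) : ℂ)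
  unfold KX EE
  rw [← this]
  congr 1; ext k
  push_cast
  rw [← Complex.exp_add, ← Complex.exp_add, ← Complex.exp_add]
  congr 1; ring

lemma uh_int1 (hf : Continuous f) (hM : ∀ t, ‖f t‖ ≤ M) {T : ℝ} (hT0 : 0 ≤ T) (hX : Integrable (fun k => k ^ 2 * SS f T k)) : Integrable (uh f T 1) := by
  have hc := uh_cont hf hM T 1
  refine Integrable.mono' (integrable_inv_one_add_sq.add ((SS_int hf hM hT0).add hX)) hc.aestronglyMeasurable (Eventually.of_forall (fun k => ?_))
  simp only [Pi.add_apply]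
  have h1 : ‖uh f T 1 k‖ ^ 2 ≤ SS f T k := by unfold SS; nlinarith [sq_nonneg ‖uh f T (-1) k‖]
  have hp : 0 < 1 + k ^ 2 := by positivity
  have h2 : ‖uh f T 1 k‖ * 1 ≤ (1 + k ^ 2)⁻¹ + (1 + k ^ 2) * ‖uh f T 1 k‖ ^ 2 := by
    have : (1 + k ^ 2)⁻¹ + (1 + k ^ 2) * ‖uh f T 1 k‖ ^ 2 - 2 * ‖uh f T 1 k‖ = (1 + k ^ 2)⁻¹ * (1 - (1 + k ^ 2) * ‖uh f T 1 k‖) ^ 2 := by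
      field_simp; ring
    have h3 : 0 ≤ (1 + k ^ 2)⁻¹ * (1 - (1 + k ^ 2) * ‖uh f T 1 k‖) ^ 2 := by positivity
    linarith [norm_nonneg (uh f T 1 k)]
  have h4 := mul_le_mul_of_nonneg_left h1 hp.le
  linarith

lemma KX_fub (hf : Continuous f) (hM : ∀ t, ‖f t‖ ≤ M) (T : ℝ) {ε : ℝ} (hε : 0 < ε) (t x : ℝ) :
    ∫ s in Ioc 0 T, KX ε (t - s) x * f s =
      ∫ k : ℝ, ((Real.exp (-ε * k ^ 2) : ℝ) : ℂ) * (Complex.exp (Complex.I * ((√2 * k * x - k ^ 2 * t : ℝ) : ℂ)) * uh f T 1 k) := by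
  simp_rw [KX_int hε]
  unfold uh
  simp_rw [← integral_const_mul, ← integral_mul_const]
  rw [integral_integral_swap]
  · congr 1; ext k
    congr 1; ext s
    have : Complex.exp (Complex.I * ((√2 * k * x : ℝ) : ℂ)) * Complex.exp (Complex.I * ((-k ^ 2 * (t - s) : ℝ) : ℂ)) =
       Complex.exp (Complex.I * ((√2 * k * x - k ^ 2 * t : ℝ) : ℂ)) * Complex.exp (Complex.I * ((1 * k ^ 2 * s : ℝ) : ℂ)) := by
      rw [← Complex.exp_add, ← Complex.exp_add]; congr 1; push_cast; ring
    linear_combination ((Real.exp (-ε * k ^ 2) : ℝ) : ℂ) * f s * this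
  · have h1 : Integrable (fun p : ℝ × ℝ => M * Real.exp (-ε * p.2 ^ 2)) ((volume.restrict (Ioc 0 T)).prod volume) :=
      Integrable.mul_prod (integrable_const M) (integrable_exp_neg_mul_sq hε)
    refine Integrable.mono' h1 (by unfold Function.uncurry; fun_prop : Continuous _).aestronglyMeasurable ?_
    refine Eventually.of_forall (fun p => ?_)
    simp only [Function.uncurry]
    rw [norm_mul, norm_mul, norm_mul, norm_eI, norm_eI, one_mul, mul_one, Complex.norm_real, Real.norm_of_nonneg (Real.exp_pos _).le, mul_comm]
    gcongr
    exact hM _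

lemma Drep (hf : Continuous f) (hM : ∀ t, ‖f t‖ ≤ M) {T : ℝ} (hT0 : 0 ≤ T) (hX : Integrable (fun k => k ^ 2 * SS f T k))
    {t : ℝ} (ht : T ≤ t) (x : ℝ) :
    ∫ s in Ioc 0 T, freeKernel (t - s) x * f s =
      (1 + Complex.I) / (2 * π) * ∫ k : ℝ, Complex.exp (Complex.I * ((√2 * k * x - k ^ 2 * t : ℝ) : ℂ)) * uh f T 1 k := by
  have hM0 : 0 ≤ M := (norm_nonneg _).trans (hM 0)
  have hui := uh_int1 hf hM hT0 hX
  have huc := uh_cont hf hM T 1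
  have lim1 : Tendsto (fun n => ∫ s in Ioc 0 T, KX (en n) (t - s) x * f s) atTop (𝓝 (∫ s in Ioc 0 T, KX 0 (t - s) x * f s)) := by
    apply tendsto_integral_of_dominated_convergence (fun s => √π * M * (1 + rr (t - s)))
    · intro n
      have := KX_cont (en_pos n) x
      exact (by fun_prop : Continuous _).aestronglyMeasurable
    · exact (bd_int T t).const_mul _
    · intro n
      filter_upwards [ae_ne T t] with s hs
      rw [norm_mul]
      calc _ ≤ (√π * (√|t-s|)⁻¹) * M := by gcongr; exact KX_bound (en_pos n).le hs x; exact hM s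
        _ ≤ (√π * (1 + rr (t - s))) * M := by gcongr; exact sqrt_inv_le _
        _ = _ := by ring
    · filter_upwards [ae_ne T t] with s hs
      exact (KX_lim hs x).mul_const _
  have lim2 : Tendsto (fun n => ∫ s in Ioc 0 T, KX (en n) (t - s) x * f s) atTop
      (𝓝 (∫ k : ℝ, ((Real.exp (-0 * k ^ 2) : ℝ) : ℂ) * (Complex.exp (Complex.I * ((√2 * k * x - k ^ 2 * t : ℝ) : ℂ)) * uh f T 1 k))) := by
    simp_rw [KX_fub hf hM T (en_pos _) t x]
    apply tendsto_integral_of_dominated_convergence (fun k => ‖uh f T 1 k‖)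
    · intro n; exact (by fun_prop : Continuous _).aestronglyMeasurable
    · exact hui.norm
    · intro n
      refine Eventually.of_forall (fun k => ?_)
      rw [norm_mul, norm_mul, norm_eI, one_mul, Complex.norm_real, Real.norm_of_nonneg (Real.exp_pos _).le]
      refine mul_le_of_le_one_left (norm_nonneg _) (Real.exp_le_one_iff.mpr ?_)
      nlinarith [mul_nonneg (en_pos n).le (sq_nonneg k)]
    · refine Eventually.of_forall (fun k => Tendsto.mul_const _ ?_)
      have : Continuous (fun ε : ℝ => ((Real.exp (-ε * k ^ 2) : ℝ) : ℂ)) := by fun_prop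
      exact (this.tendsto 0).comp en_tendsto
  have := tendsto_nhds_unique lim1 lim2
  simp only [neg_zero, zero_mul, Real.exp_zero, Complex.ofReal_one, one_mul] at this
  rw [← this, ← integral_const_mul]
  apply integral_congr_ae
  filter_upwards [ae_ne T t, ae_restrict_mem measurableSet_Ioc] with s hs hs2
  rw [free_eq (lt_of_le_of_ne (by linarith [hs2.2]) (Ne.symm hs))]
  ring

lemma lemH {m : ℝ → ℝ} {A : ℝ → ℂ} {τ : ℝ} (hτ : 0 < τ) (hm : ∀ k, m k ^ 2 ≤ 8 * τ * k ^ 2 / (1 + τ * k ^ 2)) (hm0 : ∀ k, 0 ≤ m k)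
    (hX : Integrable (fun k => k ^ 2 * ‖A k‖ ^ 2)) :
    ∫ k, m k * ‖A k‖ ≤ 1 / 2 * √√τ * (8 * π + ∫ k, k ^ 2 * ‖A k‖ ^ 2) := by
  set q := √√τ with hq
  have hq0 : 0 < q := by rw [hq]; positivity
  have hq4 : q ^ 4 = τ := by
    rw [show q ^ 4 = (q ^ 2) ^ 2 by ring, hq, Real.sq_sqrt (by positivity), Real.sq_sqrt hτ.le]
  have hi : Integrable (fun k : ℝ => (1 + (q ^ 2 * k) ^ 2)⁻¹) := integrable_inv_one_add_sq.comp_mul_left' (by positivity)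
  have hI : ∫ k : ℝ, (1 + (q ^ 2 * k) ^ 2)⁻¹ = (q ^ 2)⁻¹ * π := by
    rw [Measure.integral_comp_mul_left (fun x : ℝ => (1 + x ^ 2)⁻¹), integral_univ_inv_one_add_sq, abs_of_pos (by positivity)]; rfl
  calc ∫ k, m k * ‖A k‖ ≤ ∫ k, (4 * q ^ 3 * (1 + (q ^ 2 * k) ^ 2)⁻¹ + q / 2 * (k ^ 2 * ‖A k‖ ^ 2)) := by
        apply integral_mono_of_nonneg (Eventually.of_forall (fun k => mul_nonneg (hm0 k) (norm_nonneg _)))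
        · exact (hi.const_mul _).add (hX.const_mul _)
        refine Eventually.of_forall (fun k => ?_)
        simp only
        have h1 := hm k
        have e : (q ^ 2 * k) ^ 2 = τ * k ^ 2 := by rw [mul_pow, ← pow_mul, hq4]
        rw [e]
        set R := (1 + τ * k ^ 2)⁻¹ with hR
        have hR0 : 0 < R := by rw [hR]; positivity
        have h2 : m k ^ 2 ≤ 8 * q ^ 4 * R * k ^ 2 := by rw [hq4]; refine h1.trans (le_of_eq ?_); rw [hR]; ring
        have h3 : (m k * ‖A k‖) ^ 2 ≤ (4 * q ^ 3 * R + q / 2 * (k ^ 2 * ‖A k‖ ^ 2)) ^ 2 := by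
          calc (m k * ‖A k‖) ^ 2 = m k ^ 2 * ‖A k‖ ^ 2 := by ring
            _ ≤ (8 * q ^ 4 * R * k ^ 2) * ‖A k‖ ^ 2 := by gcongr
            _ ≤ _ := by nlinarith [sq_nonneg (4 * q ^ 3 * R - q / 2 * (k ^ 2 * ‖A k‖ ^ 2))]
        exact abs_le_of_sq_le_sq' h3 (by positivity) |>.2
    _ = 4 * q ^ 3 * ((q ^ 2)⁻¹ * π) + q / 2 * ∫ k, k ^ 2 * ‖A k‖ ^ 2 := by
        rw [integral_add (hi.const_mul _) (hX.const_mul _), integral_const_mul, integral_const_mul, hI]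
    _ = _ := by field_simp; ring

end

section
variable {a f : ℝ → ℂ} {M : ℝ}

lemma phase_sq {α q : ℝ} (hq : 0 ≤ q) (hα : α ^ 2 ≤ 2 * q ∨ |α| ≤ q) : ‖Complex.exp (Complex.I * ((α : ℝ) : ℂ)) - 1‖ ^ 2 ≤ 8 * q / (1 + q) := by
  have h1 := Real.norm_exp_I_mul_ofReal_sub_one_le (x := α)
  rw [Real.norm_eq_abs] at h1
  have h2 : ‖Complex.exp (Complex.I * ((α : ℝ) : ℂ)) - 1‖ ≤ 2 := by
    refine (norm_sub_le _ _).trans ?_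
    rw [norm_eI, norm_one]; norm_num
  set n := ‖Complex.exp (Complex.I * ((α : ℝ) : ℂ)) - 1‖
  have hn : 0 ≤ n := norm_nonneg _
  rw [le_div_iff₀ (by positivity)]
  rcases le_total q 1 with h | h
  · have h3 : n ^ 2 ≤ 2 * q := by
      have h4 : n ^ 2 ≤ |α| ^ 2 := by gcongr
      rcases hα with h5 | h5
      · rw [sq_abs] at h4; linarith
      · nlinarith [abs_nonneg α]
    nlinarith
  · have : n ^ 2 ≤ 4 := by nlinarith
    nlinarith

lemma GH {A : ℝ → ℂ} (hA : Integrable A) (hX : Integrable (fun k => k ^ 2 * ‖A k‖ ^ 2)) {τ : ℝ} (hτ : 0 ≤ τ) {p p' : ℝ → ℝ}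
    (hp : Continuous p) (hp' : Continuous p') (hpp : ∀ k, (p k - p' k) ^ 2 ≤ 2 * (τ * k ^ 2) ∨ |p k - p' k| ≤ τ * k ^ 2) :
    ‖(∫ k, Complex.exp (Complex.I * ((p k : ℝ) : ℂ)) * A k) - ∫ k, Complex.exp (Complex.I * ((p' k : ℝ) : ℂ)) * A k‖ ≤
      1 / 2 * √√τ * (8 * π + ∫ k, k ^ 2 * ‖A k‖ ^ 2) := by
  have hi : ∀ q : ℝ → ℝ, Continuous q → Integrable (fun k => Complex.exp (Complex.I * ((q k : ℝ) : ℂ)) * A k) := fun q hq =>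
    hA.bdd_mul (c := 1) (by fun_prop) (Eventually.of_forall (fun k => (norm_eI _).le))
  rcases hτ.eq_or_lt with h0 | h0
  · have : p = p' := by
      ext k
      rw [← h0] at hpp
      rcases hpp k with h1 | h1
      · have : (p k - p' k) ^ 2 = 0 := le_antisymm (by linarith) (sq_nonneg _)
        linarith [pow_eq_zero_iff (two_ne_zero) |>.mp this]
      · rw [zero_mul] at h1
        linarith [abs_eq_zero.mp (le_antisymm h1 (abs_nonneg _))]
    rw [this, sub_self, ← h0]; simp
  rw [← integral_sub (hi p hp) (hi p' hp')]
  refine (norm_integral_le_integral_norm _).trans ?_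
  refine le_trans (le_of_eq ?_) (lemH (m := fun k => ‖Complex.exp (Complex.I * ((p k - p' k : ℝ) : ℂ)) - 1‖) h0 (fun k => ?_) (fun k => norm_nonneg _) hX)
  · congr 1; ext k
    rw [← sub_mul, norm_mul]
    congr 1
    have : Complex.exp (Complex.I * ((p k : ℝ) : ℂ)) - Complex.exp (Complex.I * ((p' k : ℝ) : ℂ)) =
       Complex.exp (Complex.I * ((p' k : ℝ) : ℂ)) * (Complex.exp (Complex.I * ((p k - p' k : ℝ) : ℂ)) - 1) := by
      rw [mul_sub, ← Complex.exp_add]; push_cast; ring_nf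
    rw [this, norm_mul, norm_eI, one_mul]
  · have := phase_sq (α := p k - p' k) (q := τ * k ^ 2) (by positivity) (hpp k)
    rwa [show 8 * τ * k ^ 2 = 8 * (τ * k ^ 2) by ring]

lemma free_norm {s : ℝ} (hs : 0 < s) (x : ℝ) : ‖freeKernel s x‖ ≤ (√s)⁻¹ := by
  unfold freeKernel
  rw [free_pos hs, norm_mul, Complex.norm_real, Real.norm_of_nonneg (by positivity)]
  have e : Complex.I * ((x ^ 2 : ℝ) : ℂ) / ((2 * s : ℝ) : ℂ) = Complex.I * ((x ^ 2 / (2 * s) : ℝ) : ℂ) := by push_cast; ring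
  rw [e, norm_eI, mul_one]
  apply mul_le_of_le_one_left (by positivity)
  apply inv_le_one_of_one_le₀
  rw [Real.one_le_sqrt]
  linarith [Real.pi_gt_three]

lemma free_meas (x : ℝ) : Measurable (fun s => freeKernel s x) := by
  unfold freeKernel
  refine Measurable.mul (Measurable.pow_const (by fun_prop) _) (Complex.measurable_exp.comp ?_)
  exact Measurable.div (by fun_prop) (by fun_prop)

lemma free_int (hf : Continuous f) (hM : ∀ t, ‖f t‖ ≤ M) (t x : ℝ) : IntegrableOn (fun s => freeKernel (t - s) x * f s) (Ioc 0 t) := by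
  have hM0 : 0 ≤ M := (norm_nonneg _).trans (hM 0)
  refine Integrable.mono' ((bd_int t t).const_mul M) ?_ ?_
  · exact (((free_meas x).comp (measurable_const.sub measurable_id)).mul hf.measurable).aestronglyMeasurable
  · filter_upwards [ae_ne t t, ae_restrict_mem measurableSet_Ioc] with s hs hs2
    have hp : 0 < t - s := lt_of_le_of_ne (by linarith [hs2.2]) (Ne.symm hs)
    rw [norm_mul, mul_comm]
    gcongr
    · exact hM s
    · refine (free_norm hp x).trans ?_
      have := sqrt_inv_le (t - s)
      rwa [abs_of_pos hp] at this

lemma sq_int {τ : ℝ} : ∫ u in (0:ℝ)..τ, (√u)⁻¹ = 2 * √τ := by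
  have h1 := integral_rpow (a := 0) (b := τ) (r := -(1/2:ℝ)) (Or.inl (by norm_num))
  rcases le_total 0 τ with h | h
  · rw [show (-(1/2:ℝ)) + 1 = 1 / 2 by norm_num, Real.zero_rpow (by norm_num), sub_zero, ← Real.sqrt_eq_rpow] at h1
    rw [show 2 * √τ = √τ / (1/2) by ring, ← h1]
    apply intervalIntegral.integral_congr
    intro u hu
    rw [uIcc_of_le h] at hu
    simp only
    rw [Real.rpow_neg hu.1, ← Real.sqrt_eq_rpow]
  · rw [Real.sqrt_eq_zero_of_nonpos h]
    rw [intervalIntegral.integral_symm, intervalIntegral.integral_of_le h, setIntegral_congr_fun (g := fun _ => 0) measurableSet_Ioc]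
    · simp
    · intro u hu
      simp [Real.sqrt_eq_zero_of_nonpos hu.2]

lemma tail_bd (hM : ∀ t, ‖f t‖ ≤ M) {t t' : ℝ} (htt : t ≤ t') (x : ℝ) :
    ‖∫ s in Ioc t t', freeKernel (t' - s) x * f s‖ ≤ M * (2 * √(t' - t)) := by
  have hM0 : 0 ≤ M := (norm_nonneg _).trans (hM 0)
  have e : ∫ s in Ioc t t', M * (√(t' - s))⁻¹ = M * (2 * √(t' - t)) := by
    rw [integral_const_mul, ← intervalIntegral.integral_of_le htt, intervalIntegral.integral_comp_sub_left (fun u => (√u)⁻¹), sub_self, sq_int]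
  rw [← e]
  have hi : IntegrableOn (fun s => (√(t' - s))⁻¹) (Ioc t t') := by
    refine Integrable.mono' (g := fun s => 1 + rr (t' - s)) ?_ ?_ ?_
    · exact Integrable.add (integrable_const _) (rr_int.comp_sub_left t').integrableOn
    · exact (by fun_prop : Measurable fun s => (√(t' - s))⁻¹).aestronglyMeasurable
    · refine Eventually.of_forall (fun s => ?_)
      refine (sqrt_inv_abs _).trans ?_
      rw [one_mul]
      exact sqrt_inv_le _
  refine norm_integral_le_of_norm_le (hi.const_mul M) ?_
  filter_upwards [ae_restrict_of_ae (by simp [ae_iff] : ∀ᵐ s : ℝ, s ≠ t'), ae_restrict_mem measurableSet_Ioc] with s hs hs2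
  have hp : 0 < t' - s := sub_pos.mpr (lt_of_le_of_ne hs2.2 hs)
  rw [norm_mul, mul_comm]
  gcongr
  · exact hM s
  · exact free_norm hp x

lemma half {γ : ℂ} {X : ℝ} (hγ : ‖γ‖ ≤ 1) (ha : Integrable a) (hak : Integrable (fun k => k ^ 2 * ‖a k‖ ^ 2))
    (hf : Continuous f) (hM : ∀ t, ‖f t‖ ≤ M) (hX : ∀ T, 0 ≤ T → Integrable (fun k => k ^ 2 * SS f T k) ∧ ∫ k, k ^ 2 * SS f T k ≤ X)
    {V : ℝ → ℝ → ℂ} (hV : ∀ x t, 0 ≤ t → V x t = (2 * (π : ℂ))⁻¹ * (∫ k, Complex.exp (Complex.I * ((k * x + k ^ 2 * t : ℝ) : ℂ)) * a k)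
      - γ * ∫ s in Ioc 0 t, freeKernel (t - s) x * f s) :
    ∃ C, 0 ≤ C ∧ ∀ x x' t t', 0 ≤ t → t ≤ t' → t' ≤ t + 1 → ‖V x' t' - V x t‖ ≤ C * (√|x' - x| + √√(t' - t)) := by
  have hM0 : 0 ≤ M := (norm_nonneg _).trans (hM 0)
  have hsd : ∀ d : ℝ, √√(d ^ 2) = √|d| := fun d => by rw [Real.sqrt_sq_eq_abs]
  set Y := ∫ k, k ^ 2 * ‖a k‖ ^ 2 with hY
  have hY0 : 0 ≤ Y := integral_nonneg (fun k => by positivity)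
  have hX0 : 0 ≤ X := le_trans (integral_nonneg (fun k => mul_nonneg (sq_nonneg _) (SS_nonneg _ _ _))) (hX 0 le_rfl).2
  have hπ := Real.pi_pos
  have hpi : ‖(((2 * π)⁻¹ : ℂ))‖ ≤ 1 := by
    rw [norm_inv, norm_mul, Complex.norm_real, Complex.norm_ofNat, Real.norm_of_nonneg hπ.le]
    exact inv_le_one_of_one_le₀ (by linarith [Real.pi_gt_three])
  have hκ : ‖((1 + Complex.I) / (2 * π) : ℂ)‖ ≤ 1 := by
    rw [norm_div, norm_mul, Complex.norm_real, Complex.norm_ofNat, Real.norm_of_nonneg hπ.le, div_le_one (by positivity)]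
    refine (norm_add_le _ _).trans ?_
    rw [norm_one, Complex.norm_I]; linarith [Real.pi_gt_three]
  -- uh data
  have hU : ∀ T, 0 ≤ T → Integrable (uh f T 1) ∧ Integrable (fun k => k ^ 2 * ‖uh f T 1 k‖ ^ 2) ∧ ∫ k, k ^ 2 * ‖uh f T 1 k‖ ^ 2 ≤ X := by
    intro T hT
    obtain ⟨h1, h2⟩ := hX T hT
    have huc := uh_cont hf hM T 1
    have hle : ∀ k, k ^ 2 * ‖uh f T 1 k‖ ^ 2 ≤ k ^ 2 * SS f T k := fun k => by
      gcongr; unfold SS; nlinarith [sq_nonneg ‖uh f T (-1) k‖]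
    have h3 : Integrable (fun k => k ^ 2 * ‖uh f T 1 k‖ ^ 2) := by
      refine h1.mono' (by fun_prop : Continuous _).aestronglyMeasurable (Eventually.of_forall (fun k => ?_))
      rw [Real.norm_of_nonneg (by positivity)]
      exact hle k
    exact ⟨uh_int1 hf hM hT h1, h3, (integral_mono h3 h1 hle).trans h2⟩
  have hWt : ∀ x x' t t', t ≤ t' → ‖(∫ k, Complex.exp (Complex.I * ((k * x' + k ^ 2 * t' : ℝ) : ℂ)) * a k) -
      ∫ k, Complex.exp (Complex.I * ((k * x + k ^ 2 * t : ℝ) : ℂ)) * a k‖ ≤ 1 / 2 * (√|x' - x| + √√(t' - t)) * (8 * π + Y) := by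
    intro x x' t t' htt
    have h1 := GH ha hak (τ := (x' - x) ^ 2) (sq_nonneg _) (p := fun k => k * x' + k ^ 2 * t') (p' := fun k => k * x + k ^ 2 * t') (by fun_prop) (by fun_prop)
      (fun k => Or.inl (by nlinarith [sq_nonneg ((x' - x) * k)]))
    have h2 := GH ha hak (τ := t' - t) (sub_nonneg.mpr htt) (p := fun k => k * x + k ^ 2 * t') (p' := fun k => k * x + k ^ 2 * t) (by fun_prop) (by fun_prop)
      (fun k => Or.inr (by
        rw [show k * x + k ^ 2 * t' - (k * x + k ^ 2 * t) = (t' - t) * k ^ 2 by ring, abs_of_nonneg (mul_nonneg (sub_nonneg.mpr htt) (sq_nonneg _))]))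
    rw [hsd] at h1
    refine (norm_sub_le_norm_sub_add_norm_sub _ _ _).trans ((add_le_add h1 h2).trans (le_of_eq ?_))
    rw [← hY]; ring
  have hDt : ∀ T x x' t t', 0 ≤ T → T ≤ t → t ≤ t' → ‖(∫ s in Ioc 0 T, freeKernel (t' - s) x' * f s) - ∫ s in Ioc 0 T, freeKernel (t - s) x * f s‖
      ≤ 1 / 2 * (√|x' - x| + √√(t' - t)) * (8 * π + X) := by
    intro T x x' t t' hT0 hTt htt
    obtain ⟨u1, u2, u3⟩ := hU T hT0
    rw [Drep hf hM hT0 (hX T hT0).1 (hTt.trans htt), Drep hf hM hT0 (hX T hT0).1 hTt, ← mul_sub, norm_mul]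
    refine (mul_le_of_le_one_left (norm_nonneg _) hκ).trans ?_
    have h1 := GH u1 u2 (τ := (x' - x) ^ 2) (sq_nonneg _) (p := fun k => √2 * k * x' - k ^ 2 * t') (p' := fun k => √2 * k * x - k ^ 2 * t') (by fun_prop) (by fun_prop)
      (fun k => Or.inl (by
        rw [show √2 * k * x' - k ^ 2 * t' - (√2 * k * x - k ^ 2 * t') = √2 * (k * (x' - x)) by ring, mul_pow, Real.sq_sqrt (by norm_num)]
        exact le_of_eq (by ring)))
    have h2 := GH u1 u2 (τ := t' - t) (sub_nonneg.mpr htt) (p := fun k => √2 * k * x - k ^ 2 * t') (p' := fun k => √2 * k * x - k ^ 2 * t) (by fun_prop) (by fun_prop)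
      (fun k => Or.inr (by
        rw [show √2 * k * x - k ^ 2 * t' - (√2 * k * x - k ^ 2 * t) = -((t' - t) * k ^ 2) by ring, abs_neg, abs_of_nonneg (mul_nonneg (sub_nonneg.mpr htt) (sq_nonneg _))]))
    rw [hsd] at h1
    refine (norm_sub_le_norm_sub_add_norm_sub _ _ _).trans ((add_le_add h1 h2).trans ?_)
    rw [← add_mul, ← mul_add]
    gcongr
  refine ⟨1 / 2 * (8 * π + Y) + 1 / 2 * (8 * π + X) + 2 * M, by positivity, ?_⟩
  intro x x' t t' ht0 htt ht1
  have hspl : ∫ s in Ioc 0 t', freeKernel (t' - s) x' * f s = (∫ s in Ioc 0 t, freeKernel (t' - s) x' * f s) + ∫ s in Ioc t t', freeKernel (t' - s) x' * f s := by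
    have hi := free_int hf hM t' x'
    rw [← Ioc_union_Ioc_eq_Ioc ht0 htt]
    exact setIntegral_union (Ioc_disjoint_Ioc_of_le le_rfl) measurableSet_Ioc (hi.mono_set (Ioc_subset_Ioc_right htt)) (hi.mono_set (Ioc_subset_Ioc_left ht0))
  have e : V x' t' - V x t = (2 * (π : ℂ))⁻¹ * ((∫ k, Complex.exp (Complex.I * ((k * x' + k ^ 2 * t' : ℝ) : ℂ)) * a k) -
      ∫ k, Complex.exp (Complex.I * ((k * x + k ^ 2 * t : ℝ) : ℂ)) * a k) - γ * (((∫ s in Ioc 0 t, freeKernel (t' - s) x' * f s) - ∫ s in Ioc 0 t, freeKernel (t - s) x * f s)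
      + ∫ s in Ioc t t', freeKernel (t' - s) x' * f s) := by
    rw [hV x' t' (ht0.trans htt), hV x t ht0, hspl]; ring
  rw [e]
  refine (norm_sub_le _ _).trans ?_
  rw [norm_mul, norm_mul]
  have b1 := (mul_le_of_le_one_left (norm_nonneg _) hpi).trans (hWt x x' t t' htt)
  have b2 := (norm_add_le _ _).trans (add_le_add (hDt t x x' t t' ht0 le_rfl htt) (tail_bd hM htt x'))
  have b3 := (mul_le_of_le_one_left (norm_nonneg _) hγ).trans b2
  refine (add_le_add b1 b3).trans ?_
  have hq : √(t' - t) ≤ √√(t' - t) := by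
    set r := √(t' - t)
    have hr0 : 0 ≤ r := Real.sqrt_nonneg _
    have hr1 : r ≤ 1 := Real.sqrt_le_one.mpr (by linarith)
    apply Real.le_sqrt_of_sq_le
    nlinarith
  have h3 : M * (2 * √(t' - t)) ≤ 2 * M * (√|x' - x| + √√(t' - t)) := by
    have := Real.sqrt_nonneg |x' - x|
    nlinarith
  linarith

end

section
variable {a f : ℝ → ℂ} {M : ℝ} {U : ℂ → ℝ}

lemma mkHyp {γ : ℂ} {Mh L : ℝ} (hγ : ‖γ‖ = 1) (ha : Integrable a) (ha2 : Integrable (fun k => ‖a k‖ ^ 2)) (hak : Integrable (fun k => k ^ 2 * ‖a k‖ ^ 2))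
    (hf : Continuous f) (hM : ∀ t, ‖f t‖ ≤ M)
    {V : ℝ → ℝ → ℂ} (hV : ∀ x t, 0 ≤ t → V x t = (2 * (π : ℂ))⁻¹ * (∫ k, Complex.exp (Complex.I * ((k * x + k ^ 2 * t : ℝ) : ℂ)) * a k)
      - γ * ∫ s in Ioc 0 t, freeKernel (t - s) x * f s) (hb : ∀ x t, ‖V x t‖ ≤ Mh) (hL0 : 0 ≤ L) (hL : ∀ t s, ‖f t - f s‖ ≤ L * ‖V 0 t - V 0 s‖) :
    Hyp a f (γ * ((√(2 * π))⁻¹ : ℝ)) (V 0) M Mh L where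
  hf := hf
  hM := hM
  ha := ha
  ha2 := ha2
  hak := hak
  hc := by
    rw [norm_mul, hγ, one_mul, Complex.norm_real, Real.norm_of_nonneg (by positivity), inv_pow, Real.sq_sqrt (by positivity)]
  heq := by
    intro T t ht hTt
    rw [hV 0 t ht]
    unfold hT Gs yT
    have e1 : ∫ s in Ioc 0 T, (((√(t - s))⁻¹ : ℝ) : ℂ) * f s = ∫ s in Ioc 0 t, (((√(t - s))⁻¹ : ℝ) : ℂ) * f s := by
      apply setIntegral_eq_of_subset_of_forall_sdiff_eq_zero measurableSet_Ioc (Ioc_subset_Ioc_right hTt)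
      intro s hs
      have : t - s ≤ 0 := by
        by_contra h
        exact hs.2 ⟨hs.1.1, by linarith⟩
      rw [Real.sqrt_eq_zero_of_nonpos this]; simp
    have e2 : ∫ s in Ioc 0 t, freeKernel (t - s) 0 * f s = ((√(2 * π))⁻¹ : ℝ) * ∫ s in Ioc 0 t, (((√(t - s))⁻¹ : ℝ) : ℂ) * f s := by
      rw [← integral_const_mul]
      apply integral_congr_ae
      filter_upwards [ae_ne t t, ae_restrict_mem measurableSet_Ioc] with s hs hs2
      unfold freeKernel
      rw [free_pos (lt_of_le_of_ne (by linarith [hs2.2]) (Ne.symm hs))]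
      simp
      ring
    rw [e1, e2, ← mul_assoc]
    congr 2
    · push_cast; ring
    · congr 1; ext k; congr 4; ring
  hb := fun t _ => hb 0 t
  hL0 := hL0
  hL := fun t s _ _ => hL t s

lemma fder_eq (U : ℂ → ℝ) (z v : ℂ) : fderiv ℝ U z v = ((starRingEnd ℂ) (grad U z) * v).re := by
  have e : v = v.re • (1 : ℂ) + v.im • Complex.I := by
    rw [Complex.real_smul, Complex.real_smul, mul_one, Complex.re_add_im]
  conv_lhs => rw [e, map_add, map_smul, map_smul]
  unfold grad
  simp
  ring

lemma grad_c1 (hU : ContDiff ℝ 2 U) : ContDiff ℝ 1 (grad U) := by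
  have h1 : ContDiff ℝ 1 (fderiv ℝ U) := hU.fderiv_right (by norm_num)
  have h2 : ∀ v, ContDiff ℝ 1 (fun z => ((fderiv ℝ U z v : ℝ) : ℂ)) := fun v => Complex.ofRealCLM.contDiff.comp (h1.clm_apply contDiff_const)
  exact (h2 1).add ((h2 Complex.I).mul contDiff_const)

lemma grad_lip (hU : ContDiff ℝ 2 U) (R : ℝ) : ∃ L, 0 ≤ L ∧ ∀ z w, ‖z‖ ≤ R → ‖w‖ ≤ R → ‖grad U z - grad U w‖ ≤ L * ‖z - w‖ := by
  have hc := grad_c1 hU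
  obtain ⟨L, hL⟩ := (isCompact_closedBall (0:ℂ) R).exists_bound_of_continuousOn ((hc.continuous_fderiv (by norm_num)).continuousOn)
  refine ⟨max L 0, le_max_right _ _, fun z w hz hw => ?_⟩
  refine (convex_closedBall (0:ℂ) R).norm_image_sub_le_of_norm_fderiv_le (𝕜 := ℝ) (fun x _ => (hc.differentiable (by norm_num)) x) (fun x hx => (hL x hx).trans (le_max_left _ _)) ?_ ?_
  · simpa using hw
  · simpa using hz

lemma taylor (hU : ContDiff ℝ 2 U) {R L : ℝ} (hL0 : 0 ≤ L) (hL : ∀ z w, ‖z‖ ≤ R → ‖w‖ ≤ R → ‖grad U z - grad U w‖ ≤ L * ‖z - w‖) {z w : ℂ} (hz : ‖z‖ ≤ R) (hw : ‖w‖ ≤ R) :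
    U z - U w - L * ‖w - z‖ ^ 2 ≤ ((starRingEnd ℂ) (nonlin U z) * (w - z)).re := by
  have h1 := (convex_segment z w).norm_image_sub_le_of_norm_fderiv_le' (𝕜 := ℝ) (f := U) (φ := fderiv ℝ U z) (C := L * ‖w - z‖)
    (fun x _ => (hU.differentiable (by norm_num)) x) (fun x hx => by
      have hx1 : ‖x - z‖ ≤ ‖w - z‖ := norm_sub_le_of_mem_segment hx
      have hxR : ‖x‖ ≤ R := by
        have := (convex_closedBall (0:ℂ) R).segment_subset (x := z) (y := w) (by simpa using hz) (by simpa using hw) hx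
        simpa using this
      refine ContinuousLinearMap.opNorm_le_bound _ (by positivity) (fun v => ?_)
      rw [_root_.sub_apply, fder_eq, fder_eq, ← Complex.sub_re, ← sub_mul, ← map_sub]
      refine (Complex.abs_re_le_norm _).trans ?_
      rw [norm_mul, RCLike.norm_conj]
      gcongr
      refine (hL x z hxR hz).trans ?_
      gcongr) (left_mem_segment ℝ z w) (right_mem_segment ℝ z w)
  rw [fder_eq, Real.norm_eq_abs] at h1
  have h2 := (abs_le.mp h1).1
  unfold nonlin
  rw [map_neg, neg_mul, Complex.neg_re]
  nlinarith

lemma im_zero {u : ℝ → ℝ} (hU : ContDiff ℝ 2 U) (hUinv : ∀ z : ℂ, U z = u (‖z‖ ^ 2)) (z : ℂ) : ((starRingEnd ℂ) (nonlin U z) * z).im = 0 := by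
  have hd : HasDerivAt (fun θ : ℝ => Complex.exp ((θ : ℂ) * Complex.I) * z) (Complex.I * z) 0 := by
    have h1 : HasDerivAt (fun θ : ℝ => (θ : ℂ) * Complex.I) (1 * Complex.I) 0 := (Complex.ofRealCLM.hasDerivAt (x := 0)).mul_const Complex.I
    refine (h1.cexp.mul_const z).congr_deriv ?_
    simp
  have hz : Complex.exp (((0:ℝ) : ℂ) * Complex.I) * z = z := by simp
  have h2 : HasFDerivAt U (fderiv ℝ U z) (Complex.exp (((0:ℝ) : ℂ) * Complex.I) * z) := by
    rw [hz]; exact ((hU.differentiable (by norm_num)) z).hasFDerivAt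
  have h3 := h2.comp_hasDerivAt (0:ℝ) hd
  have e : (U ∘ fun θ : ℝ => Complex.exp ((θ : ℂ) * Complex.I) * z) = fun _ => U z := by
    ext θ
    simp only [Function.comp]
    rw [hUinv, hUinv z, norm_mul, Complex.norm_exp_ofReal_mul_I, one_mul]
  rw [e] at h3
  have h4 := h3.unique (hasDerivAt_const _ _)
  rw [fder_eq] at h4
  unfold nonlin
  simp at h4 ⊢
  linarith

lemma free_neg {s : ℝ} (hs : 0 < s) (x : ℝ) : (starRingEnd ℂ) (freeKernel (-s) x) = Complex.I * freeKernel s x := by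
  unfold freeKernel
  have hneg : 2 * π * -s ≤ 0 := by nlinarith [mul_pos Real.pi_pos hs]
  have e1 : ((2 * π * -s : ℝ) : ℂ) ^ (-(1 / 2 : ℂ)) = ((2 * π * s : ℝ) : ℂ) ^ (-(1 / 2 : ℂ)) * -Complex.I := by
    rw [Complex.ofReal_cpow_of_nonpos hneg, ← Complex.ofReal_neg, show -(2 * π * -s) = 2 * π * s by ring]
    congr 1
    rw [← Complex.exp_neg_pi_div_two_mul_I]
    congr 1; ring
  rw [e1, free_pos hs, map_mul, map_mul, Complex.conj_ofReal, map_neg, Complex.conj_I, neg_neg, ← Complex.exp_conj]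
  have e2 : (starRingEnd ℂ) (Complex.I * ((x ^ 2 : ℝ) : ℂ) / ((2 * -s : ℝ) : ℂ)) = Complex.I * ((x ^ 2 : ℝ) : ℂ) / ((2 * s : ℝ) : ℂ) := by
    rw [map_div₀, map_mul, Complex.conj_ofReal, Complex.conj_ofReal, Complex.conj_I]
    push_cast
    rw [mul_neg, neg_mul, neg_div_neg_eq]
  rw [e2]; ring

end

lemma finish {ψ : ℝ → ℝ → ℂ} {Mh C1 C2 : ℝ} (hb : ∀ x t, ‖ψ x t‖ ≤ Mh) (hC1 : 0 ≤ C1) (hC2 : 0 ≤ C2)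
    (h1 : ∀ x x' t t', 0 ≤ t → t ≤ t' → t' ≤ t + 1 → ‖ψ x' t' - ψ x t‖ ≤ C1 * (√|x' - x| + √√(t' - t)))
    (h2 : ∀ x x' t t', 0 ≤ t → t ≤ t' → t' ≤ t + 1 → ‖ψ x' (-t') - ψ x (-t)‖ ≤ C2 * (√|x' - x| + √√(t' - t))) :
    ∃ C > (0 : ℝ), ∀ x t x' t' : ℝ, ‖ψ x t - ψ x' t'‖ ≤ C * (|x - x'| ^ ((1 : ℝ) / 4) + |t - t'| ^ ((1 : ℝ) / 4)) := by
  have hMh : 0 ≤ Mh := (norm_nonneg _).trans (hb 0 0)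
  have q4 : ∀ d : ℝ, 0 ≤ d → √√d = d ^ ((1:ℝ)/4) := fun d hd => by
    rw [Real.sqrt_eq_rpow, Real.sqrt_eq_rpow, ← Real.rpow_mul hd]; norm_num
  have q2 : ∀ d : ℝ, 0 ≤ d → d ≤ 1 → √d ≤ d ^ ((1:ℝ)/4) := fun d hd hd1 => by
    rw [← q4 d hd]
    have hr1 : √d ≤ 1 := Real.sqrt_le_one.mpr hd1
    apply Real.le_sqrt_of_sq_le
    nlinarith [Real.sqrt_nonneg d]
  -- main estimate for ordered times
  have key : ∀ x t x' t' : ℝ, t ≤ t' → t' ≤ t + 1 → ‖ψ x t - ψ x' t'‖ ≤ (C1 + C2) * (√|x - x'| + √√(t' - t)) := by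
    intro x t x' t' htt ht1
    have hx0 := Real.sqrt_nonneg |x - x'|
    have ht0 := Real.sqrt_nonneg √(t' - t)
    rcases le_total 0 t with h | h
    · have := h1 x x' t t' h htt ht1
      rw [norm_sub_rev, abs_sub_comm]
      rw [abs_sub_comm] at hx0
      nlinarith
    · rcases le_total t' 0 with h' | h'
      · have := h2 x' x (-t') (-t) (by linarith) (by linarith) (by linarith)
        rw [neg_neg, neg_neg, show -t - -t' = t' - t by ring] at this
        nlinarith
      · have a1 := h2 x x 0 (-t) le_rfl (by linarith) (by linarith)
        have a2 := h1 x x' 0 t' le_rfl h' (by linarith)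
        rw [neg_neg, neg_zero, sub_self, abs_zero, Real.sqrt_zero, zero_add, sub_zero] at a1
        rw [norm_sub_rev, abs_sub_comm, sub_zero] at a2
        have b1 : √√(-t) ≤ √√(t' - t) := Real.sqrt_le_sqrt (Real.sqrt_le_sqrt (by linarith))
        have b2 : √√t' ≤ √√(t' - t) := Real.sqrt_le_sqrt (Real.sqrt_le_sqrt (by linarith))
        refine (norm_sub_le_norm_sub_add_norm_sub _ (ψ x 0) _).trans ?_
        nlinarith [mul_le_mul_of_nonneg_left b1 hC2, mul_le_mul_of_nonneg_left b2 hC1, mul_nonneg hC2 hx0]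
  refine ⟨C1 + C2 + 2 * Mh + 1, by positivity, ?_⟩
  intro x t x' t'
  have hX : 0 ≤ |x - x'| ^ ((1:ℝ)/4) := by positivity
  have hTT : 0 ≤ |t - t'| ^ ((1:ℝ)/4) := by positivity
  by_cases hs : |x - x'| ≤ 1 ∧ |t - t'| ≤ 1
  · have hk : ‖ψ x t - ψ x' t'‖ ≤ (C1 + C2) * (√|x - x'| + √√|t - t'|) := by
      rcases le_total t t' with h | h
      · have := key x t x' t' h (by linarith [(abs_le.mp hs.2).1])
        rwa [abs_sub_comm t t', abs_of_nonneg (sub_nonneg.mpr h)]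
      · have := key x' t' x t h (by linarith [(abs_le.mp hs.2).2])
        rw [norm_sub_rev, abs_sub_comm x x']
        rwa [abs_of_nonneg (sub_nonneg.mpr h)]
    rw [q4 _ (abs_nonneg _)] at hk
    have := q2 _ (abs_nonneg _) hs.1
    refine hk.trans (mul_le_mul (by linarith) (by linarith) (by positivity) (by positivity))
  · have h1 : 1 ≤ |x - x'| ^ ((1:ℝ)/4) + |t - t'| ^ ((1:ℝ)/4) := by
      rw [not_and_or, not_le, not_le] at hs
      rcases hs with h | h
      · linarith [Real.one_le_rpow h.le (by norm_num : (0:ℝ) ≤ 1 / 4)]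
      · linarith [Real.one_le_rpow h.le (by norm_num : (0:ℝ) ≤ 1 / 4)]
    have h3 := norm_sub_le (ψ x t) (ψ x' t')
    have := hb x t
    have := hb x' t'
    nlinarith

/-- **Hölder regularity of the solution.**
The solution `ψ` of the Duhamel equation with data `φ ∈ H¹(ℝ)` is Hölder
continuous of exponent `1/4` on `ℝ×ℝ`: there is `C > 0` with
`|ψ(x,t) − ψ(x',t')| ≤ C(|x−x'|^{1/4} + |t−t'|^{1/4})`. -/
theorem main_aux
    (U : ℂ → ℝ) (u : ℝ → ℝ) (A B : ℝ)
    (hU : ContDiff ℝ 2 U)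
    (hUinv : ∀ z : ℂ, U z = u (‖z‖ ^ 2))
    (hB : 0 < B)
    (hAB : ∀ z : ℂ, A - B * ‖z‖ ^ 2 ≤ U z)
    (φ : H1) (ψ : ℝ → ℝ → ℂ)
    (hcb : CbOn ψ Set.univ)
    (hsol : IsDuhamelSolution (nonlin U) φ ψ Set.univ) :
    ∃ C > (0 : ℝ), ∀ x t x' t' : ℝ,
      ‖ψ x t - ψ x' t'‖ ≤
        C * (|x - x'| ^ ((1 : ℝ) / 4) + |t - t'| ^ ((1 : ℝ) / 4)) := by
  obtain ⟨hcont, Mh, hMh⟩ := hcb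
  have hb : ∀ x t, ‖ψ x t‖ ≤ Mh := fun x t => hMh x t (Set.mem_univ _)
  have hMh0 : 0 ≤ Mh := (norm_nonneg _).trans (hb 0 0)
  have hψ0 : Continuous (fun t => ψ 0 t) := by
    have h1 : Continuous (fun p : ℝ × ℝ => ψ p.1 p.2) := by
      rw [← continuousOn_univ, ← Set.univ_prod_univ]; exact hcont
    exact h1.comp (by fun_prop : Continuous fun t : ℝ => ((0:ℝ), t))
  have hFc : Continuous (nonlin U) := (grad_c1 hU).continuous.neg
  obtain ⟨M, hM⟩ : ∃ M, ∀ z, ‖z‖ ≤ Mh → ‖nonlin U z‖ ≤ M := by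
    obtain ⟨K, hK⟩ := (isCompact_closedBall (0:ℂ) Mh).exists_bound_of_continuousOn hFc.continuousOn
    exact ⟨K, fun z hz => hK _ (by simpa using hz)⟩
  have hM0 : 0 ≤ M := (norm_nonneg _).trans (hM 0 (by simpa using hMh0))
  obtain ⟨L, hL0, hL⟩ := grad_lip hU Mh
  have hFL : ∀ z w, ‖z‖ ≤ Mh → ‖w‖ ≤ Mh → ‖nonlin U z - nonlin U w‖ ≤ L * ‖z - w‖ := by
    intro z w hz hw
    unfold nonlin
    rw [← neg_sub', norm_neg]
    exact hL z w hz hw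
  -- Fourier data
  have hk2 : Integrable (fun k : ℝ => ‖φ.hat k‖ ^ 2) := by
    refine φ.finite.mono' (φ.meas.norm.pow 2) (Eventually.of_forall (fun k => ?_))
    rw [Real.norm_of_nonneg (by positivity)]
    nlinarith [mul_nonneg (sq_nonneg k) (sq_nonneg ‖φ.hat k‖)]
  have hkk : Integrable (fun k : ℝ => k ^ 2 * ‖φ.hat k‖ ^ 2) := by
    refine (φ.finite.sub hk2).congr (Eventually.of_forall (fun k => ?_))
    simp only [Pi.sub_apply]; ring
  have hk1 : Integrable φ.hat := by
    refine Integrable.mono' (integrable_inv_one_add_sq.add φ.finite) φ.meas (Eventually.of_forall (fun k => ?_))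
    simp only [Pi.add_apply]
    have hp : 0 < 1 + k ^ 2 := by positivity
    have : (1 + k ^ 2)⁻¹ + (1 + k ^ 2) * ‖φ.hat k‖ ^ 2 - 2 * ‖φ.hat k‖ = (1 + k ^ 2)⁻¹ * (1 - (1 + k ^ 2) * ‖φ.hat k‖) ^ 2 := by
      field_simp; ring
    have h3 : 0 ≤ (1 + k ^ 2)⁻¹ * (1 - (1 + k ^ 2) * ‖φ.hat k‖) ^ 2 := by positivity
    linarith [norm_nonneg (φ.hat k)]
  -- positive times
  have pos : ∃ C, 0 ≤ C ∧ ∀ x x' t t', 0 ≤ t → t ≤ t' → t' ≤ t + 1 → ‖ψ x' t' - ψ x t‖ ≤ C * (√|x' - x| + √√(t' - t)) := by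
    have hV : ∀ x t, 0 ≤ t → ψ x t = (2 * (π : ℂ))⁻¹ * (∫ k, Complex.exp (Complex.I * ((k * x + k ^ 2 * t : ℝ) : ℂ)) * φ.hat k)
      - 1 * ∫ s in Ioc 0 t, freeKernel (t - s) x * nonlin U (ψ 0 s) := by
      intro x t ht
      rw [hsol x t (Set.mem_univ _), one_mul]
      have e := intervalIntegral.integral_comp_sub_left (a := 0) (b := t) (fun s => freeKernel s x * nonlin U (ψ 0 (t - s))) t
      simp only [sub_sub_cancel, sub_self, sub_zero] at e
      rw [← e, intervalIntegral.integral_of_le ht]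
      unfold W
      push_cast
      rfl
    have hf : Continuous (fun t => nonlin U (ψ 0 t)) := hFc.comp hψ0
    have hfM : ∀ t, ‖nonlin U (ψ 0 t)‖ ≤ M := fun t => hM _ (hb 0 t)
    have H := mkHyp (γ := 1) norm_one hk1 hk2 hkk hf hfM hV hb hL0 (fun t s => hFL _ _ (hb 0 t) (hb 0 s))
    set c : ℂ := 1 * ((√(2 * π))⁻¹ : ℝ) with hc
    set R := Mh + ‖c‖ * (M * ∫ u, rr u) with hR
    have hRM : Mh ≤ R := by
      have : 0 ≤ ∫ u, rr u := integral_nonneg rr_nonneg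
      have : 0 ≤ ‖c‖ * (M * ∫ u, rr u) := by positivity
      linarith
    obtain ⟨m, hm⟩ : ∃ m, ∀ z, ‖z‖ ≤ R → |U z| ≤ m := by
      obtain ⟨K, hK⟩ := (isCompact_closedBall (0:ℂ) R).exists_bound_of_continuousOn hU.continuous.continuousOn
      exact ⟨K, fun z hz => hK _ (by simpa using hz)⟩
    obtain ⟨L2, hL20, hL2⟩ := grad_lip hU R
    exact half (γ := 1) norm_one.le hk1 hkk hf hfM (fun T hT0 => ⟨(H.P hT0).1,
      pos_bound H (by rw [hc, one_mul]) hU.continuous hm (fun t _ w hw => taylor hU hL20 hL2 ((hb 0 t).trans hRM) hw) hL20 hT0⟩) hV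
  -- negative times
  have neg : ∃ C, 0 ≤ C ∧ ∀ x x' t t', 0 ≤ t → t ≤ t' → t' ≤ t + 1 → ‖ψ x' (-t') - ψ x (-t)‖ ≤ C * (√|x' - x| + √√(t' - t)) := by
    have hV : ∀ x t, 0 ≤ t → (starRingEnd ℂ) (ψ x (-t)) = (2 * (π : ℂ))⁻¹ * (∫ k, Complex.exp (Complex.I * ((k * x + k ^ 2 * t : ℝ) : ℂ)) * (starRingEnd ℂ) (φ.hat (-k)))
      - (-Complex.I) * ∫ s in Ioc 0 t, freeKernel (t - s) x * (starRingEnd ℂ) (nonlin U (ψ 0 (-s))) := by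
      intro x t ht
      rw [hsol x (-t) (Set.mem_univ _), map_sub]
      congr 1
      · unfold W
        rw [map_mul]
        congr 1
        · simp [map_ofNat]
        · rw [← integral_conj, ← integral_neg_eq_self]
          congr 1; ext k
          rw [map_mul, conj_eI]
          congr 4; ring
      · have e := intervalIntegral.integral_comp_sub_left (a := 0) (b := t) (fun s => Complex.I * freeKernel s x * (starRingEnd ℂ) (nonlin U (ψ 0 (-(t - s))))) t
        simp only [sub_sub_cancel, sub_self, sub_zero] at e
        have e2 := intervalIntegral.integral_comp_neg (a := 0) (b := t) (fun s => freeKernel s x * nonlin U (ψ 0 (-t - s)))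
        rw [neg_zero] at e2
        rw [intervalIntegral.integral_symm, ← e2, map_neg, neg_mul, ← integral_const_mul]
        simp_rw [← mul_assoc]
        rw [← intervalIntegral.integral_of_le ht, e, intervalIntegral.integral_of_le ht, intervalIntegral.integral_of_le ht, ← integral_conj]
        congr 1
        apply setIntegral_congr_fun measurableSet_Ioc
        intro s hs
        simp only
        rw [map_mul, free_neg hs.1, show -t - -s = -(t - s) by ring]
    have hf : Continuous (fun t => (starRingEnd ℂ) (nonlin U (ψ 0 (-t)))) := Complex.continuous_conj.comp (hFc.comp (hψ0.comp continuous_neg))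
    have hfM : ∀ t, ‖(starRingEnd ℂ) (nonlin U (ψ 0 (-t)))‖ ≤ M := fun t => by rw [RCLike.norm_conj]; exact hM _ (hb 0 _)
    have a1 : Integrable (fun k => (starRingEnd ℂ) (φ.hat (-k))) := by
      have := hk1.comp_neg
      refine this.mono (Complex.continuous_conj.comp_aestronglyMeasurable this.aestronglyMeasurable) (Eventually.of_forall (fun k => ?_))
      rw [RCLike.norm_conj]
    have a2 : Integrable (fun k => ‖(starRingEnd ℂ) (φ.hat (-k))‖ ^ 2) := by
      refine hk2.comp_neg.congr (Eventually.of_forall (fun k => ?_))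
      simp only [RCLike.norm_conj]
    have a3 : Integrable (fun k : ℝ => k ^ 2 * ‖(starRingEnd ℂ) (φ.hat (-k))‖ ^ 2) := by
      refine hkk.comp_neg.congr (Eventually.of_forall (fun k => ?_))
      simp only [RCLike.norm_conj, neg_sq]
    have hb' : ∀ x t, ‖(starRingEnd ℂ) (ψ x (-t))‖ ≤ Mh := fun x t => by rw [RCLike.norm_conj]; exact hb _ _
    have H := mkHyp (γ := -Complex.I) (V := fun x t => (starRingEnd ℂ) (ψ x (-t))) (by simp) a1 a2 a3 hf hfM hV hb' hL0 (fun t s => by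
      rw [← map_sub, ← map_sub, RCLike.norm_conj, RCLike.norm_conj]; exact hFL _ _ (hb 0 _) (hb 0 _))
    have hre : ∀ t, 0 ≤ t → ((starRingEnd ℂ) ((starRingEnd ℂ) (nonlin U (ψ 0 (-t)))) * (starRingEnd ℂ) (ψ 0 (-t))).im = 0 := by
      intro t _
      rw [← map_mul, Complex.conj_im, im_zero hU hUinv, neg_zero]
    obtain ⟨C, hC0, hC⟩ := half (γ := -Complex.I) (by simp) a1 a3 hf hfM (X := 4 * (∫ k, ‖(starRingEnd ℂ) (φ.hat (-k))‖ ^ 2) +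
        2 * (CA * M ^ 2 + L ^ 2 * CD * ((∫ k, ‖(starRingEnd ℂ) (φ.hat (-k))‖ ^ 2) + 4 * (∫ k, ‖(starRingEnd ℂ) (φ.hat (-k))‖ ^ 2)))) (fun T hT0 => by
      have hP := H.P hT0
      have hn := neg_bound H rfl hre hT0
      refine ⟨hP.1, hP.2.trans ?_⟩
      have := CD_nonneg
      gcongr) hV
    refine ⟨C, hC0, fun x x' t t' h0 h1 h2 => ?_⟩
    have := hC x x' t t' h0 h1 h2
    rwa [← map_sub, RCLike.norm_conj] at this
  obtain ⟨C1, hC1, h1⟩ := pos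
  obtain ⟨C2, hC2, h2⟩ := neg
  exact finish hb hC1 hC2 h1 h2

end SNLS
end

namespace SNLS

/-- **Hölder regularity of the solution.**
The solution `ψ` of the Duhamel equation with data `φ ∈ H¹(ℝ)` is Hölder
continuous of exponent `1/4` on `ℝ×ℝ`: there is `C > 0` with
`|ψ(x,t) − ψ(x',t')| ≤ C(|x−x'|^{1/4} + |t−t'|^{1/4})`. -/
theorem holder_regularity
    (U : ℂ → ℝ) (u : ℝ → ℝ) (A B : ℝ)
    (hU : ContDiff ℝ 2 U)
    (hUinv : ∀ z : ℂ, U z = u (‖z‖ ^ 2))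
    (hB : 0 < B)
    (hAB : ∀ z : ℂ, A - B * ‖z‖ ^ 2 ≤ U z)
    (φ : H1) (ψ : ℝ → ℝ → ℂ)
    (hcb : CbOn ψ Set.univ)
    (hsol : IsDuhamelSolution (nonlin U) φ ψ Set.univ) :
    ∃ C > (0 : ℝ), ∀ x t x' t' : ℝ,
      ‖ψ x t - ψ x' t'‖ ≤
        C * (|x - x'| ^ ((1 : ℝ) / 4) + |t - t'| ^ ((1 : ℝ) / 4)) := by
  exact main_aux U u A B hU hUinv hB hAB φ ψ hcb hsol

end SNLS
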